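/- Let SO(n) := { g ∈ M_{n×n}(ℝ) : g·gᵀ = I, det(g) = 1 }, a compact group, equipped with its Haar probability measure. For Haar-random g ∈ SO(n), write the n complex eigenvalues of g (counted with multiplicity, i.e. the roots of its characteristic polynomial over ℂ) as {e^{2πiθ_1}, …, e^{2πiθ_n}} with θ_j ∈ [−1/2, 1/2) for all j, and for an interval I ⊆ [−1/2, 1/2) let U_I^{(n)} := #{ j : θ_j ∈ I } be the number of eigenangles in I. Then there is an absolute constant C > 0 such that, uniformly over all n ≥ 1 and all intervals I ⊆ [−1/2, 1/2): | E[U_I^{(n)}] − n·|I| | ≤ C, and Var(U_I^{(n)}) ≤ C·log(2 + n·|I|). -/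

import Mathlib

open MeasureTheory
open scoped Classical

/-- The special orthogonal group `SO(n)`, as the subgroup of the orthogonal group
(real matrices `g` with `g·gᵀ = 1`) consisting of those `g` with `det g = 1`. -/
def SOGroup (n : ℕ) : Subgroup ↥(Matrix.orthogonalGroup (Fin n) ℝ) where
  carrier := {g | ((g : Matrix (Fin n) (Fin n) ℝ)).det = 1}
  one_mem' := by simp
  mul_mem' := by
    intro a b ha hb
    simp only [Set.mem_setOf_eq, Submonoid.coe_mul, Matrix.det_mul] at *
    rw [ha, hb, mul_one]
  inv_mem' := by
    intro a ha
    simp only [Set.mem_setOf_eq] at *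
    have h : ((a⁻¹ : ↥(Matrix.orthogonalGroup (Fin n) ℝ)) : Matrix (Fin n) (Fin n) ℝ)
        = star (a : Matrix (Fin n) (Fin n) ℝ) := rfl
    rw [h, Matrix.star_eq_conjTranspose, Matrix.det_conjTranspose, ha, star_one]

/-- The eigenangle `θ ∈ [−1/2, 1/2)` of a point `λ` on the unit circle, so that
`λ = e^{2πiθ}`: it is `arg λ / (2π)`, except that the angle `arg λ = π` is represented
by `θ = −1/2` instead of `1/2`. -/
noncomputable def eigenangle (l : ℂ) : ℝ :=
  if Complex.arg l = Real.pi then -(1 / 2) else Complex.arg l / (2 * Real.pi)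

/-- The number of eigenvalues (roots of the characteristic polynomial over `ℂ`, with
multiplicity) of `g ∈ SO(n)` whose eigenangle lies in `[a, b)`. -/
noncomputable def SOeigCount (n : ℕ) (g : ↥(SOGroup n)) (a b : ℝ) : ℕ :=
  Multiset.card
    (((((g : ↥(Matrix.orthogonalGroup (Fin n) ℝ)) : Matrix (Fin n) (Fin n) ℝ).map
        (Complex.ofReal)).charpoly.roots).filter
      (fun l => a ≤ eigenangle l ∧ eigenangle l < b))

/-! ### Products of power sums and the radial Laplacian -/

/-- The absolute difference of two natural numbers. -/
def absDiff (a b : ℕ) : ℕ := (a - b) + (b - a)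

/-- The monomial `∏ T k`, the product running over a list of indices. -/
def powerMon (T : ℕ → ℝ) : List ℕ → ℝ
  | [] => 1
  | k :: s => T k * powerMon T s

/-- First derivative of `powerMon T` when `T` has first derivative `D`. -/
def powerMonD (T D : ℕ → ℝ) : List ℕ → ℝ
  | [] => 0
  | k :: s => D k * powerMon T s + T k * powerMonD T D s

/-- Second derivative of `powerMon T` when `T` has derivatives `D` and `D2`. -/
def powerMonD2 (T D D2 : ℕ → ℝ) : List ℕ → ℝ
  | [] => 0
  | k :: s => D2 k * powerMon T s + 2 * (D k * powerMonD T D s) + T k * powerMonD2 T D D2 s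

/-- The radial Laplacian of the `k`-th power sum, in terms of the power sums. -/
def lapPower (T : ℕ → ℝ) (k : ℕ) : ℝ :=
  k * ∑ b ∈ Finset.range k, (T (absDiff (k - b) b) - T (k - b) * T b)

/-- The carré du champ of the power sums with indices `j` and `k`. -/
def gammaPower (T : ℕ → ℝ) (j k : ℕ) : ℝ := j * k * (T (absDiff j k) - T (j + k))

/-- The carré du champ of the `k`-th power sum and a monomial. -/
def gammaMon (T : ℕ → ℝ) (k : ℕ) : List ℕ → ℝ
  | [] => 0
  | j :: s => gammaPower T k j * powerMon T s + T j * gammaMon T k s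

/-- The radial Laplacian of a monomial in the power sums. -/
def lapMon (T : ℕ → ℝ) : List ℕ → ℝ
  | [] => 0
  | k :: s => lapPower T k * powerMon T s + T k * lapMon T s + 2 * gammaMon T k s

lemma sum_mul_powerMonD {ι : Type*} [Fintype ι] (T : ℕ → ℝ) (D : ι → ℕ → ℝ) (κ : ℝ)
    (h : ∀ j k, ∑ a, D a j * D a k = κ * gammaPower T j k) (k : ℕ) (s : List ℕ) :
    ∑ a, D a k * powerMonD T (D a) s = κ * gammaMon T k s := by
  induction s with
  | nil => simp [powerMonD, gammaMon]
  | cons j s ih =>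
    have : ∀ a, D a k * powerMonD T (D a) (j :: s)
        = (D a k * D a j) * powerMon T s + T j * (D a k * powerMonD T (D a) s) := by
      intro a; simp only [powerMonD]; ring
    simp only [this, Finset.sum_add_distrib, ← Finset.sum_mul, ← Finset.mul_sum, h, ih, gammaMon]
    ring

lemma sum_powerMonD2 {ι : Type*} [Fintype ι] (T : ℕ → ℝ) (D D2 : ι → ℕ → ℝ) (κ δ : ℝ)
    (δ' : ι → ℝ) (h : ∀ j k, ∑ a, D a j * D a k = κ * gammaPower T j k)
    (h2 : ∀ k, δ * ∑ a, D2 a k + 2 * ∑ a, δ' a * D a k = κ * (δ * lapPower T k))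
    (s : List ℕ) :
    δ * ∑ a, powerMonD2 T (D a) (D2 a) s + 2 * ∑ a, δ' a * powerMonD T (D a) s
      = κ * (δ * lapMon T s) := by
  induction s with
  | nil => simp [powerMonD, powerMonD2, lapMon]
  | cons k s ih =>
    have e1 : ∀ a, δ' a * powerMonD T (D a) (k :: s)
        = (δ' a * D a k) * powerMon T s + T k * (δ' a * powerMonD T (D a) s) := by
      intro a; simp only [powerMonD]; ring
    simp only [e1, powerMonD2, Finset.sum_add_distrib, ← Finset.sum_mul, ← Finset.mul_sum, lapMon,
      sum_mul_powerMonD T D κ h]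
    linear_combination powerMon T s * h2 k + T k * ih

/-- Pull-backs to `X` of the polynomials of weighted degree at most `d` in the power sums. -/
def powerSpan {X : Type*} (τ : X → ℕ → ℝ) (d : ℕ) : Submodule ℝ (X → ℝ) :=
  Submodule.span ℝ {φ | ∃ s : List ℕ, s.sum ≤ d ∧ φ = fun x => powerMon (τ x) s}

section powerSpan

variable {X : Type*} (τ : X → ℕ → ℝ)

lemma powerSpan_mono {d d' : ℕ} (h : d ≤ d') : powerSpan τ d ≤ powerSpan τ d' := by
  apply Submodule.span_mono
  rintro φ ⟨s, hs, rfl⟩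
  exact ⟨s, hs.trans h, rfl⟩

lemma powerMon_mem_powerSpan {d : ℕ} {s : List ℕ} (h : s.sum ≤ d) :
    (fun x => powerMon (τ x) s) ∈ powerSpan τ d :=
  Submodule.subset_span ⟨s, h, rfl⟩

lemma mul_mem_powerSpan {d k d' : ℕ} {φ : X → ℝ} (h : φ ∈ powerSpan τ d) (hd : k + d ≤ d') :
    (fun x => τ x k * φ x) ∈ powerSpan τ d' := by
  induction h using Submodule.span_induction with
  | mem φ h =>
    obtain ⟨s, hs, rfl⟩ := h
    exact powerMon_mem_powerSpan τ (s := k :: s) (by simp; omega)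
  | zero => convert Submodule.zero_mem (powerSpan τ d') using 1; funext x; simp
  | add φ ψ _ _ h1 h2 => convert Submodule.add_mem _ h1 h2 using 1; funext x; simp [mul_add]
  | smul c φ _ h =>
    convert Submodule.smul_mem _ c h using 1; funext x; simp [mul_left_comm]

lemma absDiff_le (a b : ℕ) : absDiff a b ≤ a + b := by unfold absDiff; omega

lemma gammaMon_mem_powerSpan (k : ℕ) (s : List ℕ) :
    (fun x => gammaMon (τ x) k s) ∈ powerSpan τ (k + s.sum) := by
  induction s with
  | nil => exact Submodule.zero_mem _
  | cons j s ih =>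
    have hs := powerMon_mem_powerSpan τ (le_refl s.sum)
    have a1 := mul_mem_powerSpan τ (k := absDiff k j) (d' := k + (j :: s).sum) hs
      (by have := absDiff_le k j; simp; omega)
    have a2 := mul_mem_powerSpan τ (k := k + j) (d' := k + (j :: s).sum) hs (by simp; omega)
    have a3 := mul_mem_powerSpan τ (k := j) (d' := k + (j :: s).sum) ih (by simp; omega)
    have := Submodule.add_mem _ (Submodule.smul_mem _ ((k : ℝ) * j) (Submodule.sub_mem _ a1 a2)) a3
    convert this using 1
    funext x
    simp [gammaMon, gammaPower]
    ring

lemma lapMon_mem_powerSpan (s : List ℕ) :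
    (fun x => lapMon (τ x) s) ∈ powerSpan τ s.sum := by
  induction s with
  | nil => exact Submodule.zero_mem _
  | cons k s ih =>
    have hs := powerMon_mem_powerSpan τ (le_refl s.sum)
    have a2 := mul_mem_powerSpan τ (k := k) (d' := (k :: s).sum) ih (by simp)
    have a3 := gammaMon_mem_powerSpan τ k s
    have a1 : (fun x => ∑ b ∈ Finset.range k, (τ x (absDiff (k - b) b) * powerMon (τ x) s
        - τ x (k - b) * (τ x b * powerMon (τ x) s))) ∈ powerSpan τ (k :: s).sum := by
      have := Submodule.sum_mem (powerSpan τ (k :: s).sum) (t := Finset.range k)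
        (f := fun b => fun x => (τ x (absDiff (k - b) b) * powerMon (τ x) s
          - τ x (k - b) * (τ x b * powerMon (τ x) s))) (by
          intro b hb
          rw [Finset.mem_range] at hb
          apply Submodule.sub_mem
          · exact mul_mem_powerSpan τ hs (by have := absDiff_le (k - b) b; simp; omega)
          · exact mul_mem_powerSpan τ (mul_mem_powerSpan τ hs (le_refl _)) (by simp; omega))
      convert this using 1
      funext x; simp
    have := Submodule.add_mem _ (Submodule.add_mem _ (Submodule.smul_mem _ (k : ℝ) a1) a2)
      (Submodule.smul_mem _ (2 : ℝ) a3)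
    convert this using 1
    funext x
    simp [lapMon, lapPower, Finset.sum_sub_distrib, Finset.sum_mul, Finset.mul_sum, mul_sub, sub_mul,
      mul_assoc]

lemma powerMon_filter_pos {T : ℕ → ℝ} {n : ℝ} (h0 : T 0 = n) (s : List ℕ) :
    ∃ m : ℕ, powerMon T s = n ^ m * powerMon T (s.filter (0 < ·)) ∧ m = s.count 0 := by
  induction s with
  | nil => exact ⟨0, by simp [powerMon]⟩
  | cons k s ih =>
    obtain ⟨m, h, hm⟩ := ih
    rcases Nat.eq_zero_or_pos k with rfl | hk
    · exact ⟨m + 1, by simp [powerMon, h, h0, pow_succ]; ring, by simp [hm]⟩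
    · exact ⟨m, by simp [powerMon, h, hk]; ring, by simp [hm, hk.ne']⟩

lemma length_le_sum_of_pos (s : List ℕ) (h : ∀ k ∈ s, 0 < k) : s.length ≤ s.sum := by
  induction s with
  | nil => simp
  | cons k s ih =>
    have := ih fun j hj => h j (List.mem_cons_of_mem _ hj)
    have := h k List.mem_cons_self
    simp; omega

lemma finite_pos_lists (d : ℕ) : {s : List ℕ | (∀ k ∈ s, 0 < k) ∧ s.sum ≤ d}.Finite := by
  have hfin : Set.Finite {l : List (Fin (d + 1)) | l.length ≤ d} :=
    List.finite_length_le (Fin (d + 1)) d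
  have := hfin.image (List.map (fun i : Fin (d + 1) => (i : ℕ)))
  refine this.subset ?_
  rintro s ⟨h1, h2⟩
  have hle : ∀ k ∈ s, k < d + 1 := fun k hk => by have := List.le_sum_of_mem hk; omega
  refine ⟨s.map (fun k => Fin.ofNat (d + 1) k), ?_, ?_⟩
  · simpa using (length_le_sum_of_pos s h1).trans h2
  · rw [List.map_map]
    conv_rhs => rw [← List.map_id s]
    apply List.map_congr_left
    intro k hk
    simp [Nat.mod_eq_of_lt (hle k hk)]

lemma finiteDimensional_powerSpan {n : ℝ} (h0 : ∀ x, τ x 0 = n) (d : ℕ) :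
    FiniteDimensional ℝ (powerSpan τ d) := by
  have hf := (finite_pos_lists d).image (fun s => fun x => powerMon (τ x) s)
  have : powerSpan τ d ≤ Submodule.span ℝ
      ((fun s => fun x => powerMon (τ x) s) '' {s : List ℕ | (∀ k ∈ s, 0 < k) ∧ s.sum ≤ d}) := by
    apply Submodule.span_le.2
    rintro φ ⟨s, hs, rfl⟩
    have e : (fun x => powerMon (τ x) s)
        = n ^ (s.count 0) • (fun x => powerMon (τ x) (s.filter (0 < ·))) := by
      funext x
      obtain ⟨m, hm, rfl⟩ := powerMon_filter_pos (h0 x) s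
      simpa using hm
    rw [e]
    refine Submodule.smul_mem _ _ (Submodule.subset_span ⟨_, ⟨by simp, ?_⟩, rfl⟩)
    exact (List.Sublist.sum_le_sum List.filter_sublist (by simp)).trans hs
  have := FiniteDimensional.span_of_finite ℝ hf
  exact Submodule.finiteDimensional_of_le ‹_ ≤ _›

end powerSpan

lemma linearMap_eq_of_range_ker {C V : Type*} [AddCommGroup C] [Module ℝ C] [AddCommGroup V]
    [Module ℝ V] [FiniteDimensional ℝ C] [FiniteDimensional ℝ V] (E L : C →ₗ[ℝ] V)
    (hE : Function.Surjective E) (v₀ : V) (hker : ∀ c, L c = 0 → ∃ r : ℝ, E c = r • v₀)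
    (Λ₁ Λ₂ : V →ₗ[ℝ] ℝ) (h1 : ∀ c, Λ₁ (L c) = 0) (h2 : ∀ c, Λ₂ (L c) = 0)
    (hv1 : Λ₁ v₀ = 1) (hv2 : Λ₂ v₀ = 1) : Λ₁ = Λ₂ := by
  have hle : LinearMap.range L ≤ LinearMap.ker Λ₂ := by
    rintro _ ⟨c, rfl⟩; exact h2 c
  have hv0 : v₀ ≠ 0 := by rintro rfl; simp at hv2
  have hk : LinearMap.ker L ≤ LinearMap.ker ((Submodule.span ℝ {v₀}).mkQ ∘ₗ E) := by
    intro c hc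
    obtain ⟨r, hr⟩ := hker c hc
    simp [hr]
  have e1 := LinearMap.finrank_range_add_finrank_ker L
  have e2 := LinearMap.finrank_range_add_finrank_ker ((Submodule.span ℝ {v₀}).mkQ ∘ₗ E)
  have e3 := LinearMap.finrank_range_add_finrank_ker Λ₂
  have e4 := Submodule.finrank_mono hk
  have e5 : LinearMap.range ((Submodule.span ℝ {v₀}).mkQ ∘ₗ E) = ⊤ := by
    rw [LinearMap.range_eq_top]
    exact (Submodule.mkQ_surjective _).comp hE
  have e6 : LinearMap.range Λ₂ = ⊤ := by
    rw [LinearMap.range_eq_top]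
    intro r; exact ⟨r • v₀, by simp [hv2]⟩
  have e7 := Submodule.finrank_quotient_add_finrank (Submodule.span ℝ {v₀})
  rw [finrank_span_singleton hv0] at e7
  rw [e5, finrank_top] at e2
  rw [e6, finrank_top, Module.finrank_self] at e3
  have heq := Submodule.eq_of_le_of_finrank_le hle (by omega)
  ext v
  have : v - Λ₂ v • v₀ ∈ LinearMap.ker Λ₂ := by simp [hv2]
  rw [← heq] at this
  obtain ⟨c, hc⟩ := this
  have := h1 c
  rw [hc] at this
  simp [hv1] at this
  linarith

/-! ### Power sums on the torus -/

/-- The `k`-th power sum `e + 2 ∑ cos (k θ j)`. -/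
noncomputable def torusPower {N : ℕ} (e : ℕ) (θ : Fin N → ℝ) (k : ℕ) : ℝ :=
  e + 2 * ∑ j, Real.cos (k * θ j)

lemma cos_absDiff (a b : ℕ) (x : ℝ) :
    Real.cos ((absDiff a b : ℕ) * x) = Real.cos (a * x - b * x) := by
  unfold absDiff
  rcases le_total a b with h | h
  · rw [Nat.sub_eq_zero_of_le h, zero_add, Nat.cast_sub h, ← Real.cos_neg]; ring_nf
  · rw [Nat.sub_eq_zero_of_le h, add_zero, Nat.cast_sub h]; ring_nf

lemma two_mul_sin_mul_sin (x y : ℝ) :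
    2 * (Real.sin x * Real.sin y) = Real.cos (x - y) - Real.cos (x + y) := by
  rw [Real.cos_sub, Real.cos_add]; ring

lemma sum_torus_deriv_mul {N : ℕ} (e : ℕ) (θ : Fin N → ℝ) (j k : ℕ) :
    ∑ a, (-2 * j * Real.sin (j * θ a)) * (-2 * k * Real.sin (k * θ a))
      = 1 * gammaPower (torusPower e θ) j k := by
  have : ∀ a, (-2 * j * Real.sin (j * θ a)) * (-2 * k * Real.sin (k * θ a))
      = 2 * j * k * (Real.cos ((absDiff j k : ℕ) * θ a) - Real.cos ((j + k : ℕ) * θ a)) := by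
    intro a
    have h := two_mul_sin_mul_sin (j * θ a) (k * θ a)
    rw [cos_absDiff]
    push_cast
    rw [add_mul, ← h]; ring
  simp only [this, gammaPower, torusPower, ← Finset.mul_sum, Finset.sum_sub_distrib]
  ring

/-- The sum `∑ cos (a u) cos ((k - a) v)` over `1 ≤ a ≤ k`. -/
noncomputable def cosConv (k : ℕ) (u v : ℝ) : ℝ :=
  ∑ b ∈ Finset.range k, Real.cos ((k - b : ℕ) * u) * Real.cos (b * v)

lemma two_mul_cos_sub_cos_mul_cosConv (k : ℕ) (u v : ℝ) :
    2 * ((Real.cos v - Real.cos u) * cosConv k u v)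
      = Real.cos u * Real.cos (k * v) - Real.cos ((k + 1) * u) + Real.cos (k * u) * Real.cos v
        - Real.cos ((k - 1) * v) := by
  have key : ∀ b ∈ Finset.range k,
      2 * ((Real.cos v - Real.cos u) * (Real.cos ((k - b : ℕ) * u) * Real.cos (b * v)))
      = (Real.cos ((k - ((b + 1 : ℕ) : ℝ) + 1) * u) * Real.cos ((b + 1 : ℕ) * v)
          - Real.cos ((k - (b : ℝ) + 1) * u) * Real.cos (b * v))
        - (Real.cos ((k - ((b + 1 : ℕ) : ℝ)) * u) * Real.cos ((((b + 1 : ℕ) : ℝ) - 1) * v)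
          - Real.cos ((k - (b : ℝ)) * u) * Real.cos (((b : ℝ) - 1) * v)) := by
    intro b hb
    rw [Finset.mem_range] at hb
    rw [Nat.cast_sub hb.le]
    push_cast
    have e1 : ((k : ℝ) - (b + 1) + 1) * u = (k - b) * u := by ring
    have e2 : ((k : ℝ) - b + 1) * u = (k - b) * u + u := by ring
    have e3 : ((k : ℝ) - (b + 1)) * u = (k - b) * u - u := by ring
    have e4 : ((b : ℝ) + 1) * v = b * v + v := by ring
    have e5 : ((b : ℝ) + 1 - 1) * v = b * v := by ring
    have e6 : ((b : ℝ) - 1) * v = b * v - v := by ring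
    rw [e1, e2, e3, e4, e5, e6]
    simp only [Real.cos_add, Real.cos_sub]
    ring
  unfold cosConv
  rw [Finset.mul_sum, Finset.mul_sum, Finset.sum_congr rfl key, Finset.sum_sub_distrib,
    Finset.sum_range_sub (fun b : ℕ => Real.cos ((k - (b : ℝ) + 1) * u) * Real.cos (b * v)),
    Finset.sum_range_sub
      (fun b : ℕ => Real.cos ((k - (b : ℝ)) * u) * Real.cos (((b : ℝ) - 1) * v))]
  simp
  ring

lemma cos_sub_cos_mul_cosConv_add (k : ℕ) (u v : ℝ) :
    (Real.cos v - Real.cos u) * (cosConv k u v + cosConv k v u)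
      = Real.sin u * Real.sin (k * u) - Real.sin v * Real.sin (k * v) := by
  have h1 := two_mul_cos_sub_cos_mul_cosConv k u v
  have h2 := two_mul_cos_sub_cos_mul_cosConv k v u
  have e : ∀ x : ℝ, Real.cos ((k + 1) * x) - Real.cos ((k - 1) * x)
      = -2 * (Real.sin x * Real.sin (k * x)) := by
    intro x
    rw [add_mul, sub_mul, Real.cos_add, Real.cos_sub, one_mul]; ring
  have hu := e u
  have hv := e v
  linarith

lemma sin_half_mul_sum (k : ℕ) (x : ℝ) :
    Real.sin (x / 2) * ∑ b ∈ Finset.range k, (Real.cos ((k - b : ℕ) * x) + Real.cos (b * x))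
      = Real.cos (x / 2) * Real.sin (k * x) := by
  have h1 : ∑ b ∈ Finset.range k, Real.cos ((k - b : ℕ) * x)
      = ∑ b ∈ Finset.range k, Real.cos ((b + 1 : ℕ) * x) := by
    rw [← Finset.sum_range_reflect]
    apply Finset.sum_congr rfl
    intro b hb
    rw [Finset.mem_range] at hb
    congr 3; omega
  rw [Finset.sum_add_distrib, h1, ← Finset.sum_add_distrib, Finset.mul_sum]
  have key : ∀ b ∈ Finset.range k, Real.sin (x / 2) * (Real.cos ((b + 1 : ℕ) * x)
      + Real.cos (b * x)) = Real.cos (x / 2) * Real.sin ((b + 1 : ℕ) * x)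
        - Real.cos (x / 2) * Real.sin (b * x) := by
    intro b _
    obtain ⟨y, rfl⟩ : ∃ y, x = 2 * y := ⟨x / 2, by ring⟩
    push_cast
    rw [add_mul, one_mul, mul_div_cancel_left₀ _ (by norm_num : (2 : ℝ) ≠ 0), Real.cos_add,
      Real.sin_add, Real.cos_two_mul, Real.sin_two_mul]
    linear_combination (-2 * Real.cos y * Real.sin (b * (2 * y))) * Real.sin_sq_add_cos_sq y
  rw [Finset.sum_congr rfl key,
    Finset.sum_range_sub (fun b : ℕ => Real.cos (x / 2) * Real.sin (b * x))]
  simp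

/-- The pairs `(i, j)` with `i < j`. -/
def ordPairs (N : ℕ) : Finset (Fin N × Fin N) := Finset.univ.filter (fun p => p.1 < p.2)

lemma sum_sum_eq_diag_add_ordPairs {N : ℕ} (g : Fin N → Fin N → ℝ) :
    ∑ i, ∑ j, g i j = ∑ i, g i i + ∑ p ∈ ordPairs N, (g p.1 p.2 + g p.2 p.1) := by
  have h1 : ∑ i, ∑ j, g i j = ∑ p : Fin N × Fin N, g p.1 p.2 := (Fintype.sum_prod_type' g).symm
  have h2 : ∀ p : Fin N × Fin N, g p.1 p.2 = (if p.1 = p.2 then g p.1 p.2 else 0)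
      + (if p.1 < p.2 then g p.1 p.2 else 0) + (if p.2 < p.1 then g p.1 p.2 else 0) := by
    intro p
    rcases lt_trichotomy p.1 p.2 with h | h | h
    · simp [h, h.ne, h.not_gt]
    · simp [h]
    · simp [h, h.ne', h.not_gt]
  rw [h1, Finset.sum_congr rfl (fun p _ => h2 p), Finset.sum_add_distrib, Finset.sum_add_distrib,
    add_assoc]
  congr 1
  · rw [Fintype.sum_prod_type]; simp
  · rw [Finset.sum_add_distrib, ordPairs, Finset.sum_filter, Finset.sum_filter]
    congr 1
    exact (Equiv.prodComm (Fin N) (Fin N)).sum_comp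
      (fun p => if p.1 < p.2 then g p.2 p.1 else 0) |>.symm ▸ rfl

/-- The Weyl denominator of `SO(2 N + e)`. -/
noncomputable def weylDen {N : ℕ} (e : ℕ) (θ : Fin N → ℝ) : ℝ :=
  (∏ p ∈ ordPairs N, (Real.cos (θ p.2) - Real.cos (θ p.1))) * ∏ j, Real.sin (θ j / 2) ^ e

/-- The partial derivatives of `weylDen`. -/
noncomputable def weylDenD {N : ℕ} (e : ℕ) (θ : Fin N → ℝ) (a : Fin N) : ℝ :=
  (∑ p ∈ ordPairs N, (∏ q ∈ (ordPairs N).erase p, (Real.cos (θ q.2) - Real.cos (θ q.1))) *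
      (-Real.sin (θ p.2) * (if p.2 = a then 1 else 0)
        + Real.sin (θ p.1) * (if p.1 = a then 1 else 0))) * ∏ j, Real.sin (θ j / 2) ^ e
    + (∏ p ∈ ordPairs N, (Real.cos (θ p.2) - Real.cos (θ p.1))) *
      ∑ j, (∏ i ∈ Finset.univ.erase j, Real.sin (θ i / 2) ^ e) *
        (e * Real.sin (θ j / 2) ^ (e - 1) * (Real.cos (θ j / 2) / 2) * (if j = a then 1 else 0))

lemma lapPower_torusPower {N : ℕ} {e : ℕ} (he : (e : ℝ) * e = e) (θ : Fin N → ℝ) (k : ℕ) :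
    lapPower (torusPower e θ) k = -2 * k ^ 2 * ∑ j, Real.cos (k * θ j)
      - 4 * k * ∑ p ∈ ordPairs N, (cosConv k (θ p.1) (θ p.2) + cosConv k (θ p.2) (θ p.1))
      - 2 * k * e * ∑ j, ∑ b ∈ Finset.range k,
          (Real.cos ((k - b : ℕ) * θ j) + Real.cos (b * θ j)) := by
  have hdiag : ∀ x : ℝ, 2 * cosConv k x x = k * Real.cos (k * x)
      + ∑ b ∈ Finset.range k, Real.cos ((absDiff (k - b) b : ℕ) * x) := by
    intro x
    have : (k : ℝ) * Real.cos (k * x) = ∑ b ∈ Finset.range k, Real.cos (k * x) := by simp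
    rw [this, ← Finset.sum_add_distrib, cosConv, Finset.mul_sum]
    apply Finset.sum_congr rfl
    intro b hb
    rw [Finset.mem_range] at hb
    rw [cos_absDiff, Nat.cast_sub hb.le]
    have h1 : (k : ℝ) * x = (k - b : ℝ) * x + b * x := by ring
    rw [h1, Real.cos_add, Real.cos_sub]; ring
  have hswap : ∑ b ∈ Finset.range k, (∑ i, Real.cos ((k - b : ℕ) * θ i))
      * (∑ j, Real.cos (b * θ j)) = ∑ i, ∑ j, cosConv k (θ i) (θ j) := by
    simp only [Finset.sum_mul_sum, cosConv]
    rw [Finset.sum_comm]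
    refine Finset.sum_congr rfl fun i _ => ?_
    rw [Finset.sum_comm]
  rw [sum_sum_eq_diag_add_ordPairs] at hswap
  have hd : ∑ i, 2 * cosConv k (θ i) (θ i) = k * ∑ i, Real.cos (k * θ i)
      + ∑ b ∈ Finset.range k, ∑ i, Real.cos ((absDiff (k - b) b : ℕ) * θ i) := by
    simp only [hdiag, Finset.sum_add_distrib, Finset.mul_sum]
    congr 1
    rw [Finset.sum_comm]
  rw [← Finset.mul_sum] at hd
  have hb : ∀ b ∈ Finset.range k, torusPower e θ (absDiff (k - b) b)
      - torusPower e θ (k - b) * torusPower e θ b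
      = 2 * (∑ i, Real.cos ((absDiff (k - b) b : ℕ) * θ i))
        - 4 * ((∑ i, Real.cos ((k - b : ℕ) * θ i)) * (∑ j, Real.cos (b * θ j)))
        - 2 * e * ((∑ i, Real.cos ((k - b : ℕ) * θ i)) + (∑ j, Real.cos (b * θ j))) := by
    intro b _
    unfold torusPower
    linear_combination -he
  have hc : ∑ j, ∑ b ∈ Finset.range k, (Real.cos ((k - b : ℕ) * θ j) + Real.cos (b * θ j))
      = ∑ b ∈ Finset.range k, ((∑ i, Real.cos ((k - b : ℕ) * θ i))
        + (∑ j, Real.cos (b * θ j))) := by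
    rw [Finset.sum_comm]; simp only [Finset.sum_add_distrib]
  rw [lapPower, Finset.sum_congr rfl hb, Finset.sum_sub_distrib, Finset.sum_sub_distrib,
    ← Finset.mul_sum, ← Finset.mul_sum, ← Finset.mul_sum, hswap, hc]
  linear_combination (-2 * k : ℝ) * hd

lemma weylDen_radial {N : ℕ} {e : ℕ} (he : (e : ℝ) * e = e) (θ : Fin N → ℝ) (k : ℕ) :
    weylDen e θ * ∑ a, (-2 * (k : ℝ) ^ 2 * Real.cos (k * θ a))
      + 2 * ∑ a, weylDenD e θ a * (-2 * k * Real.sin (k * θ a))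
      = 1 * (weylDen e θ * lapPower (torusPower e θ) k) := by
  set V := ∏ p ∈ ordPairs N, (Real.cos (θ p.2) - Real.cos (θ p.1)) with hV
  set W := ∏ j, Real.sin (θ j / 2) ^ e with hW
  have hδ : weylDen e θ = V * W := rfl
  have h1 : ∑ a, (∑ p ∈ ordPairs N,
      (∏ q ∈ (ordPairs N).erase p, (Real.cos (θ q.2) - Real.cos (θ q.1))) *
      (-Real.sin (θ p.2) * (if p.2 = a then 1 else 0)
        + Real.sin (θ p.1) * (if p.1 = a then 1 else 0))) * (-2 * k * Real.sin (k * θ a))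
      = -2 * k * (V * ∑ p ∈ ordPairs N,
          (cosConv k (θ p.1) (θ p.2) + cosConv k (θ p.2) (θ p.1))) := by
    simp only [Finset.sum_mul]
    rw [Finset.sum_comm, Finset.mul_sum, Finset.mul_sum]
    refine Finset.sum_congr rfl fun p hp => ?_
    rw [hV, ← Finset.mul_prod_erase _ _ hp]
    have := cos_sub_cos_mul_cosConv_add k (θ p.1) (θ p.2)
    simp only [mul_assoc, ← Finset.mul_sum, add_mul, Finset.sum_add_distrib, ite_mul, one_mul,
      zero_mul, Finset.sum_ite_eq, Finset.mem_univ, if_true]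
    linear_combination (2 * k * ∏ q ∈ (ordPairs N).erase p,
      (Real.cos (θ q.2) - Real.cos (θ q.1))) * this
  have h2 : ∑ a, (∑ j, (∏ i ∈ Finset.univ.erase j, Real.sin (θ i / 2) ^ e) *
        (e * Real.sin (θ j / 2) ^ (e - 1) * (Real.cos (θ j / 2) / 2) * (if j = a then 1 else 0)))
          * (-2 * k * Real.sin (k * θ a))
      = -k * e * (W * ∑ j, ∑ b ∈ Finset.range k,
          (Real.cos ((k - b : ℕ) * θ j) + Real.cos (b * θ j))) := by
    simp only [Finset.sum_mul]
    rw [Finset.sum_comm, Finset.mul_sum, Finset.mul_sum]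
    refine Finset.sum_congr rfl fun j _ => ?_
    rw [hW, ← Finset.mul_prod_erase _ _ (Finset.mem_univ j)]
    have := sin_half_mul_sum k (θ j)
    have hs : (e : ℝ) * Real.sin (θ j / 2) ^ e
        = e * Real.sin (θ j / 2) ^ (e - 1) * Real.sin (θ j / 2) := by
      rcases Nat.eq_zero_or_pos e with rfl | h
      · simp
      · rw [mul_assoc, ← pow_succ, Nat.sub_add_cancel h]
    simp only [mul_assoc, ← Finset.mul_sum, ite_mul, one_mul,
      zero_mul, Finset.sum_ite_eq, Finset.mem_univ, if_true]
    linear_combination (k * e * Real.sin (θ j / 2) ^ (e - 1) *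
      ∏ i ∈ Finset.univ.erase j, Real.sin (θ i / 2) ^ e) * this
      + (k * (∏ i ∈ Finset.univ.erase j, Real.sin (θ i / 2) ^ e) *
        ∑ b ∈ Finset.range k, (Real.cos ((k - b : ℕ) * θ j) + Real.cos (b * θ j))) * hs
  have h3 : ∀ a, weylDenD e θ a * (-2 * k * Real.sin (k * θ a))
      = W * ((∑ p ∈ ordPairs N,
      (∏ q ∈ (ordPairs N).erase p, (Real.cos (θ q.2) - Real.cos (θ q.1))) *
      (-Real.sin (θ p.2) * (if p.2 = a then 1 else 0)
        + Real.sin (θ p.1) * (if p.1 = a then 1 else 0))) * (-2 * k * Real.sin (k * θ a)))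
      + V * ((∑ j, (∏ i ∈ Finset.univ.erase j, Real.sin (θ i / 2) ^ e) *
        (e * Real.sin (θ j / 2) ^ (e - 1) * (Real.cos (θ j / 2) / 2) * (if j = a then 1 else 0)))
          * (-2 * k * Real.sin (k * θ a))) := by
    intro a; unfold weylDenD; ring
  rw [Finset.sum_congr rfl (fun a _ => h3 a), Finset.sum_add_distrib, ← Finset.mul_sum,
    ← Finset.mul_sum, ← Finset.mul_sum, h1, h2, lapPower_torusPower he, hδ]
  ring

/-! ### Calculus on the torus -/

lemma hasDerivAt_powerMon {T : ℝ → ℕ → ℝ} {D : ℕ → ℝ} {t : ℝ}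
    (h : ∀ k, HasDerivAt (fun x => T x k) (D k) t) (s : List ℕ) :
    HasDerivAt (fun x => powerMon (T x) s) (powerMonD (T t) D s) t := by
  induction s with
  | nil => exact hasDerivAt_const _ _
  | cons k s ih => exact (h k).mul ih

lemma hasDerivAt_powerMonD {T D : ℝ → ℕ → ℝ} {D2 : ℕ → ℝ} {t : ℝ}
    (h : ∀ k, HasDerivAt (fun x => T x k) (D t k) t)
    (h2 : ∀ k, HasDerivAt (fun x => D x k) (D2 k) t) (s : List ℕ) :
    HasDerivAt (fun x => powerMonD (T x) (D x) s) (powerMonD2 (T t) (D t) D2 s) t := by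
  induction s with
  | nil => exact hasDerivAt_const _ _
  | cons k s ih =>
    refine (((h2 k).mul (hasDerivAt_powerMon h s)).add ((h k).mul ih)).congr_deriv ?_
    simp only [powerMonD2]; ring

section torus

variable {N : ℕ}

lemma hasDerivAt_line (θ : Fin N → ℝ) (a j : Fin N) :
    HasDerivAt (fun t : ℝ => (θ + t • Pi.single a (1 : ℝ) : Fin N → ℝ) j)
      (if j = a then 1 else 0) 0 := by
  have h := ((hasDerivAt_id (0 : ℝ)).mul_const ((Pi.single a (1 : ℝ) : Fin N → ℝ) j)).const_add (θ j)
  simpa [Pi.single_apply] using h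

lemma hasLineDerivAt_cos (θ : Fin N → ℝ) (a j : Fin N) (c : ℝ) :
    HasLineDerivAt ℝ (fun θ : Fin N → ℝ => Real.cos (c * θ j))
      (-Real.sin (c * θ j) * (c * (if j = a then 1 else 0))) θ (Pi.single a 1) := by
  have h := ((hasDerivAt_line θ a j).const_mul c).cos
  simpa [HasLineDerivAt] using h

lemma hasLineDerivAt_sin (θ : Fin N → ℝ) (a j : Fin N) (c : ℝ) :
    HasLineDerivAt ℝ (fun θ : Fin N → ℝ => Real.sin (c * θ j))
      (Real.cos (c * θ j) * (c * (if j = a then 1 else 0))) θ (Pi.single a 1) := by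
  have h := ((hasDerivAt_line θ a j).const_mul c).sin
  simpa [HasLineDerivAt] using h

lemma hasLineDerivAt_torusPower (e : ℕ) (θ : Fin N → ℝ) (a : Fin N) (k : ℕ) :
    HasLineDerivAt ℝ (fun θ : Fin N → ℝ => torusPower e θ k) (-2 * k * Real.sin (k * θ a)) θ
      (Pi.single a 1) := by
  have h : HasDerivAt (fun t : ℝ => (e : ℝ) + 2 * ∑ j,
      Real.cos (k * (θ + t • Pi.single a (1 : ℝ) : Fin N → ℝ) j)) _ 0 :=
    ((HasDerivAt.fun_sum (u := Finset.univ)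
      (fun j _ => hasLineDerivAt_cos θ a j k)).const_mul 2).const_add _
  refine h.congr_deriv ?_
  simp [mul_ite]
  ring

lemma hasLineDerivAt_powerMon (e : ℕ) (θ : Fin N → ℝ) (a : Fin N) (s : List ℕ) :
    HasLineDerivAt ℝ (fun θ : Fin N → ℝ => powerMon (torusPower e θ) s)
      (powerMonD (torusPower e θ) (fun k => -2 * k * Real.sin (k * θ a)) s) θ
      (Pi.single a 1) := by
  have h := hasDerivAt_powerMon (fun k => hasLineDerivAt_torusPower e θ a k) s
  simpa [HasLineDerivAt] using h

lemma hasLineDerivAt_powerMonD (e : ℕ) (θ : Fin N → ℝ) (a : Fin N) (s : List ℕ) :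
    HasLineDerivAt ℝ (fun θ : Fin N → ℝ =>
      powerMonD (torusPower e θ) (fun k => -2 * k * Real.sin (k * θ a)) s)
      (powerMonD2 (torusPower e θ) (fun k => -2 * k * Real.sin (k * θ a))
        (fun k => -2 * (k : ℝ) ^ 2 * Real.cos (k * θ a)) s) θ (Pi.single a 1) := by
  have h := hasDerivAt_powerMonD (t := 0) (T := fun t => torusPower e (θ + t • Pi.single a (1 : ℝ)))
    (D := fun t k => -2 * k * Real.sin (k * (θ + t • Pi.single a (1 : ℝ) : Fin N → ℝ) a))
    (D2 := fun k => -2 * (k : ℝ) ^ 2 * Real.cos (k * θ a))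
    (fun k => by simpa [HasLineDerivAt] using hasLineDerivAt_torusPower e θ a k)
    (fun k => by
      have h' : HasDerivAt _ _ _ := (hasLineDerivAt_sin θ a a k).const_mul (-2 * (k : ℝ))
      refine h'.congr_deriv ?_
      simp; ring) s
  simpa [HasLineDerivAt] using h

lemma hasLineDerivAt_weylDen (e : ℕ) (θ : Fin N → ℝ) (a : Fin N) :
    HasLineDerivAt ℝ (fun θ : Fin N → ℝ => weylDen e θ) (weylDenD e θ a) θ (Pi.single a 1) := by
  have h1 : ∀ p ∈ ordPairs N, HasDerivAt (fun t : ℝ =>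
      Real.cos ((θ + t • Pi.single a (1 : ℝ) : Fin N → ℝ) p.2)
        - Real.cos ((θ + t • Pi.single a (1 : ℝ) : Fin N → ℝ) p.1))
      (-Real.sin (θ p.2) * (if p.2 = a then 1 else 0)
        + Real.sin (θ p.1) * (if p.1 = a then 1 else 0)) 0 := by
    intro p _
    refine ((hasDerivAt_line θ a p.2).cos.sub (hasDerivAt_line θ a p.1).cos).congr_deriv ?_
    simp; split_ifs <;> ring
  have h2 : ∀ j ∈ Finset.univ, HasDerivAt (fun t : ℝ =>
      Real.sin ((θ + t • Pi.single a (1 : ℝ) : Fin N → ℝ) j / 2) ^ e)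
      (e * Real.sin (θ j / 2) ^ (e - 1) * (Real.cos (θ j / 2) / 2) * (if j = a then 1 else 0))
      0 := by
    intro j _
    refine (((hasDerivAt_line θ a j).div_const 2).sin.pow e).congr_deriv ?_
    simp; split_ifs <;> ring
  have h := (HasDerivAt.fun_finsetProd h1).mul (HasDerivAt.fun_finsetProd h2)
  refine h.congr_deriv ?_
  simp [weylDenD]

lemma contDiff_torusPower (e k : ℕ) :
    ContDiff ℝ 2 (fun θ : Fin N → ℝ => torusPower e θ k) := by
  unfold torusPower; fun_prop

lemma contDiff_powerMon (e : ℕ) (s : List ℕ) :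
    ContDiff ℝ 2 (fun θ : Fin N → ℝ => powerMon (torusPower e θ) s) := by
  induction s with
  | nil => exact contDiff_const
  | cons k s ih => exact (contDiff_torusPower e k).mul ih

lemma contDiff_powerMonD (e : ℕ) (a : Fin N) (s : List ℕ) :
    ContDiff ℝ 2 (fun θ : Fin N → ℝ =>
      powerMonD (torusPower e θ) (fun k => -2 * k * Real.sin (k * θ a)) s) := by
  induction s with
  | nil => exact contDiff_const
  | cons k s ih =>
    refine ContDiff.add (ContDiff.mul (by fun_prop) (contDiff_powerMon e s))
      ((contDiff_torusPower e k).mul ih)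

lemma contDiff_weylDen (e : ℕ) : ContDiff ℝ 2 (fun θ : Fin N → ℝ => weylDen e θ) := by
  unfold weylDen
  refine ContDiff.mul (contDiff_prod fun p _ => by fun_prop) (contDiff_prod fun p _ => by fun_prop)

lemma powerMonD_eq_zero {T D : ℕ → ℝ} (h : ∀ k, D k = 0) (s : List ℕ) : powerMonD T D s = 0 := by
  induction s with
  | nil => rfl
  | cons k s ih => simp [powerMonD, ih, h]

/-- A function `φ` on the torus together with its image `l` under the radial Laplacian. -/
def IsRadialPair (e : ℕ) (p : ((Fin N → ℝ) → ℝ) × ((Fin N → ℝ) → ℝ)) : Prop :=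
  ContDiff ℝ 2 p.1 ∧ ∃ D D2 : Fin N → (Fin N → ℝ) → ℝ,
    (∀ a, ContDiff ℝ 2 (D a)) ∧
    (∀ a θ, HasLineDerivAt ℝ p.1 (D a θ) θ (Pi.single a 1)) ∧
    (∀ a θ, HasLineDerivAt ℝ (D a) (D2 a θ) θ (Pi.single a 1)) ∧
    (∀ a θ, Real.sin (θ a) = 0 → D a θ = 0) ∧
    ∀ θ, weylDen e θ * ∑ a, D2 a θ + 2 * ∑ a, weylDenD e θ a * D a θ = weylDen e θ * p.2 θ

lemma isRadialPair_powerMon {e : ℕ} (he : (e : ℝ) * e = e) (s : List ℕ) :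
    IsRadialPair (N := N) e (fun θ => powerMon (torusPower e θ) s,
      fun θ => lapMon (torusPower e θ) s) := by
  refine ⟨contDiff_powerMon e s, _, _, fun a => contDiff_powerMonD e a s,
    fun a θ => hasLineDerivAt_powerMon e θ a s, fun a θ => hasLineDerivAt_powerMonD e θ a s,
    ?_, ?_⟩
  · intro a θ h
    apply powerMonD_eq_zero
    intro k
    rw [Real.sin_eq_zero_iff] at h
    obtain ⟨n, hn⟩ := h
    rw [← hn]
    have : Real.sin ((k : ℝ) * (n * Real.pi)) = 0 := by
      rw [← mul_assoc]; exact_mod_cast Real.sin_int_mul_pi (k * n)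
    rw [this, mul_zero]
  · intro θ
    have := sum_powerMonD2 (torusPower e θ) (fun (a : Fin N) k => -2 * k * Real.sin (k * θ a))
      (fun a k => -2 * (k : ℝ) ^ 2 * Real.cos (k * θ a)) 1 (weylDen e θ) (weylDenD e θ)
      (sum_torus_deriv_mul e θ) (weylDen_radial he θ) s
    rw [one_mul] at this
    exact this

lemma IsRadialPair.add {e : ℕ} {p q : ((Fin N → ℝ) → ℝ) × ((Fin N → ℝ) → ℝ)}
    (hp : IsRadialPair e p) (hq : IsRadialPair e q) : IsRadialPair e (p + q) := by
  obtain ⟨c, D, D2, h1, h2, h3, h4, h5⟩ := hp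
  obtain ⟨c', D', D2', h1', h2', h3', h4', h5'⟩ := hq
  refine ⟨c.add c', fun a => D a + D' a, fun a => D2 a + D2' a, fun a => (h1 a).add (h1' a),
    fun a θ => HasDerivAt.add (h2 a θ) (h2' a θ), fun a θ => HasDerivAt.add (h3 a θ) (h3' a θ),
    fun a θ h => by simp [h4 a θ h, h4' a θ h], fun θ => ?_⟩
  simp only [Pi.add_apply, Finset.sum_add_distrib, Prod.snd_add, mul_add]
  linear_combination h5 θ + h5' θ

lemma IsRadialPair.smul {e : ℕ} {p : ((Fin N → ℝ) → ℝ) × ((Fin N → ℝ) → ℝ)} (c : ℝ)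
    (hp : IsRadialPair e p) : IsRadialPair e (c • p) := by
  obtain ⟨h0, D, D2, h1, h2, h3, h4, h5⟩ := hp
  refine ⟨h0.const_smul c, fun a => c • D a, fun a => c • D2 a, fun a => (h1 a).const_smul c,
    fun a θ => HasDerivAt.const_smul c (h2 a θ), fun a θ => HasDerivAt.const_smul c (h3 a θ),
    fun a θ h => by simp [h4 a θ h], fun θ => ?_⟩
  have := h5 θ
  simp only [Pi.smul_apply, smul_eq_mul, Prod.smul_snd, mul_left_comm _ c, ← Finset.mul_sum]
  linear_combination c * this

lemma isRadialPair_zero {e : ℕ} : IsRadialPair (N := N) e 0 := by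
  refine ⟨contDiff_const, fun _ _ => 0, fun _ _ => 0, fun _ => contDiff_const,
    fun a θ => hasDerivAt_const _ _, fun a θ => hasDerivAt_const _ _, fun _ _ _ => rfl, ?_⟩
  simp

/-- The integration domain `[0, π]^N`. -/
def torusBox (N : ℕ) : Set (Fin N → ℝ) := Set.Icc 0 (fun _ => Real.pi)

lemma setIntegral_radial_mul {e : ℕ} {p : ((Fin N → ℝ) → ℝ) × ((Fin N → ℝ) → ℝ)}
    (hp0 : ContDiff ℝ 2 p.1) {D D2 : Fin N → (Fin N → ℝ) → ℝ}
    (h1 : ∀ a, ContDiff ℝ 2 (D a))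
    (h3 : ∀ a θ, HasLineDerivAt ℝ (D a) (D2 a θ) θ (Pi.single a 1))
    (h4 : ∀ a θ, Real.sin (θ a) = 0 → D a θ = 0)
    (h5 : ∀ θ, weylDen e θ * ∑ a, D2 a θ + 2 * ∑ a, weylDenD e θ a * D a θ
      = weylDen e θ * p.2 θ)
    {ψ : (Fin N → ℝ) → ℝ} (hψ : ContDiff ℝ 2 ψ) {E : Fin N → (Fin N → ℝ) → ℝ}
    (hE : ∀ a θ, HasLineDerivAt ℝ ψ (E a θ) θ (Pi.single a 1)) :
    ∫ θ in torusBox N, weylDen e θ ^ 2 * (ψ θ * p.2 θ + ∑ a, E a θ * D a θ) = 0 := by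
  rcases N with _ | n
  · have : ∀ θ, p.2 θ = 0 := by
      intro θ
      have := h5 θ
      simp [weylDen, ordPairs] at this
      exact this.symm
    simp [this]
  · set F : Fin (n + 1) → (Fin (n + 1) → ℝ) → ℝ := fun a θ => weylDen e θ ^ 2 * ψ θ * D a θ with hF
    have hFc : ∀ a, ContDiff ℝ 2 (F a) := fun a =>
      (((contDiff_weylDen e).pow 2).mul hψ).mul (h1 a)
    have hFd : ∀ a θ, fderiv ℝ (F a) θ (Pi.single a 1) = 2 * weylDen e θ * weylDenD e θ a * ψ θ
        * D a θ + weylDen e θ ^ 2 * E a θ * D a θ + weylDen e θ ^ 2 * ψ θ * D2 a θ := by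
      intro a θ
      have hd : DifferentiableAt ℝ (F a) θ := (hFc a).differentiable (by norm_num) θ
      have e1 := hd.hasFDerivAt.hasLineDerivAt (Pi.single a 1)
      have e2 : HasLineDerivAt ℝ (F a) (2 * weylDen e θ * weylDenD e θ a * ψ θ
        * D a θ + weylDen e θ ^ 2 * E a θ * D a θ + weylDen e θ ^ 2 * ψ θ * D2 a θ) θ
          (Pi.single a 1) := by
        refine ((((hasLineDerivAt_weylDen e θ a).pow 2).mul (hE a θ)).mul (h3 a θ)).congr_deriv ?_
        simp; ring
      exact e1.unique e2
    have hsum : ∀ θ, ∑ a, fderiv ℝ (F a) θ (Pi.single a 1)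
        = weylDen e θ ^ 2 * (ψ θ * p.2 θ + ∑ a, E a θ * D a θ) := by
      intro θ
      have := h5 θ
      simp only [hFd, Finset.sum_add_distrib]
      have e1 : ∑ a, 2 * weylDen e θ * weylDenD e θ a * ψ θ * D a θ
          = 2 * weylDen e θ * ψ θ * ∑ a, weylDenD e θ a * D a θ := by
        rw [Finset.mul_sum]; exact Finset.sum_congr rfl fun a _ => by ring
      have e2 : ∑ a, weylDen e θ ^ 2 * E a θ * D a θ = weylDen e θ ^ 2 * ∑ a, E a θ * D a θ := by
        rw [Finset.mul_sum]; exact Finset.sum_congr rfl fun a _ => by ring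
      rw [e1, e2, ← Finset.mul_sum]
      linear_combination weylDen e θ * ψ θ * this
    have hcont : Continuous fun θ => ∑ a, fderiv ℝ (F a) θ (Pi.single a 1) :=
      continuous_finsetSum _ fun a _ => ((hFc a).continuous_fderiv (by norm_num)).clm_apply
        continuous_const
    have hdiv := integral_divergence_of_hasFDerivAt_off_countable' (E := ℝ) (0 : Fin (n + 1) → ℝ)
      (fun _ => Real.pi) (fun _ => Real.pi_pos.le) F (fun a θ => fderiv ℝ (F a) θ) ∅
      Set.countable_empty (fun a => (hFc a).continuous.continuousOn)
      (fun θ _ a => ((hFc a).differentiable (by norm_num) θ).hasFDerivAt)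
      (hcont.continuousOn.integrableOn_compact isCompact_Icc)
    simp only [hsum] at hdiv
    rw [torusBox, hdiv]
    apply Finset.sum_eq_zero
    intro a _
    have hz : ∀ θ : Fin (n + 1) → ℝ, Real.sin (θ a) = 0 → F a θ = 0 := by
      intro θ h; simp [hF, h4 a θ h]
    rw [integral_congr_ae (g := fun _ => 0) (Filter.Eventually.of_forall fun x => hz _ (by simp)),
      integral_congr_ae (g := fun _ => 0) (Filter.Eventually.of_forall fun x => hz _ (by simp))]
    simp

end torus

/-! ### Uniqueness of the invariant functional -/

section uniqueness

variable {N : ℕ}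

lemma isCompact_torusBox : IsCompact (torusBox N) := isCompact_Icc

lemma measurableSet_torusBox : MeasurableSet (torusBox N) := isCompact_torusBox.measurableSet

lemma interior_torusBox : interior (torusBox N) = Set.univ.pi fun _ => Set.Ioo 0 Real.pi := by
  rw [torusBox, ← Set.pi_univ_Icc, interior_pi_set Set.finite_univ]
  simp

lemma interior_torusBox_nonempty : (interior (torusBox N)).Nonempty := by
  rw [interior_torusBox]
  exact ⟨fun _ => Real.pi / 2, fun _ _ => ⟨by positivity, by linarith [Real.pi_pos]⟩⟩

lemma torusBox_subset_closure_interior : torusBox N ⊆ closure (interior (torusBox N)) := by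
  have h : Convex ℝ (torusBox N) := convex_Icc _ _
  rw [h.closure_interior_eq_closure_of_nonempty_interior interior_torusBox_nonempty]
  exact subset_closure

lemma volume_torusBox_pos : 0 < (volume : Measure (Fin N → ℝ)) (torusBox N) :=
  lt_of_lt_of_le (isOpen_interior.measure_pos volume interior_torusBox_nonempty)
    (measure_mono interior_subset)

lemma ae_linear_ne_zero (L : (Fin N → ℝ) →ₗ[ℝ] ℝ) (hL : L ≠ 0) :
    ∀ᵐ θ ∂(volume : Measure (Fin N → ℝ)), L θ ≠ 0 := by
  have := Measure.addHaar_submodule (volume : Measure (Fin N → ℝ)) (LinearMap.ker L)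
    (fun h => hL (LinearMap.ker_eq_top.1 h))
  rw [ae_iff]
  convert this using 2
  ext θ; simp

lemma ae_weylDen_ne_zero (e : ℕ) :
    ∀ᵐ θ ∂(volume : Measure (Fin N → ℝ)).restrict (torusBox N), weylDen e θ ≠ 0 := by
  have h1 : ∀ᵐ θ ∂(volume : Measure (Fin N → ℝ)), ∀ j, θ j ≠ 0 := by
    rw [ae_all_iff]
    intro j
    refine ae_linear_ne_zero (LinearMap.proj j) fun h => ?_
    have := congrArg (fun f => f (Pi.single j 1)) h
    simp at this
  have h2 : ∀ᵐ θ ∂(volume : Measure (Fin N → ℝ)), ∀ p ∈ ordPairs N, θ p.2 ≠ θ p.1 := by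
    rw [Finset.eventually_all]
    intro p hp
    have := ae_linear_ne_zero ((LinearMap.proj p.2 : (Fin N → ℝ) →ₗ[ℝ] ℝ)
      - (LinearMap.proj p.1 : (Fin N → ℝ) →ₗ[ℝ] ℝ)) fun h => ?_
    · filter_upwards [this] with θ hθ h
      exact hθ (by simp [h])
    · have h' := congrArg (fun f => f (Pi.single p.2 1)) h
      simp [ordPairs] at hp
      simp [hp.ne] at h'
  filter_upwards [ae_restrict_of_ae h1, ae_restrict_of_ae h2,
    ae_restrict_mem measurableSet_torusBox] with θ a1 a2 a3
  have b1 : ∀ j, 0 ≤ θ j := fun j => a3.1 j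
  have b2 : ∀ j, θ j ≤ Real.pi := fun j => a3.2 j
  refine mul_ne_zero (Finset.prod_ne_zero_iff.2 fun p hp => ?_)
    (Finset.prod_ne_zero_iff.2 fun j _ => pow_ne_zero _ ?_)
  · rw [sub_ne_zero]
    exact fun h => a2 p hp (Real.injOn_cos ⟨b1 _, b2 _⟩ ⟨b1 _, b2 _⟩ h)
  · have := lt_of_le_of_ne (b1 j) (a1 j).symm
    exact (Real.sin_pos_of_pos_of_lt_pi (by linarith) (by linarith [b2 j, Real.pi_pos])).ne'

lemma continuous_weylDen (e : ℕ) : Continuous fun θ : Fin N → ℝ => weylDen e θ :=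
  (contDiff_weylDen e).continuous

/-- The normalisation constant `∫ weylDen ^ 2` over the box. -/
noncomputable def weylNorm (N e : ℕ) : ℝ := ∫ θ in torusBox N, weylDen e θ ^ 2

lemma weylNorm_pos (N e : ℕ) : 0 < weylNorm N e := by
  have h0 : 0 ≤ weylNorm N e := integral_nonneg fun θ => sq_nonneg _
  refine lt_of_le_of_ne h0 fun h => ?_
  have hi : IntegrableOn (fun θ : Fin N → ℝ => weylDen e θ ^ 2) (torusBox N) :=
    ((continuous_weylDen e).pow 2).continuousOn.integrableOn_compact isCompact_torusBox
  have := (setIntegral_eq_zero_iff_of_nonneg_ae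
    (Filter.Eventually.of_forall fun θ => sq_nonneg (weylDen e θ)) hi).1 h.symm
  have hf : ∀ᵐ θ ∂(volume : Measure (Fin N → ℝ)).restrict (torusBox N), False := by
    filter_upwards [this, ae_weylDen_ne_zero e] with θ h1 h2
    exact h2 (by simpa using h1)
  rw [ae_iff] at hf
  simp at hf
  exact volume_torusBox_pos.ne' hf

lemma IsRadialPair.setIntegral_eq_zero {e : ℕ} {p : ((Fin N → ℝ) → ℝ) × ((Fin N → ℝ) → ℝ)}
    (hp : IsRadialPair e p) : ∫ θ in torusBox N, weylDen e θ ^ 2 * p.2 θ = 0 := by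
  obtain ⟨h0, D, D2, h1, h2, h3, h4, h5⟩ := hp
  have := setIntegral_radial_mul h0 h1 h3 h4 h5 (ψ := fun _ => 1) contDiff_const
    (E := fun _ _ => 0) (fun a θ => hasDerivAt_const _ _)
  simpa using this

lemma IsRadialPair.const_of_eq_zero {e : ℕ} {p : ((Fin N → ℝ) → ℝ) × ((Fin N → ℝ) → ℝ)}
    (hp : IsRadialPair e p) (h : ∀ θ ∈ torusBox N, p.2 θ = 0) :
    ∃ r, ∀ θ ∈ torusBox N, p.1 θ = r := by
  obtain ⟨h0, D, D2, h1, h2, h3, h4, h5⟩ := hp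
  have hIntg := setIntegral_radial_mul h0 h1 h3 h4 h5 h0 h2
  rw [setIntegral_congr_fun (g := fun θ => weylDen e θ ^ 2 * ∑ a, D a θ * D a θ)
    measurableSet_torusBox (fun θ hθ => by simp [h θ hθ])] at hIntg
  have hc : Continuous fun θ => ∑ a, D a θ * D a θ :=
    continuous_finsetSum _ fun a _ => (h1 a).continuous.mul (h1 a).continuous
  have hi := (((continuous_weylDen e).pow 2).mul hc).continuousOn.integrableOn_compact
    (μ := volume) (isCompact_torusBox (N := N))
  have hz := (setIntegral_eq_zero_iff_of_nonneg_ae (Filter.Eventually.of_forall fun θ =>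
    mul_nonneg (sq_nonneg (weylDen e θ))
      (Finset.sum_nonneg fun a _ => mul_self_nonneg (D a θ))) hi).1 hIntg
  have hae : (fun θ => ∑ a, D a θ * D a θ)
      =ᵐ[(volume : Measure (Fin N → ℝ)).restrict (torusBox N)] fun _ => 0 := by
    filter_upwards [hz, ae_weylDen_ne_zero e] with θ a1 a2
    simpa [a2] using a1
  have hD := Measure.eqOn_of_ae_eq hae hc.continuousOn continuousOn_const
    torusBox_subset_closure_interior
  have hDz : ∀ θ ∈ torusBox N, ∀ a, D a θ = 0 := by
    intro θ hθ a
    have := (Finset.sum_eq_zero_iff_of_nonneg (fun a _ => mul_self_nonneg (D a θ))).1 (hD hθ) a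
      (Finset.mem_univ a)
    simpa using this
  have hdiff : Differentiable ℝ p.1 := h0.differentiable (by norm_num)
  have hfd : ∀ θ ∈ torusBox N, fderiv ℝ p.1 θ = 0 := by
    intro θ hθ
    apply ContinuousLinearMap.coe_injective
    refine LinearMap.pi_ext' fun a => LinearMap.ext_ring ?_
    have := ((hdiff θ).hasFDerivAt.hasLineDerivAt (Pi.single a 1)).unique (h2 a θ)
    rw [hDz θ hθ a] at this
    simpa using this
  obtain ⟨θ₀, hθ₀⟩ := interior_torusBox_nonempty (N := N)
  refine ⟨p.1 θ₀, fun θ hθ => ?_⟩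
  have hE : Set.EqOn p.1 (fun _ => p.1 θ₀) (closure (interior (torusBox N))) := by
    refine Set.EqOn.closure (fun x hx => ?_) hdiff.continuous continuous_const
    exact isOpen_interior.is_const_of_fderiv_eq_zero
      ((convex_Icc _ _).interior.isPreconnected) hdiff.differentiableOn
      (fun y hy => hfd y (interior_subset hy)) hx hθ₀
  exact hE (torusBox_subset_closure_interior hθ)

lemma exists_functional {X Ω : Type*} [MeasurableSpace Ω] (μ : Measure Ω) (τ : X → ℕ → ℝ)
    (w : Ω → ℝ) (ϑ : Ω → X) (d : ℕ)
    (hIntg : ∀ s, Integrable (fun g => w g * powerMon (τ (ϑ g)) s) μ) :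
    ∃ Λ : powerSpan τ d →ₗ[ℝ] ℝ, ∀ φ, Λ φ = ∫ g, w g * φ.1 (ϑ g) ∂μ := by
  have hi : ∀ φ ∈ powerSpan τ d, Integrable (fun g => w g * φ (ϑ g)) μ := by
    intro φ hφ
    induction hφ using Submodule.span_induction with
    | mem φ h => obtain ⟨s, hs, rfl⟩ := h; exact hIntg s
    | zero => simp
    | add φ ψ _ _ h1 h2 => simp only [Pi.add_apply, mul_add]; exact h1.add h2
    | smul c φ _ h => simpa [mul_left_comm] using h.const_mul c
  refine ⟨{ toFun := fun φ => ∫ g, w g * φ.1 (ϑ g) ∂μ, map_add' := ?_, map_smul' := ?_ },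
    fun φ => rfl⟩
  · intro φ ψ
    rw [← integral_add (hi _ φ.2) (hi _ ψ.2)]
    simp [mul_add]
  · intro c φ
    simp [mul_left_comm, integral_const_mul]

/-- Weyl integration formula for polynomials in power sums: a probability measure annihilating
the radial Laplacian is given by the squared Weyl denominator. -/
theorem integral_powerMon_eq {e : ℕ} (he : (e : ℝ) * e = e) {Ω : Type*} [MeasurableSpace Ω]
    (μ : Measure Ω) [IsProbabilityMeasure μ] (ϑ : Ω → Fin N → ℝ) (hϑ : ∀ g, ϑ g ∈ torusBox N)
    (hIntg : ∀ s, Integrable (fun g => powerMon (torusPower e (ϑ g)) s) μ)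
    (hL : ∀ s, ∫ g, lapMon (torusPower e (ϑ g)) s ∂μ = 0) (s : List ℕ) :
    ∫ g, powerMon (torusPower e (ϑ g)) s ∂μ
      = (weylNorm N e)⁻¹ * ∫ θ in torusBox N, weylDen e θ ^ 2 * powerMon (torusPower e θ) s := by
  set d := s.sum with hd
  set τ : torusBox N → ℕ → ℝ := fun x => torusPower e x.1 with hτ
  have hτ0 : ∀ θ : Fin N → ℝ, torusPower e θ 0 = e + 2 * N := by intro θ; simp [torusPower]
  have fd1 := finiteDimensional_powerSpan τ (fun x => hτ0 x.1) d
  have fd2 := finiteDimensional_powerSpan (fun θ : Fin N → ℝ => torusPower e θ) hτ0 d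
  set G : Set (((Fin N → ℝ) → ℝ) × ((Fin N → ℝ) → ℝ)) :=
    {p | ∃ s : List ℕ, s.sum ≤ d ∧ p = (fun θ => powerMon (torusPower e θ) s,
      fun θ => lapMon (torusPower e θ) s)} with hG
  set C := Submodule.span ℝ G with hC
  have hCle : C ≤ (powerSpan (fun θ : Fin N → ℝ => torusPower e θ) d).prod
      (powerSpan (fun θ : Fin N → ℝ => torusPower e θ) d) := by
    refine Submodule.span_le.2 ?_
    rintro _ ⟨s, hs, rfl⟩
    exact ⟨powerMon_mem_powerSpan _ hs, powerSpan_mono _ hs (lapMon_mem_powerSpan _ s)⟩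
  have fd3 : FiniteDimensional ℝ ((powerSpan (fun θ : Fin N → ℝ => torusPower e θ) d).prod
      (powerSpan (fun θ : Fin N → ℝ => torusPower e θ) d)) :=
    Module.Finite.iff_fg.2 (Submodule.FG.prod (Module.Finite.iff_fg.1 fd2)
      (Module.Finite.iff_fg.1 fd2))
  have fdC : FiniteDimensional ℝ C := Submodule.finiteDimensional_of_le hCle
  have hrad : ∀ c ∈ C, IsRadialPair e c := by
    intro c hc
    induction hc using Submodule.span_induction with
    | mem c h => obtain ⟨s, hs, rfl⟩ := h; exact isRadialPair_powerMon he s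
    | zero => exact isRadialPair_zero
    | add _ _ _ _ h1 h2 => exact h1.add h2
    | smul c _ _ h => exact h.smul c
  set R : ((Fin N → ℝ) → ℝ) →ₗ[ℝ] (torusBox N → ℝ) := LinearMap.funLeft ℝ ℝ Subtype.val with hR
  have hRmap : (powerSpan (fun θ : Fin N → ℝ => torusPower e θ) d).map R ≤ powerSpan τ d := by
    rw [powerSpan, Submodule.map_span]
    refine Submodule.span_le.2 ?_
    rintro _ ⟨_, ⟨s, hs, rfl⟩, rfl⟩
    exact powerMon_mem_powerSpan τ hs
  set E : C →ₗ[ℝ] powerSpan τ d := ((R ∘ₗ LinearMap.fst ℝ _ _) ∘ₗ C.subtype).codRestrict _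
    (fun c => hRmap ⟨_, (hCle c.2).1, rfl⟩) with hE
  set L : C →ₗ[ℝ] powerSpan τ d := ((R ∘ₗ LinearMap.snd ℝ _ _) ∘ₗ C.subtype).codRestrict _
    (fun c => hRmap ⟨_, (hCle c.2).2, rfl⟩) with hLd
  have hEs : Function.Surjective E := by
    have : powerSpan τ d ≤ C.map (R ∘ₗ LinearMap.fst ℝ _ _) := by
      refine Submodule.span_le.2 ?_
      rintro _ ⟨s, hs, rfl⟩
      exact ⟨_, Submodule.subset_span ⟨s, hs, rfl⟩, rfl⟩
    rintro ⟨φ, hφ⟩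
    obtain ⟨c, hc, hcφ⟩ := this hφ
    exact ⟨⟨c, hc⟩, Subtype.ext hcφ⟩
  obtain ⟨Λ₁, hΛ₁⟩ := exists_functional μ τ (fun _ => 1) (fun g => ⟨ϑ g, hϑ g⟩) d
    (by simpa [hτ] using hIntg)
  obtain ⟨Λ₂, hΛ₂⟩ := exists_functional (Measure.comap Subtype.val volume) τ
    (fun x => (weylNorm N e)⁻¹ * weylDen e x.1 ^ 2) (id : torusBox N → torusBox N) d (by
      intro s
      have hc : Continuous fun θ : Fin N → ℝ => (weylNorm N e)⁻¹ * weylDen e θ ^ 2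
          * powerMon (torusPower e θ) s :=
        (continuous_const.mul ((continuous_weylDen e).pow 2)).mul
          (contDiff_powerMon e s).continuous
      exact (integrableOn_iff_comap_subtypeVal measurableSet_torusBox).1
        (hc.continuousOn.integrableOn_compact (μ := volume) isCompact_torusBox))
  have hΛ₂' : ∀ f : (Fin N → ℝ) → ℝ, ∀ h : R f ∈ powerSpan τ d, Λ₂ ⟨R f, h⟩
      = (weylNorm N e)⁻¹ * ∫ θ in torusBox N, weylDen e θ ^ 2 * f θ := by
    intro f h
    rw [hΛ₂, ← integral_const_mul, ← integral_subtype_comap measurableSet_torusBox]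
    refine integral_congr_ae (Filter.Eventually.of_forall fun x => ?_)
    change (weylNorm N e)⁻¹ * weylDen e x.1 ^ 2 * f x.1
      = (weylNorm N e)⁻¹ * (weylDen e x.1 ^ 2 * f x.1)
    ring
  have h1mem : (fun θ : Fin N → ℝ => (1 : ℝ)) ∈ powerSpan (fun θ : Fin N → ℝ => torusPower e θ) d :=
    powerMon_mem_powerSpan (fun θ : Fin N → ℝ => torusPower e θ) (s := []) (by simp)
  have heq := linearMap_eq_of_range_ker E L hEs ⟨R fun _ => 1, hRmap ⟨_, h1mem, rfl⟩⟩ (by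
      intro c hc
      obtain ⟨r, hr⟩ := (hrad c.1 c.2).const_of_eq_zero (by
        intro θ hθ
        exact congrFun (congrArg Subtype.val hc) ⟨θ, hθ⟩)
      refine ⟨r, Subtype.ext (funext fun x => ?_)⟩
      have := hr x.1 x.2
      change c.1.1 x.1 = r * 1
      rw [this, mul_one])
    Λ₁ Λ₂ (by
      have : ∀ c : C, Λ₁ (L c) = ∫ g, c.1.2 (ϑ g) ∂μ := by
        intro c; rw [hΛ₁]; simp only [one_mul]; rfl
      have hle : C ≤ (LinearMap.ker (Λ₁ ∘ₗ L)).map C.subtype := by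
        refine Submodule.span_le.2 ?_
        rintro p ⟨s, hs, rfl⟩
        refine ⟨⟨_, Submodule.subset_span ⟨s, hs, rfl⟩⟩, ?_, rfl⟩
        change Λ₁ (L _) = 0
        rw [this]
        exact hL s
      intro c
      obtain ⟨c', hc', h⟩ := hle c.2
      have h' : c' = c := Subtype.ext h
      rw [← h']
      exact hc')
    (by
      intro c
      have h := (hrad c.1 c.2).setIntegral_eq_zero
      have := hΛ₂' c.1.2 (hRmap ⟨_, (hCle c.2).2, rfl⟩)
      rw [h, mul_zero] at this
      exact this)
    (by rw [hΛ₁]; simp [hR, LinearMap.funLeft_apply])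
    (by
      rw [hΛ₂']
      simp only [mul_one]
      exact inv_mul_cancel₀ (weylNorm_pos N e).ne')
  have hmem := powerMon_mem_powerSpan (fun θ : Fin N → ℝ => torusPower e θ) (s := s) hd.ge
  have hfin := congrArg (fun Λ => Λ ⟨R fun θ => powerMon (torusPower e θ) s,
    hRmap ⟨_, hmem, rfl⟩⟩) heq
  simp only [hΛ₂'] at hfin
  rw [← hfin, hΛ₁]
  simp [hR, LinearMap.funLeft_apply]

end uniqueness

/-! ### Invariance under the orthogonal group -/

section group

variable {n : ℕ}

/-- The infinitesimal rotations. -/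
def skewUnit (n : ℕ) (p : Fin n × Fin n) : Matrix (Fin n) (Fin n) ℝ :=
  Matrix.single p.1 p.2 1 - Matrix.single p.2 p.1 1

lemma trace_single_mul_single_mul (p q r s : Fin n) (X Y : Matrix (Fin n) (Fin n) ℝ) :
    (Matrix.single p q 1 * X * Matrix.single r s 1 * Y).trace = X q r * Y s p := by
  have h : ∀ (p q : Fin n) (Z : Matrix (Fin n) (Fin n) ℝ),
      (Matrix.single p q 1 * Z).trace = Z q p := by
    intro p q Z; simp [Matrix.trace_single_mul]
  rw [mul_assoc, mul_assoc, h]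
  simp [Matrix.mul_apply, Matrix.single_apply, ite_and]

lemma sum_trace_skewUnit_mul_mul (X Y : Matrix (Fin n) (Fin n) ℝ) :
    ∑ p, (skewUnit n p * X * skewUnit n p * Y).trace
      = 2 * ((X.transpose * Y).trace - X.trace * Y.trace) := by
  have : ∀ p : Fin n × Fin n, (skewUnit n p * X * skewUnit n p * Y).trace
      = X p.2 p.1 * Y p.2 p.1 - X p.2 p.2 * Y p.1 p.1 - X p.1 p.1 * Y p.2 p.2
        + X p.1 p.2 * Y p.1 p.2 := by
    intro p
    simp only [skewUnit, sub_mul, mul_sub, Matrix.trace_sub, trace_single_mul_single_mul]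
    ring
  have e1 : (X.transpose * Y).trace = ∑ i, ∑ j, X j i * Y j i := by
    simp [Matrix.trace, Matrix.mul_apply]
  have e2 : X.trace * Y.trace = ∑ i, ∑ j, X i i * Y j j := by
    simp [Matrix.trace, Finset.sum_mul_sum]
  simp only [this, Finset.sum_add_distrib, Finset.sum_sub_distrib, Fintype.sum_prod_type]
  rw [e1, e2, Finset.sum_comm (f := fun i j => X j j * Y i i),
    Finset.sum_comm (f := fun i j => X i j * Y i j)]
  ring

lemma sum_trace_skewUnit_mul (X Y : Matrix (Fin n) (Fin n) ℝ) :
    ∑ p, (skewUnit n p * X).trace * (skewUnit n p * Y).trace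
      = 2 * ((X.transpose * Y).trace - (X * Y).trace) := by
  have : ∀ p : Fin n × Fin n, (skewUnit n p * X).trace * (skewUnit n p * Y).trace
      = X p.2 p.1 * Y p.2 p.1 - X p.2 p.1 * Y p.1 p.2 - X p.1 p.2 * Y p.2 p.1
        + X p.1 p.2 * Y p.1 p.2 := by
    intro p
    simp only [skewUnit, sub_mul, Matrix.trace_sub, Matrix.trace_single_mul, one_smul]
    ring
  have e1 : (X.transpose * Y).trace = ∑ i, ∑ j, X j i * Y j i := by
    simp [Matrix.trace, Matrix.mul_apply]
  have e2 : (X * Y).trace = ∑ i, ∑ j, X i j * Y j i := by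
    simp [Matrix.trace, Matrix.mul_apply]
  simp only [this, Finset.sum_add_distrib, Finset.sum_sub_distrib, Fintype.sum_prod_type]
  rw [e1, e2, Finset.sum_comm (f := fun i j => X j i * Y i j),
    Finset.sum_comm (f := fun i j => X i j * Y i j)]
  ring

lemma trace_pow_transpose_mul_pow {M : Matrix (Fin n) (Fin n) ℝ} (hM : M.transpose * M = 1)
    (i j : ℕ) : ((M ^ i).transpose * M ^ j).trace = (M ^ absDiff i j).trace := by
  have h1 : ∀ i, (M ^ i).transpose * M ^ i = 1 := by
    intro i
    induction i with
    | zero => simp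
    | succ i ih =>
      have e : M ^ (i + 1) = M ^ i * M := pow_succ M i
      rw [e, Matrix.transpose_mul, mul_assoc, ← mul_assoc _ (M ^ i) M, ih, one_mul, hM]
  have h2 : ∀ i d, ((M ^ i).transpose * M ^ (i + d)).trace = (M ^ d).trace := by
    intro i d
    rw [pow_add, ← mul_assoc, h1, one_mul]
  rcases le_total i j with h | h
  · obtain ⟨d, rfl⟩ := Nat.exists_eq_add_of_le h
    rw [h2]; congr 2; unfold absDiff; omega
  · obtain ⟨d, rfl⟩ := Nat.exists_eq_add_of_le h
    rw [← Matrix.trace_transpose, Matrix.transpose_mul, Matrix.transpose_transpose, h2]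
    congr 2; unfold absDiff; omega

/-- The power sums of the eigenvalues of a matrix. -/
def tracePower (M : Matrix (Fin n) (Fin n) ℝ) (k : ℕ) : ℝ := (M ^ k).trace

/-- Derivative of `tracePower` in the direction `A * M`. -/
def tracePowerD (A M : Matrix (Fin n) (Fin n) ℝ) (k : ℕ) : ℝ := k * (A * M ^ k).trace

/-- Second derivative of `tracePower` in the direction `A * M`. -/
def tracePowerD2 (A M : Matrix (Fin n) (Fin n) ℝ) (k : ℕ) : ℝ :=
  k * ∑ b ∈ Finset.range k, (A * M ^ (k - b) * A * M ^ b).trace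

lemma sum_powerMonD2_tracePower {M : Matrix (Fin n) (Fin n) ℝ} (hM : M.transpose * M = 1)
    (s : List ℕ) :
    ∑ p, powerMonD2 (tracePower M) (tracePowerD (skewUnit n p) M) (tracePowerD2 (skewUnit n p) M) s
      = 2 * lapMon (tracePower M) s := by
  have h := sum_powerMonD2 (tracePower M) (fun p => tracePowerD (skewUnit n p) M)
    (fun p => tracePowerD2 (skewUnit n p) M) 2 1 (fun _ => 0) (by
      intro j k
      have : ∀ p, tracePowerD (skewUnit n p) M j * tracePowerD (skewUnit n p) M k
          = (j * k) * ((skewUnit n p * M ^ j).trace * (skewUnit n p * M ^ k).trace) := by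
        intro p; unfold tracePowerD; ring
      simp only [this, ← Finset.mul_sum]
      rw [sum_trace_skewUnit_mul, trace_pow_transpose_mul_pow hM, ← pow_add]
      unfold gammaPower tracePower
      ring) (by
      intro k
      simp only [tracePowerD2, ← Finset.mul_sum, zero_mul, Finset.sum_const_zero, mul_zero]
      rw [Finset.sum_comm]
      simp only [sum_trace_skewUnit_mul_mul, trace_pow_transpose_mul_pow hM, lapPower, tracePower]
      rw [← Finset.mul_sum]
      ring) s
  simpa using h

section calculus

attribute [local instance] Matrix.linftyOpNormedRing Matrix.linftyOpNormedAlgebra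

lemma hasDerivAt_exp_smul_mul (A M : Matrix (Fin n) (Fin n) ℝ) (t : ℝ) :
    HasDerivAt (fun t : ℝ => NormedSpace.exp (t • A) * M) (A * (NormedSpace.exp (t • A) * M)) t := by
  have h := (hasDerivAt_exp_smul_const' (𝕂 := ℝ) A t).mul_const M
  rwa [mul_assoc] at h

lemma hasDerivAt_trace {f : ℝ → Matrix (Fin n) (Fin n) ℝ} {f' : Matrix (Fin n) (Fin n) ℝ} {t : ℝ}
    (h : HasDerivAt f f' t) : HasDerivAt (fun t => (f t).trace) f'.trace t :=
  (LinearMap.toContinuousLinearMap (Matrix.traceLinearMap (Fin n) ℝ ℝ)).hasFDerivAt.comp_hasDerivAt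
    t h

lemma hasDerivAt_matrix_pow {A : Matrix (Fin n) (Fin n) ℝ} {f : ℝ → Matrix (Fin n) (Fin n) ℝ}
    {t : ℝ} (h : HasDerivAt f (A * f t) t) (k : ℕ) :
    HasDerivAt (fun t => f t ^ k) (∑ b ∈ Finset.range k, f t ^ b * A * f t ^ (k - b)) t := by
  induction k with
  | zero =>
    simp only [pow_zero, Finset.range_zero, Finset.sum_empty]
    exact hasDerivAt_const t (1 : Matrix (Fin n) (Fin n) ℝ)
  | succ k ih =>
    have h' := ih.mul h
    simp only [pow_succ (f _) k]
    refine h'.congr_deriv ?_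
    rw [Finset.sum_range_succ, Finset.sum_mul]
    congr 1
    · refine Finset.sum_congr rfl fun b hb => ?_
      rw [Finset.mem_range] at hb
      rw [Nat.succ_sub hb.le, pow_succ, mul_assoc, mul_assoc]
    · simp [mul_assoc]

lemma hasDerivAt_tracePower (A M : Matrix (Fin n) (Fin n) ℝ) (k : ℕ) (t : ℝ) :
    HasDerivAt (fun t : ℝ => tracePower (NormedSpace.exp (t • A) * M) k)
      (tracePowerD A (NormedSpace.exp (t • A) * M) k) t := by
  have h := hasDerivAt_trace (hasDerivAt_matrix_pow (hasDerivAt_exp_smul_mul A M t) k)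
  refine h.congr_deriv ?_
  set X := NormedSpace.exp (t • A) * M
  have : ∀ b ∈ Finset.range k, (X ^ b * A * X ^ (k - b)).trace = (A * X ^ k).trace := by
    intro b hb
    rw [Finset.mem_range] at hb
    rw [mul_assoc, Matrix.trace_mul_comm, mul_assoc, ← pow_add, Nat.sub_add_cancel hb.le]
  rw [Matrix.trace_sum, Finset.sum_congr rfl this]
  simp [tracePowerD]

lemma hasDerivAt_tracePowerD (A M : Matrix (Fin n) (Fin n) ℝ) (k : ℕ) (t : ℝ) :
    HasDerivAt (fun t : ℝ => tracePowerD A (NormedSpace.exp (t • A) * M) k)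
      (tracePowerD2 A (NormedSpace.exp (t • A) * M) k) t := by
  have h := (hasDerivAt_trace ((hasDerivAt_matrix_pow (hasDerivAt_exp_smul_mul A M t) k).const_mul
    A)).const_mul (k : ℝ)
  refine h.congr_deriv ?_
  set X := NormedSpace.exp (t • A) * M
  rw [Finset.mul_sum, Matrix.trace_sum, tracePowerD2]
  congr 1
  refine Finset.sum_congr rfl fun b _ => ?_
  rw [← mul_assoc, ← mul_assoc, mul_assoc (A * X ^ b), Matrix.trace_mul_comm, ← mul_assoc]

lemma hasDerivAt_powerMonD_tracePower (A M : Matrix (Fin n) (Fin n) ℝ) (s : List ℕ) (t : ℝ) :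
    HasDerivAt (fun t : ℝ => powerMonD (tracePower (NormedSpace.exp (t • A) * M))
        (tracePowerD A (NormedSpace.exp (t • A) * M)) s)
      (powerMonD2 (tracePower (NormedSpace.exp (t • A) * M))
        (tracePowerD A (NormedSpace.exp (t • A) * M))
        (tracePowerD2 A (NormedSpace.exp (t • A) * M)) s) t :=
  hasDerivAt_powerMonD (T := fun t => tracePower (NormedSpace.exp (t • A) * M))
    (D := fun t => tracePowerD A (NormedSpace.exp (t • A) * M))
    (fun k => hasDerivAt_tracePower A M k t) (fun k => hasDerivAt_tracePowerD A M k t) s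

lemma exp_skew_mem (A : Matrix (Fin n) (Fin n) ℝ) (hA : A.transpose = -A) :
    NormedSpace.exp A ∈ Matrix.orthogonalGroup (Fin n) ℝ := by
  rw [Matrix.mem_orthogonalGroup_iff]
  change _ * (NormedSpace.exp A).transpose = 1
  rw [← Matrix.exp_transpose, hA, Matrix.exp_neg]
  exact Matrix.mul_nonsing_inv _ ((Matrix.isUnit_iff_isUnit_det _).1 (Matrix.isUnit_exp A))

lemma det_exp_skew (A : Matrix (Fin n) (Fin n) ℝ) (hA : A.transpose = -A) :
    (NormedSpace.exp A).det = 1 := by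
  have e : A = (2 : ℕ) • ((1 / 2 : ℝ) • A) := by
    rw [← Nat.cast_smul_eq_nsmul ℝ, smul_smul]; norm_num
  have h := exp_skew_mem ((1 / 2 : ℝ) • A) (by rw [Matrix.transpose_smul, hA, smul_neg])
  rw [Matrix.mem_orthogonalGroup_iff] at h
  have h' := congrArg Matrix.det h
  change (_ * (NormedSpace.exp ((1 / 2 : ℝ) • A)).transpose).det = _ at h'
  rw [Matrix.det_mul, Matrix.det_transpose, Matrix.det_one] at h'
  rw [e, Matrix.exp_nsmul, Matrix.det_pow, sq, h']

lemma skewUnit_transpose (p : Fin n × Fin n) : (skewUnit n p).transpose = -skewUnit n p := by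
  simp [skewUnit, Matrix.transpose_sub, Matrix.transpose_single]

end calculus

/-- The underlying matrix of an element of `SO(n)`. -/
def SOMat (g : SOGroup n) : Matrix (Fin n) (Fin n) ℝ := g.1.1

lemma SOMat_transpose_mul (g : SOGroup n) : (SOMat g).transpose * SOMat g = 1 :=
  (Matrix.mem_orthogonalGroup_iff' _ _).1 g.1.2

lemma SOMat_det (g : SOGroup n) : (SOMat g).det = 1 := g.2

lemma SOMat_mul (g h : SOGroup n) : SOMat (g * h) = SOMat g * SOMat h := rfl

lemma continuous_SOMat : Continuous (SOMat (n := n)) :=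
  continuous_subtype_val.comp continuous_subtype_val

lemma abs_SOMat_le (g : SOGroup n) (i j : Fin n) : |SOMat g i j| ≤ 1 := by
  have h := congrFun (congrFun (SOMat_transpose_mul g) j) j
  simp only [Matrix.mul_apply, Matrix.transpose_apply, Matrix.one_apply_eq] at h
  have := Finset.single_le_sum (f := fun i => SOMat g i j * SOMat g i j)
    (fun i _ => mul_self_nonneg _) (Finset.mem_univ i)
  rw [h] at this
  exact abs_le_one_iff_mul_self_le_one.2 this

lemma exists_bound_SOMat {F : Matrix (Fin n) (Fin n) ℝ → ℝ} (hF : Continuous F) :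
    ∃ B, ∀ g : SOGroup n, ‖F (SOMat g)‖ ≤ B := by
  have hc : IsCompact (Set.univ.pi fun _ : Fin n => Set.univ.pi fun _ : Fin n =>
      Set.Icc (-1 : ℝ) 1) := isCompact_univ_pi fun _ => isCompact_univ_pi fun _ => isCompact_Icc
  obtain ⟨B, hB⟩ := hc.exists_bound_of_continuousOn (f := F) hF.continuousOn
  exact ⟨B, fun g => hB _ fun i _ j _ => abs_le.1 (abs_SOMat_le g i j)⟩

lemma integrable_comp_SOMat [MeasurableSpace (SOGroup n)] [BorelSpace (SOGroup n)] (μ : Measure (SOGroup n))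
    [IsProbabilityMeasure μ] {F : Matrix (Fin n) (Fin n) ℝ → ℝ} (hF : Continuous F) :
    Integrable (fun g => F (SOMat g)) μ := by
  obtain ⟨B, hB⟩ := exists_bound_SOMat (n := n) hF
  exact Integrable.of_bound (hF.comp continuous_SOMat).aestronglyMeasurable B
    (Filter.Eventually.of_forall hB)

lemma integral_deriv_eq_zero [MeasurableSpace (SOGroup n)] [BorelSpace (SOGroup n)] (μ : Measure (SOGroup n))
    [μ.IsHaarMeasure] [IsProbabilityMeasure μ] {F F' : Matrix (Fin n) (Fin n) ℝ → ℝ} (hF : Continuous F)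
    (hF' : Continuous F') {A : Matrix (Fin n) (Fin n) ℝ} (hA : A.transpose = -A)
    (hd : ∀ M t, HasDerivAt (fun t : ℝ => F (NormedSpace.exp (t • A) * M))
      (F' (NormedSpace.exp (t • A) * M)) t) :
    ∫ g, F' (SOMat g) ∂μ = 0 := by
  have hA' : ∀ t : ℝ, (t • A).transpose = -(t • A) := by
    intro t; rw [Matrix.transpose_smul, hA, smul_neg]
  set R : ℝ → SOGroup n := fun t => ⟨⟨NormedSpace.exp (t • A), exp_skew_mem _ (hA' t)⟩,
    det_exp_skew _ (hA' t)⟩ with hR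
  have hRm : ∀ t, SOMat (R t) = NormedSpace.exp (t • A) := fun t => rfl
  obtain ⟨B, hB⟩ := exists_bound_SOMat (n := n) hF'
  have hcont : ∀ t : ℝ, Continuous fun g : SOGroup n => F (NormedSpace.exp (t • A) * SOMat g) :=
    fun t => hF.comp (continuous_const.mul continuous_SOMat)
  have h := hasDerivAt_integral_of_dominated_loc_of_deriv_le (μ := μ) (x₀ := (0 : ℝ))
    (F := fun t g => F (NormedSpace.exp (t • A) * SOMat g))
    (F' := fun t g => F' (NormedSpace.exp (t • A) * SOMat g)) (bound := fun _ => B)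
    (s := Set.univ) Filter.univ_mem
    (Filter.Eventually.of_forall fun t => (hcont t).aestronglyMeasurable)
    (by simpa using integrable_comp_SOMat μ hF)
    ((hF'.comp (continuous_const.mul continuous_SOMat)).aestronglyMeasurable :
      AEStronglyMeasurable (fun g => F' (NormedSpace.exp ((0 : ℝ) • A) * SOMat g)) μ)
    (Filter.Eventually.of_forall fun g t _ => by
      rw [← hRm, ← SOMat_mul]; exact hB _)
    (integrable_const B) (Filter.Eventually.of_forall fun g t _ => hd _ t)
  have hconst : (fun t : ℝ => ∫ g, F (NormedSpace.exp ((t : ℝ) • A) * SOMat g) ∂μ)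
      = fun _ => ∫ g, F (SOMat g) ∂μ := by
    funext t
    rw [← integral_mul_left_eq_self (fun g => F (SOMat g)) (R t)]
    rfl
  have h2 := h.2
  rw [hconst] at h2
  have := h2.unique (hasDerivAt_const _ _)
  simpa using this

lemma continuous_tracePower (k : ℕ) :
    Continuous fun M : Matrix (Fin n) (Fin n) ℝ => tracePower M k :=
  (continuous_id.pow k).matrix_trace

lemma continuous_tracePowerD (A : Matrix (Fin n) (Fin n) ℝ) (k : ℕ) :
    Continuous fun M : Matrix (Fin n) (Fin n) ℝ => tracePowerD A M k :=
  continuous_const.mul (continuous_const.mul (continuous_id.pow k)).matrix_trace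

lemma continuous_tracePowerD2 (A : Matrix (Fin n) (Fin n) ℝ) (k : ℕ) :
    Continuous fun M : Matrix (Fin n) (Fin n) ℝ => tracePowerD2 A M k :=
  continuous_const.mul (continuous_finsetSum _ fun b _ =>
    (((continuous_const.mul (continuous_id.pow _)).mul continuous_const).mul
      (continuous_id.pow b)).matrix_trace)

lemma continuous_powerMon_comp {X : Type*} [TopologicalSpace X] {T : X → ℕ → ℝ}
    (h : ∀ k, Continuous fun x => T x k) (s : List ℕ) : Continuous fun x => powerMon (T x) s := by
  induction s with
  | nil => exact continuous_const
  | cons k s ih => exact (h k).mul ih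

lemma continuous_powerMonD_comp {X : Type*} [TopologicalSpace X] {T D : X → ℕ → ℝ}
    (h : ∀ k, Continuous fun x => T x k) (h1 : ∀ k, Continuous fun x => D x k) (s : List ℕ) :
    Continuous fun x => powerMonD (T x) (D x) s := by
  induction s with
  | nil => exact continuous_const
  | cons k s ih => exact ((h1 k).mul (continuous_powerMon_comp h s)).add ((h k).mul ih)

lemma continuous_powerMonD2_comp {X : Type*} [TopologicalSpace X] {T D D2 : X → ℕ → ℝ}
    (h : ∀ k, Continuous fun x => T x k) (h1 : ∀ k, Continuous fun x => D x k)
    (h2 : ∀ k, Continuous fun x => D2 x k) (s : List ℕ) :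
    Continuous fun x => powerMonD2 (T x) (D x) (D2 x) s := by
  induction s with
  | nil => exact continuous_const
  | cons k s ih =>
    exact (((h2 k).mul (continuous_powerMon_comp h s)).add (continuous_const.mul
      ((h1 k).mul (continuous_powerMonD_comp h h1 s)))).add ((h k).mul ih)

theorem integral_lapMon_eq_zero [MeasurableSpace (SOGroup n)] [BorelSpace (SOGroup n)] (μ : Measure (SOGroup n))
    [μ.IsHaarMeasure] [IsProbabilityMeasure μ] (s : List ℕ) :
    ∫ g, lapMon (tracePower (SOMat g)) s ∂μ = 0 := by
  have h : ∀ p : Fin n × Fin n, ∫ g, powerMonD2 (tracePower (SOMat g))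
      (tracePowerD (skewUnit n p) (SOMat g)) (tracePowerD2 (skewUnit n p) (SOMat g)) s ∂μ = 0 :=
    fun p => integral_deriv_eq_zero μ
      (F := fun M => powerMonD (tracePower M) (tracePowerD (skewUnit n p) M) s)
      (F' := fun M => powerMonD2 (tracePower M) (tracePowerD (skewUnit n p) M)
        (tracePowerD2 (skewUnit n p) M) s)
      (continuous_powerMonD_comp continuous_tracePower (continuous_tracePowerD _) s)
      (continuous_powerMonD2_comp continuous_tracePower (continuous_tracePowerD _)
        (continuous_tracePowerD2 _) s)
      (skewUnit_transpose p) (fun M t => hasDerivAt_powerMonD_tracePower (skewUnit n p) M s t)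
  have h2 : ∫ g, (2 : ℝ) * lapMon (tracePower (SOMat g)) s ∂μ = 0 := by
    simp only [← fun g => sum_powerMonD2_tracePower (SOMat_transpose_mul g) s]
    rw [integral_finsetSum]
    · exact Finset.sum_eq_zero fun p _ => h p
    · intro p _
      exact integrable_comp_SOMat μ
        (F := fun M => powerMonD2 (tracePower M) (tracePowerD (skewUnit n p) M)
          (tracePowerD2 (skewUnit n p) M) s)
        (continuous_powerMonD2_comp continuous_tracePower (continuous_tracePowerD _)
        (continuous_tracePowerD2 _) s)
  rw [integral_const_mul] at h2
  linarith

end group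

/-! ### Eigenvalues of special orthogonal matrices -/

section eigenvalues

open Polynomial

lemma det_aeval_eq_prod_roots {n : ℕ} (A : Matrix (Fin n) (Fin n) ℂ) (p : ℂ[X]) :
    (aeval A p).det = (A.charpoly.roots.map fun l => p.eval l).prod := by
  have hc : Multiset.card A.charpoly.roots = n := by
    rw [IsAlgClosed.card_roots_eq_natDegree, Matrix.charpoly_natDegree_eq_dim, Fintype.card_fin]
  refine Submonoid.closure_induction (motive := fun p _ =>
    (aeval A p).det = (A.charpoly.roots.map fun l => p.eval l).prod) ?_ ?_ ?_ (IsAlgClosed.splits p)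
  · rintro _ (⟨a, rfl⟩ | ⟨a, rfl⟩)
    · simp [hc, Matrix.algebraMap_eq_diagonal]
    · have h1 := Matrix.eval_charpoly A (-a)
      rw [(IsAlgClosed.splits A.charpoly).eval_eq_prod_roots_of_monic A.charpoly_monic] at h1
      have h2 : Matrix.scalar (Fin n) (-a) - A = -(aeval A (X + C a)) := by
        simp [Matrix.algebraMap_eq_diagonal, sub_eq_add_neg, add_comm]
      have h3 : (A.charpoly.roots.map fun l => -a - l)
          = (A.charpoly.roots.map fun l => eval l (X + C a)).map Neg.neg := by
        rw [Multiset.map_map]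
        refine Multiset.map_congr rfl fun l _ => ?_
        simp [sub_eq_add_neg, add_comm]
      rw [h2, h3, Multiset.prod_map_neg, Matrix.det_neg] at h1
      simp only [Multiset.card_map, hc, Fintype.card_fin] at h1
      exact (mul_left_cancel₀ (pow_ne_zero _ (by norm_num)) h1).symm
  · simp
  · intro p q _ _ hp hq
    simp [hp, hq, Multiset.prod_map_mul]

lemma roots_charpoly_pow {n : ℕ} (A : Matrix (Fin n) (Fin n) ℂ) (k : ℕ) :
    (A ^ k).charpoly.roots = A.charpoly.roots.map fun l => l ^ k := by
  have : (A ^ k).charpoly = ((A.charpoly.roots.map fun l => l ^ k).map fun a => X - C a).prod := by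
    refine Polynomial.funext fun x => ?_
    have h := det_aeval_eq_prod_roots A (C x - X ^ k)
    rw [Matrix.eval_charpoly, Polynomial.eval_multiset_prod, Multiset.map_map, Multiset.map_map]
    simp only [map_sub, aeval_C, map_pow, aeval_X, eval_sub, eval_C, eval_pow, eval_X] at h
    simpa [Function.comp_def, Matrix.algebraMap_eq_diagonal, Matrix.scalar_apply, Pi.algebraMap_def] using h
  rw [this, Polynomial.roots_multiset_prod_X_sub_C]

lemma trace_pow_eq_sum_roots {n : ℕ} (A : Matrix (Fin n) (Fin n) ℂ) (k : ℕ) :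
    (A ^ k).trace = (A.charpoly.roots.map fun l => l ^ k).sum := by
  rw [Matrix.trace_eq_sum_roots_charpoly, roots_charpoly_pow]

/-- The point `e^{it}` of the unit circle. -/
noncomputable def circlePoint (t : ℝ) : ℂ := Complex.exp (t * Complex.I)

lemma exists_circlePoint (z : ℂ) (hz : ‖z‖ = 1) : ∃ t ∈ Set.Icc 0 Real.pi,
    ({z, starRingEnd ℂ z} : Multiset ℂ) = {circlePoint t, circlePoint (-t)} := by
  have hs : z.re ^ 2 + z.im ^ 2 = 1 := by
    rw [← Complex.normSq_add_mul_I z.re z.im, Complex.re_add_im, Complex.normSq_eq_norm_sq, hz]; norm_num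
  have h1 : -1 ≤ z.re := by nlinarith [sq_nonneg z.im]
  have h2 : z.re ≤ 1 := by nlinarith [sq_nonneg z.im]
  refine ⟨Real.arccos z.re, ⟨Real.arccos_nonneg _, Real.arccos_le_pi _⟩, ?_⟩
  have hc : ∀ t : ℝ, circlePoint t = ⟨Real.cos t, Real.sin t⟩ := by
    intro t
    rw [circlePoint, Complex.exp_mul_I]
    apply Complex.ext <;> simp [Complex.cos_ofReal_re, Complex.sin_ofReal_re]
  have e : Real.sin (Real.arccos z.re) = |z.im| := by
    rw [Real.sin_arccos, ← Real.sqrt_sq_eq_abs]; congr 1; linarith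
  rw [hc, hc, Real.cos_neg, Real.sin_neg, Real.cos_arccos h1 h2, e]
  rcases abs_cases z.im with ⟨h, _⟩ | ⟨h, _⟩ <;> rw [h]
  · rfl
  · rw [neg_neg, Multiset.pair_comm]; rfl

lemma exists_conj_pair (S : Multiset ℂ) (hn : ∀ z ∈ S, ‖z‖ = 1)
    (hc : S.map (starRingEnd ℂ) = S) (hp : S.prod = 1) (h2 : 2 ≤ Multiset.card S) :
    ∃ z S', S = z ::ₘ starRingEnd ℂ z ::ₘ S' := by
  by_cases hr : ∃ z ∈ S, starRingEnd ℂ z ≠ z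
  · obtain ⟨z, hz, hne⟩ := hr
    obtain ⟨S₁, h₁⟩ := Multiset.exists_cons_of_mem hz
    have : starRingEnd ℂ z ∈ S := by rw [← hc]; exact Multiset.mem_map_of_mem _ hz
    rw [h₁, Multiset.mem_cons] at this
    obtain ⟨S₂, h₂⟩ := Multiset.exists_cons_of_mem (this.resolve_left hne)
    exact ⟨z, S₂, by rw [h₁, h₂]⟩
  · push Not at hr
    have hpm : ∀ z ∈ S, z = 1 ∨ z = -1 := by
      intro z hz
      obtain ⟨r, rfl⟩ := Complex.conj_eq_iff_real.1 (hr z hz)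
      have := hn _ hz
      rw [Complex.norm_real, Real.norm_eq_abs] at this
      rcases abs_eq (by norm_num : (0 : ℝ) ≤ 1) |>.1 this with h | h <;> simp [h]
    have key : ∀ z ∈ S, ∀ S₁, S = z ::ₘ S₁ → z ∈ S₁ → ∃ z S', S = z ::ₘ starRingEnd ℂ z ::ₘ S' := by
      intro z hz S₁ h₁ h
      obtain ⟨S₂, h₂⟩ := Multiset.exists_cons_of_mem h
      exact ⟨z, S₂, by rw [hr z hz, h₁, h₂]⟩
    obtain ⟨z, hz⟩ := Multiset.card_pos_iff_exists_mem.1 (by omega : 0 < Multiset.card S)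
    obtain ⟨S₁, h₁⟩ := Multiset.exists_cons_of_mem hz
    have c₁ : Multiset.card S = Multiset.card S₁ + 1 := by rw [h₁, Multiset.card_cons]
    obtain ⟨w, hw⟩ := Multiset.card_pos_iff_exists_mem.1 (by omega : 0 < Multiset.card S₁)
    by_cases hzS : z ∈ S₁
    · exact key z hz S₁ h₁ hzS
    obtain ⟨S₂, h₂⟩ := Multiset.exists_cons_of_mem hw
    have hwS : w ∈ S := by rw [h₁]; exact Multiset.mem_cons_of_mem hw
    have hwz : w ≠ z := fun h => hzS (h ▸ hw)
    by_cases hwS₂ : w ∈ S₂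
    · refine key w hwS (z ::ₘ S₂) ?_ (Multiset.mem_cons_of_mem hwS₂)
      rw [h₁, h₂, Multiset.cons_swap]
    have h0 : S₂ = 0 := by
      refine Multiset.eq_zero_of_forall_notMem fun v hv => ?_
      have hvS₁ : v ∈ S₁ := by rw [h₂]; exact Multiset.mem_cons_of_mem hv
      have hvz : v ≠ z := fun h => hzS (h ▸ hvS₁)
      have hvw : v ≠ w := fun h => hwS₂ (h ▸ hv)
      have hvS : v ∈ S := by rw [h₁]; exact Multiset.mem_cons_of_mem hvS₁
      rcases hpm z hz with h | h <;> rcases hpm w hwS with h' | h' <;>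
        rcases hpm v hvS with h'' | h'' <;> simp_all
    exfalso
    rw [h₁, h₂, h0] at hp
    simp only [Multiset.prod_cons, Multiset.prod_zero, mul_one] at hp
    rcases hpm z hz with h | h <;> rcases hpm w hwS with h' | h' <;> rw [h, h'] at hp hwz <;>
      first | exact hwz rfl | (have := congrArg Complex.re hp; norm_num at this)

lemma exists_angles (e : ℕ) (he : e ≤ 1) (N : ℕ) : ∀ S : Multiset ℂ, (∀ z ∈ S, ‖z‖ = 1) →
    S.map (starRingEnd ℂ) = S → S.prod = 1 → Multiset.card S = 2 * N + e →
    ∃ θ ∈ torusBox N, S = Multiset.replicate e 1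
      + ∑ j, ({circlePoint (θ j), circlePoint (-θ j)} : Multiset ℂ) := by
  induction N with
  | zero =>
    intro S hn hc hp hcard
    refine ⟨0, ⟨le_refl _, fun j => j.elim0⟩, ?_⟩
    simp only [Finset.univ_eq_empty, Finset.sum_empty, add_zero]
    interval_cases e
    · simpa using hcard
    · obtain ⟨a, rfl⟩ := Multiset.card_eq_one.1 hcard
      simpa using hp
  | succ N ih =>
    intro S hn hc hp hcard
    obtain ⟨z, S', rfl⟩ := exists_conj_pair S hn hc hp (by omega)
    have hz : ‖z‖ = 1 := hn z (by simp)
    obtain ⟨t, ht, hzt⟩ := exists_circlePoint z hz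
    simp only [Multiset.map_cons, Complex.conj_conj] at hc
    rw [Multiset.cons_swap] at hc
    obtain ⟨θ, hθ, hS'⟩ := ih S' (fun w hw => hn w (by simp [hw]))
      (by simpa using hc) (by
        rw [Multiset.prod_cons, Multiset.prod_cons, ← mul_assoc, Complex.mul_conj,
          Complex.normSq_eq_norm_sq, hz] at hp
        simpa using hp) (by simp only [Multiset.card_cons] at hcard; omega)
    refine ⟨Fin.cons t θ, ⟨fun j => ?_, fun j => ?_⟩, ?_⟩
    · refine Fin.cases ?_ (fun i => ?_) j
      · exact ht.1
      · exact hθ.1 i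
    · refine Fin.cases ?_ (fun i => ?_) j
      · exact ht.2
      · exact hθ.2 i
    · simp only [Fin.sum_univ_succ, Fin.cons_zero, Fin.cons_succ]
      rw [← hzt, add_left_comm, ← hS']
      simp [Multiset.cons_add]

open scoped Matrix.Norms.L2Operator in
lemma norm_eq_one_of_mem_roots {n : ℕ} (g : SOGroup n) {z : ℂ}
    (hz : z ∈ ((SOMat g).map Complex.ofReal).charpoly.roots) : ‖z‖ = 1 := by
  have hU : (SOMat g).map Complex.ofReal ∈ unitary (Matrix (Fin n) (Fin n) ℂ) := by
    have h : star ((SOMat g).map Complex.ofReal) = (SOMat g).transpose.map Complex.ofReal := by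
      ext i j; simp
    have h1 : (SOMat g).transpose.map Complex.ofReal * (SOMat g).map Complex.ofReal = 1 := by
      have := Matrix.map_mul (L := (SOMat g).transpose) (M := SOMat g) (f := Complex.ofRealHom)
      rw [SOMat_transpose_mul] at this
      rw [show (Complex.ofReal : ℝ → ℂ) = Complex.ofRealHom from rfl, ← this]
      simp
    rw [Unitary.mem_iff, h]
    exact ⟨h1, mul_eq_one_comm.1 h1⟩
  have hs := Matrix.mem_spectrum_of_isRoot_charpoly (Polynomial.isRoot_of_mem_roots hz)
  have := spectrum.subset_circle_of_unitary hU hs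
  simpa using this

lemma map_ofReal_charpoly {n : ℕ} (M : Matrix (Fin n) (Fin n) ℝ) :
    (M.map Complex.ofReal).charpoly = M.charpoly.map Complex.ofRealHom :=
  Matrix.charpoly_map M Complex.ofRealHom

theorem exists_angles_SOMat {e : ℕ} (he : e ≤ 1) (N : ℕ) (g : SOGroup (2 * N + e)) :
    ∃ θ ∈ torusBox N, ((SOMat g).map Complex.ofReal).charpoly.roots = Multiset.replicate e 1
      + ∑ j, ({circlePoint (θ j), circlePoint (-θ j)} : Multiset ℂ) := by
  refine exists_angles e he N _ (fun z hz => norm_eq_one_of_mem_roots g hz) ?_ ?_ ?_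
  · rw [map_ofReal_charpoly]
    have := (IsAlgClosed.splits (((SOMat g).charpoly.map Complex.ofRealHom))).roots_map
      (starRingEnd ℂ)
    rw [← this, Polynomial.map_map]
    congr 2
    ext x; simp
  · rw [← Matrix.det_eq_prod_roots_charpoly]
    have := Complex.ofRealHom.map_det (SOMat g)
    rw [SOMat_det, map_one] at this
    exact this.symm
  · rw [IsAlgClosed.card_roots_eq_natDegree, Matrix.charpoly_natDegree_eq_dim, Fintype.card_fin]

lemma tracePower_eq_torusPower {e N : ℕ} {g : SOGroup (2 * N + e)} {θ : Fin N → ℝ}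
    (h : ((SOMat g).map Complex.ofReal).charpoly.roots = Multiset.replicate e 1
      + ∑ j, ({circlePoint (θ j), circlePoint (-θ j)} : Multiset ℂ)) (k : ℕ) :
    tracePower (SOMat g) k = torusPower e θ k := by
  have h1 := trace_pow_eq_sum_roots ((SOMat g).map Complex.ofReal) k
  have h2 : ((SOMat g).map Complex.ofReal ^ k).trace = ((tracePower (SOMat g) k : ℝ) : ℂ) := by
    have := Matrix.map_pow (M := SOMat g) (f := Complex.ofRealHom) (a := k)
    rw [show (Complex.ofReal : ℝ → ℂ) = Complex.ofRealHom from rfl, ← this, tracePower]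
    exact (AddMonoidHom.map_trace (Complex.ofRealHom : ℝ →+ ℂ) _).symm
  rw [h2, h] at h1
  have h3 : ∀ t : ℝ, circlePoint t ^ k + circlePoint (-t) ^ k = 2 * (Real.cos (k * t) : ℝ) := by
    intro t
    rw [circlePoint, circlePoint, ← Complex.exp_nat_mul, ← Complex.exp_nat_mul,
      Complex.ofReal_cos, Complex.cos]
    push_cast
    rw [mul_div_cancel₀ _ (by norm_num : (2 : ℂ) ≠ 0)]
    congr 2 <;> ring
  have h4 : ∀ s : Finset (Fin N), ((∑ j ∈ s, ({circlePoint (θ j), circlePoint (-θ j)} : Multiset ℂ)).map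
      fun l => l ^ k).sum = ∑ j ∈ s, 2 * ((Real.cos (k * θ j) : ℝ) : ℂ) := by
    intro s
    induction s using Finset.induction_on with
    | empty => simp
    | insert j s hj ih =>
      rw [Finset.sum_insert hj, Finset.sum_insert hj, Multiset.map_add, Multiset.sum_add, ih]
      simp [h3]
  rw [Multiset.map_add, Multiset.sum_add, h4] at h1
  apply Complex.ofReal_injective
  rw [h1, torusPower]
  simp [Finset.mul_sum]

lemma SOeigCount_eq {e N : ℕ} {g : SOGroup (2 * N + e)} {θ : Fin N → ℝ}
    (h : ((SOMat g).map Complex.ofReal).charpoly.roots = Multiset.replicate e 1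
      + ∑ j, ({circlePoint (θ j), circlePoint (-θ j)} : Multiset ℂ)) (a b : ℝ) :
    (SOeigCount (2 * N + e) g a b : ℝ) =
      e * (if a ≤ eigenangle 1 ∧ eigenangle 1 < b then 1 else 0)
      + ∑ j, ((if a ≤ eigenangle (circlePoint (θ j)) ∧ eigenangle (circlePoint (θ j)) < b
          then (1 : ℝ) else 0)
        + if a ≤ eigenangle (circlePoint (-θ j)) ∧ eigenangle (circlePoint (-θ j)) < b
          then 1 else 0) := by
  have h0 : SOeigCount (2 * N + e) g a b
      = (((SOMat g).map Complex.ofReal).charpoly.roots).countP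
        (fun l => a ≤ eigenangle l ∧ eigenangle l < b) := (Multiset.countP_eq_card_filter _ _).symm
  rw [h0, h, Multiset.countP_add]
  have h4 : ∀ s : Finset (Fin N), (((∑ j ∈ s, ({circlePoint (θ j), circlePoint (-θ j)} :
      Multiset ℂ)).countP (fun l => a ≤ eigenangle l ∧ eigenangle l < b) : ℕ) : ℝ)
      = ∑ j ∈ s, ((if a ≤ eigenangle (circlePoint (θ j)) ∧ eigenangle (circlePoint (θ j)) < b
          then (1 : ℝ) else 0)
        + if a ≤ eigenangle (circlePoint (-θ j)) ∧ eigenangle (circlePoint (-θ j)) < b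
          then 1 else 0) := by
    intro s
    induction s using Finset.induction_on with
    | empty => simp
    | insert j s hj ih =>
      rw [Finset.sum_insert hj, Finset.sum_insert hj, Multiset.countP_add, Nat.cast_add, ih]
      congr 1
      rw [Multiset.insert_eq_cons, Multiset.countP_cons, ← Multiset.cons_zero, Multiset.countP_cons]
      push_cast
      simp [add_comm]
  rw [Nat.cast_add, h4]
  congr 1
  clear h h0 h4 g
  induction e with
  | zero => simp
  | succ e ih =>
    rw [Multiset.replicate_succ, Multiset.countP_cons, Nat.cast_add, ih]
    push_cast
    ring

end eigenvalues

/-! ### Comparison of linear statistics of two random angle configurations -/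

section comparison

/-- The span of the monomials, as functions of the sequence of power sums. -/
def monSpan : Submodule ℝ ((ℕ → ℝ) → ℝ) :=
  Submodule.span ℝ (Set.range fun (s : List ℕ) (T : ℕ → ℝ) => powerMon T s)

lemma powerMon_append (T : ℕ → ℝ) (s t : List ℕ) :
    powerMon T (s ++ t) = powerMon T s * powerMon T t := by
  induction s with
  | nil => simp [powerMon]
  | cons k s ih => simp [powerMon, ih, mul_assoc]

lemma monSpan_mul {φ ψ : (ℕ → ℝ) → ℝ} (hφ : φ ∈ monSpan) (hψ : ψ ∈ monSpan) :
    φ * ψ ∈ monSpan := by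
  induction hφ using Submodule.span_induction with
  | mem x hx =>
    obtain ⟨s, rfl⟩ := hx
    induction hψ using Submodule.span_induction with
    | mem y hy =>
      obtain ⟨t, rfl⟩ := hy
      refine Submodule.subset_span ⟨s ++ t, ?_⟩
      funext T; exact powerMon_append T s t
    | zero => simp [monSpan]
    | add x y _ _ hx hy => rw [mul_add]; exact Submodule.add_mem _ hx hy
    | smul c x _ hx => rw [mul_smul_comm]; exact Submodule.smul_mem _ _ hx
  | zero => simp [monSpan]
  | add x y _ _ hx hy => rw [add_mul]; exact Submodule.add_mem _ hx hy
  | smul c x _ hx => rw [smul_mul_assoc]; exact Submodule.smul_mem _ _ hx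

/-- The span of the functions `cos (kθ)`. -/
def cosSpan : Submodule ℝ (ℝ → ℝ) :=
  Submodule.span ℝ (Set.range fun (k : ℕ) (t : ℝ) => Real.cos (k * t))

lemma cosSpan_mul_cos {u : ℝ → ℝ} (hu : u ∈ cosSpan) : (fun t => u t * Real.cos t) ∈ cosSpan := by
  induction hu using Submodule.span_induction with
  | mem x hx =>
    obtain ⟨k, rfl⟩ := hx
    have : (fun t : ℝ => Real.cos (k * t) * Real.cos t)
        = (1 / 2 : ℝ) • ((fun t : ℝ => Real.cos ((k + 1 : ℕ) * t))
          + fun t : ℝ => Real.cos (absDiff k 1 * t)) := by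
      funext t
      have := cos_absDiff k 1 t
      simp only [Pi.smul_apply, Pi.add_apply, smul_eq_mul, this]
      rw [Nat.cast_add, Nat.cast_one, add_mul, one_mul, Real.cos_add, Real.cos_sub]
      ring
    simp only [this]
    exact Submodule.smul_mem _ _ (Submodule.add_mem _ (Submodule.subset_span ⟨_, rfl⟩)
      (Submodule.subset_span ⟨_, rfl⟩))
  | zero => convert cosSpan.zero_mem using 1; funext t; simp
  | add x y _ _ hx hy =>
    have := cosSpan.add_mem hx hy
    simpa [add_mul, Pi.add_def] using this
  | smul c x _ hx =>
    have := cosSpan.smul_mem c hx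
    simpa [mul_assoc, Pi.smul_def] using this

lemma polynomial_cos_mem_cosSpan (p : Polynomial ℝ) :
    (fun t => p.eval (Real.cos t)) ∈ cosSpan := by
  induction p using Polynomial.induction_on' with
  | add p q hp hq =>
    simp only [Polynomial.eval_add]; exact cosSpan.add_mem hp hq
  | monomial m c =>
    simp only [Polynomial.eval_monomial]
    refine cosSpan.smul_mem c ?_
    induction m with
    | zero => exact Submodule.subset_span ⟨0, by funext t; simp⟩
    | succ m ih => simp only [pow_succ]; exact cosSpan_mul_cos ih

lemma exists_monSpan_sum {u : ℝ → ℝ} (hu : u ∈ cosSpan) (N e : ℕ) :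
    ∃ φ ∈ monSpan, ∀ θ : Fin N → ℝ, ∑ j, u (θ j) = φ (torusPower e θ) := by
  induction hu using Submodule.span_induction with
  | mem x hx =>
    obtain ⟨k, rfl⟩ := hx
    refine ⟨(1 / 2 : ℝ) • ((fun T => powerMon T [k]) + (-e : ℝ) • fun T => powerMon T []), ?_, ?_⟩
    · exact Submodule.smul_mem _ _ (Submodule.add_mem _ (Submodule.subset_span ⟨_, rfl⟩)
        (Submodule.smul_mem _ _ (Submodule.subset_span ⟨_, rfl⟩)))
    · intro θ
      simp [powerMon, torusPower]
  | zero => exact ⟨0, Submodule.zero_mem _, fun θ => by simp⟩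
  | add x y _ _ hx hy =>
    obtain ⟨φ, hφ, h1⟩ := hx
    obtain ⟨ψ, hψ, h2⟩ := hy
    exact ⟨φ + ψ, Submodule.add_mem _ hφ hψ, fun θ => by
      simp [Finset.sum_add_distrib, ← h1, ← h2]⟩
  | smul c x _ hx =>
    obtain ⟨φ, hφ, h1⟩ := hx
    exact ⟨c • φ, Submodule.smul_mem _ _ hφ, fun θ => by simp [← h1, Finset.mul_sum]⟩

variable {Ω Ω' : Type*} [MeasurableSpace Ω] [MeasurableSpace Ω'] {N : ℕ}

/-- The linear statistics attached to `h (cos θ)` have the same first two moments under two random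
configurations of angles. -/
structure LinStatAgree (μ : Measure Ω) (ν : Measure Ω') (x : Ω → Fin N → ℝ) (y : Ω' → Fin N → ℝ)
    (h : ℝ → ℝ) : Prop where
  left : AEStronglyMeasurable (fun g => ∑ j, h (Real.cos (x g j))) μ
  right : AEStronglyMeasurable (fun g => ∑ j, h (Real.cos (y g j))) ν
  mean : ∫ g, ∑ j, h (Real.cos (x g j)) ∂μ = ∫ g, ∑ j, h (Real.cos (y g j)) ∂ν
  sq : ∫ g, (∑ j, h (Real.cos (x g j))) ^ 2 ∂μ = ∫ g, (∑ j, h (Real.cos (y g j))) ^ 2 ∂ν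

variable {μ : Measure Ω} {ν : Measure Ω'} {x : Ω → Fin N → ℝ} {y : Ω' → Fin N → ℝ}

lemma tendsto_linStat [IsFiniteMeasure μ] {h : ℕ → ℝ → ℝ} {k : ℝ → ℝ} {B : ℝ}
    (hm : ∀ m, AEStronglyMeasurable (fun g => ∑ j, h m (Real.cos (x g j))) μ)
    (hB : ∀ m, ∀ t ∈ Set.Icc (-1 : ℝ) 1, |h m t| ≤ B)
    (hk : ∀ t ∈ Set.Icc (-1 : ℝ) 1, Filter.Tendsto (fun m => h m t) Filter.atTop (nhds (k t))) :
    AEStronglyMeasurable (fun g => ∑ j, k (Real.cos (x g j))) μ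
    ∧ Filter.Tendsto (fun m => ∫ g, ∑ j, h m (Real.cos (x g j)) ∂μ) Filter.atTop
      (nhds (∫ g, ∑ j, k (Real.cos (x g j)) ∂μ))
    ∧ Filter.Tendsto (fun m => ∫ g, (∑ j, h m (Real.cos (x g j))) ^ 2 ∂μ) Filter.atTop
      (nhds (∫ g, (∑ j, k (Real.cos (x g j))) ^ 2 ∂μ)) := by
  have ht : ∀ g, Filter.Tendsto (fun m => ∑ j, h m (Real.cos (x g j))) Filter.atTop
      (nhds (∑ j, k (Real.cos (x g j)))) := fun g =>
    tendsto_finsetSum _ fun j _ => hk _ ⟨Real.neg_one_le_cos _, Real.cos_le_one _⟩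
  have hb : ∀ m g, |∑ j, h m (Real.cos (x g j))| ≤ N * B := by
    intro m g
    refine (Finset.abs_sum_le_sum_abs _ _).trans ?_
    refine (Finset.sum_le_sum fun j _ =>
      hB m _ ⟨Real.neg_one_le_cos _, Real.cos_le_one _⟩).trans ?_
    simp
  refine ⟨aestronglyMeasurable_of_tendsto_ae _ hm (.of_forall ht), ?_, ?_⟩
  · exact tendsto_integral_of_dominated_convergence (fun _ => N * B) hm (integrable_const _)
      (fun m => .of_forall fun g => hb m g) (.of_forall ht)
  · refine tendsto_integral_of_dominated_convergence (fun _ => (N * B) ^ 2) (fun m => (hm m).pow 2)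
      (integrable_const _) (fun m => .of_forall fun g => ?_) (.of_forall fun g => (ht g).pow 2)
    rw [Real.norm_eq_abs, abs_pow]
    exact pow_le_pow_left₀ (abs_nonneg _) (hb m g) 2

lemma LinStatAgree.of_tendsto [IsFiniteMeasure μ] [IsFiniteMeasure ν] {h : ℕ → ℝ → ℝ} {k : ℝ → ℝ}
    {B : ℝ} (hA : ∀ m, LinStatAgree μ ν x y (h m))
    (hB : ∀ m, ∀ t ∈ Set.Icc (-1 : ℝ) 1, |h m t| ≤ B)
    (hk : ∀ t ∈ Set.Icc (-1 : ℝ) 1, Filter.Tendsto (fun m => h m t) Filter.atTop (nhds (k t))) :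
    LinStatAgree μ ν x y k := by
  obtain ⟨a1, a2, a3⟩ := tendsto_linStat (fun m => (hA m).left) hB hk
  obtain ⟨b1, b2, b3⟩ := tendsto_linStat (fun m => (hA m).right) hB hk
  exact ⟨a1, b1, tendsto_nhds_unique (a2.congr fun m => (hA m).mean) b2,
    tendsto_nhds_unique (a3.congr fun m => (hA m).sq) b3⟩

lemma integral_monSpan {e : ℕ}
    (hx : ∀ s, Integrable (fun g => powerMon (torusPower e (x g)) s) μ)
    (hy : ∀ s, Integrable (fun g => powerMon (torusPower e (y g)) s) ν)
    (hxy : ∀ s, ∫ g, powerMon (torusPower e (x g)) s ∂μ = ∫ g, powerMon (torusPower e (y g)) s ∂ν)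
    {φ : (ℕ → ℝ) → ℝ} (hφ : φ ∈ monSpan) :
    Integrable (fun g => φ (torusPower e (x g))) μ ∧ Integrable (fun g => φ (torusPower e (y g))) ν
    ∧ ∫ g, φ (torusPower e (x g)) ∂μ = ∫ g, φ (torusPower e (y g)) ∂ν := by
  induction hφ using Submodule.span_induction with
  | mem φ hφ => obtain ⟨s, rfl⟩ := hφ; exact ⟨hx s, hy s, hxy s⟩
  | zero => simp
  | add φ ψ _ _ h1 h2 =>
    refine ⟨h1.1.add h2.1, h1.2.1.add h2.2.1, ?_⟩
    simp only [Pi.add_apply]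
    rw [integral_add h1.1 h2.1, integral_add h1.2.1 h2.2.1, h1.2.2, h2.2.2]
  | smul c φ _ h1 =>
    refine ⟨h1.1.const_mul c, h1.2.1.const_mul c, ?_⟩
    simp only [Pi.smul_apply, smul_eq_mul]
    rw [integral_const_mul, integral_const_mul, h1.2.2]

lemma linStatAgree_polynomial {e : ℕ}
    (hx : ∀ s, Integrable (fun g => powerMon (torusPower e (x g)) s) μ)
    (hy : ∀ s, Integrable (fun g => powerMon (torusPower e (y g)) s) ν)
    (hxy : ∀ s, ∫ g, powerMon (torusPower e (x g)) s ∂μ = ∫ g, powerMon (torusPower e (y g)) s ∂ν)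
    (p : Polynomial ℝ) : LinStatAgree μ ν x y fun t => p.eval t := by
  obtain ⟨φ, hφ, h⟩ := exists_monSpan_sum (polynomial_cos_mem_cosSpan p) N e
  have h1 := integral_monSpan hx hy hxy hφ
  have h2 := integral_monSpan hx hy hxy (monSpan_mul hφ hφ)
  constructor <;> simp only [h]
  · exact h1.1.1
  · exact h1.2.1.1
  · exact h1.2.2
  · simpa [sq] using h2.2.2

lemma linStatAgree_continuousOn [IsFiniteMeasure μ] [IsFiniteMeasure ν]
    (hp : ∀ p : Polynomial ℝ, LinStatAgree μ ν x y fun t => p.eval t) {h : ℝ → ℝ}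
    (hc : ContinuousOn h (Set.Icc (-1) 1)) : LinStatAgree μ ν x y h := by
  choose p hpn using fun m : ℕ => exists_polynomial_near_of_continuousOn (-1) 1 h hc
    (1 / ((m : ℝ) + 1)) (by positivity)
  obtain ⟨B, hB⟩ := isCompact_Icc.exists_bound_of_continuousOn hc
  refine LinStatAgree.of_tendsto (h := fun m t => (p m).eval t) (B := B + 1) (fun m => hp (p m)) ?_ ?_
  · intro m t ht
    have h1 := hpn m t ht
    have h2 := hB t ht
    have h3 : 1 / ((m : ℝ) + 1) ≤ 1 := by
      rw [div_le_one (by positivity)]; linarith [(Nat.cast_nonneg m : (0 : ℝ) ≤ m)]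
    rw [Real.norm_eq_abs] at h2
    have := abs_sub_abs_le_abs_sub ((p m).eval t) (h t)
    linarith
  · intro t ht
    rw [tendsto_iff_dist_tendsto_zero]
    refine squeeze_zero (fun _ => dist_nonneg) (fun m => ?_) tendsto_one_div_add_atTop_nhds_zero_nat
    rw [Real.dist_eq]
    exact (hpn m t ht).le

/-- Bounded pointwise limits of continuous functions on `[-1, 1]`. -/
def IsBddBaire (k : ℝ → ℝ) : Prop :=
  ∃ (h : ℕ → ℝ → ℝ) (B : ℝ), (∀ m, ContinuousOn (h m) (Set.Icc (-1) 1)) ∧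
    (∀ m, ∀ t ∈ Set.Icc (-1 : ℝ) 1, |h m t| ≤ B) ∧
    ∀ t ∈ Set.Icc (-1 : ℝ) 1, Filter.Tendsto (fun m => h m t) Filter.atTop (nhds (k t))

lemma LinStatAgree.of_isBddBaire [IsFiniteMeasure μ] [IsFiniteMeasure ν]
    (hp : ∀ p : Polynomial ℝ, LinStatAgree μ ν x y fun t => p.eval t) {k : ℝ → ℝ}
    (hk : IsBddBaire k) : LinStatAgree μ ν x y k := by
  obtain ⟨h, B, h1, h2, h3⟩ := hk
  exact LinStatAgree.of_tendsto (fun m => linStatAgree_continuousOn hp (h1 m)) h2 h3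

lemma IsBddBaire.congr {k l : ℝ → ℝ} (hk : IsBddBaire k)
    (h : ∀ t ∈ Set.Icc (-1 : ℝ) 1, k t = l t) : IsBddBaire l := by
  obtain ⟨f, B, h1, h2, h3⟩ := hk
  exact ⟨f, B, h1, h2, fun t ht => h t ht ▸ h3 t ht⟩

lemma IsBddBaire.add {k l : ℝ → ℝ} (hk : IsBddBaire k) (hl : IsBddBaire l) :
    IsBddBaire fun t => k t + l t := by
  obtain ⟨f, B, h1, h2, h3⟩ := hk
  obtain ⟨g, D, g1, g2, g3⟩ := hl
  exact ⟨fun m t => f m t + g m t, B + D, fun m => (h1 m).add (g1 m),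
    fun m t ht => (abs_add_le _ _).trans (add_le_add (h2 m t ht) (g2 m t ht)),
    fun t ht => (h3 t ht).add (g3 t ht)⟩

lemma IsBddBaire.const_mul {k : ℝ → ℝ} (hk : IsBddBaire k) (c : ℝ) :
    IsBddBaire fun t => c * k t := by
  obtain ⟨f, B, h1, h2, h3⟩ := hk
  exact ⟨fun m t => c * f m t, |c| * B, fun m => continuousOn_const.mul (h1 m),
    fun m t ht => by rw [abs_mul]; exact mul_le_mul_of_nonneg_left (h2 m t ht) (abs_nonneg _),
    fun t ht => (h3 t ht).const_mul c⟩

lemma isBddBaire_lt {u : ℝ → ℝ} (hu : Continuous u) (c : ℝ) :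
    IsBddBaire fun t => if u t < c then 1 else 0 := by
  refine ⟨fun m t => min 1 (max 0 (m * (c - u t))), 1, fun m => by fun_prop, fun m t _ => ?_,
    fun t _ => ?_⟩
  · rw [abs_of_nonneg (le_min zero_le_one (le_max_left _ _))]
    exact min_le_left _ _
  · beta_reduce
    split_ifs with h
    · refine tendsto_const_nhds.congr' ?_
      obtain ⟨M, hM⟩ := exists_nat_ge (1 / (c - u t))
      filter_upwards [Filter.eventually_ge_atTop M] with m hm
      have h1 : (1 : ℝ) ≤ m * (c - u t) := by
        rw [div_le_iff₀ (by linarith)] at hM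
        refine hM.trans (mul_le_mul_of_nonneg_right (by exact_mod_cast hm) (by linarith))
      rw [min_eq_left (h1.trans (le_max_right _ _))]
    · refine tendsto_const_nhds.congr fun m => ?_
      have : (m : ℝ) * (c - u t) ≤ 0 :=
        mul_nonpos_of_nonneg_of_nonpos (Nat.cast_nonneg m) (by linarith)
      rw [max_eq_left this]; simp

end comparison

/-! ### The Weyl measure -/

section weylMeasure

variable {N : ℕ}

/-- The probability measure on the box of angles given by the Weyl integration formula. -/
noncomputable def weylMeasure (N e : ℕ) : Measure (Fin N → ℝ) :=
  (volume.restrict (torusBox N)).withDensity fun θ =>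
    ENNReal.ofReal ((weylNorm N e)⁻¹ * weylDen e θ ^ 2)

lemma integrableOn_torusBox {F : (Fin N → ℝ) → ℝ} (hF : Continuous F) :
    IntegrableOn F (torusBox N) :=
  hF.continuousOn.integrableOn_compact isCompact_torusBox

lemma integral_weylMeasure (e : ℕ) (F : (Fin N → ℝ) → ℝ) :
    ∫ θ, F θ ∂(weylMeasure N e)
      = (weylNorm N e)⁻¹ * ∫ θ in torusBox N, weylDen e θ ^ 2 * F θ := by
  have := continuous_weylDen (N := N) e
  rw [weylMeasure, integral_withDensity_eq_integral_toReal_smul (by fun_prop)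
    (.of_forall fun _ => ENNReal.ofReal_lt_top), ← integral_const_mul]
  refine integral_congr_ae (.of_forall fun θ => ?_)
  have h : 0 ≤ (weylNorm N e)⁻¹ * weylDen e θ ^ 2 :=
    mul_nonneg (inv_nonneg.2 (weylNorm_pos N e).le) (sq_nonneg _)
  simp only [ENNReal.toReal_ofReal h, smul_eq_mul, mul_assoc]

instance isProbabilityMeasure_weylMeasure (e : ℕ) : IsProbabilityMeasure (weylMeasure N e) := by
  constructor
  have hc := continuous_weylDen (N := N) e
  rw [weylMeasure, withDensity_apply _ MeasurableSet.univ, Measure.restrict_univ,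
    ← ofReal_integral_eq_lintegral_ofReal, integral_const_mul]
  · change ENNReal.ofReal ((weylNorm N e)⁻¹ * weylNorm N e) = 1
    rw [inv_mul_cancel₀ (weylNorm_pos N e).ne', ENNReal.ofReal_one]
  · exact integrableOn_torusBox (by fun_prop)
  · exact .of_forall fun θ => mul_nonneg (inv_nonneg.2 (weylNorm_pos N e).le) (sq_nonneg _)

lemma ae_mem_torusBox (e : ℕ) : ∀ᵐ θ ∂(weylMeasure N e), θ ∈ torusBox N :=
  (withDensity_absolutelyContinuous _ _).ae_le (ae_restrict_mem measurableSet_torusBox)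

lemma integrable_weylMeasure (e : ℕ) {F : (Fin N → ℝ) → ℝ} (hF : Continuous F) :
    Integrable F (weylMeasure N e) := by
  obtain ⟨B, hB⟩ := isCompact_torusBox.exists_bound_of_continuousOn hF.continuousOn
  refine Integrable.of_bound hF.aestronglyMeasurable B ?_
  filter_upwards [ae_mem_torusBox e] with θ hθ using hB θ hθ

end weylMeasure

/-! ### Eigenvalue counts as linear statistics -/

section counting

/-- The number of points among `e^{it}` and `e^{-it}` with eigenangle in `[a, b)`. -/
noncomputable def countFun (a b t : ℝ) : ℝ :=
  (if a ≤ eigenangle (circlePoint t) ∧ eigenangle (circlePoint t) < b then 1 else 0)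
    + if a ≤ eigenangle (circlePoint (-t)) ∧ eigenangle (circlePoint (-t)) < b then 1 else 0

lemma arg_circlePoint {t : ℝ} (ht : t ∈ Set.Ioc (-Real.pi) Real.pi) :
    (circlePoint t).arg = t := by
  rw [circlePoint, Complex.exp_mul_I, Complex.arg_cos_add_sin_mul_I ht]

lemma eigenangle_circlePoint {t : ℝ} (ht : t ∈ Set.Ioo (-Real.pi) Real.pi) :
    eigenangle (circlePoint t) = t / (2 * Real.pi) := by
  rw [eigenangle, arg_circlePoint ⟨ht.1, ht.2.le⟩, if_neg ht.2.ne]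

/-- The indicator of a half-open interval as a difference of indicators. -/
lemma indicator_eq_sub {a b : ℝ} (hab : a ≤ b) (s : ℝ) :
    (if a ≤ s ∧ s < b then (1 : ℝ) else 0) = (if s < b then 1 else 0) - if s < a then 1 else 0 := by
  by_cases h1 : s < a
  · rw [if_neg (fun h => absurd h.1 (not_le.2 h1)), if_pos h1, if_pos (h1.trans_le hab), sub_self]
  · rw [if_neg h1, sub_zero]
    simp [not_lt.1 h1]

lemma countFun_eq {a b t : ℝ} (ht : t ∈ Set.Ico 0 Real.pi) :
    countFun a b t = (if a ≤ t / (2 * Real.pi) ∧ t / (2 * Real.pi) < b then 1 else 0)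
      + if a ≤ -t / (2 * Real.pi) ∧ -t / (2 * Real.pi) < b then 1 else 0 := by
  rw [countFun, eigenangle_circlePoint ⟨by linarith [ht.1, Real.pi_pos], ht.2⟩,
    eigenangle_circlePoint ⟨by linarith [ht.2], by linarith [ht.1, Real.pi_pos]⟩]

lemma IsBddBaire.congr_Ioc {k l : ℝ → ℝ} (hk : IsBddBaire k)
    (h : ∀ t ∈ Set.Ioc (-1 : ℝ) 1, k t = l t) : IsBddBaire l := by
  have h1 := (isBddBaire_lt (continuous_const (y := (0 : ℝ))) 1).add
    ((isBddBaire_lt continuous_neg 1).const_mul (-1))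
  refine (hk.add (h1.const_mul (l (-1) - k (-1)))).congr fun t ht => ?_
  rcases eq_or_lt_of_le ht.1 with h' | h'
  · subst h'
    norm_num
  · have hlt : -t < 1 := by linarith
    simp [hlt, h t ⟨h', ht.2⟩]

lemma isBddBaire_countFun {a b : ℝ} (hab : a ≤ b) :
    IsBddBaire fun x => countFun a b (Real.arccos x) := by
  have hu : Continuous fun x : ℝ => Real.arccos x / (2 * Real.pi) := by fun_prop
  have hv : Continuous fun x : ℝ => -Real.arccos x / (2 * Real.pi) := by fun_prop
  refine (((isBddBaire_lt hu b).add ((isBddBaire_lt hu a).const_mul (-1))).add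
    ((isBddBaire_lt hv b).add ((isBddBaire_lt hv a).const_mul (-1)))).congr_Ioc fun t ht => ?_
  have hpi : Real.arccos t < Real.pi := by
    refine lt_of_le_of_ne (Real.arccos_le_pi t) fun h' => ?_
    rw [Real.arccos_eq_pi] at h'
    linarith [ht.1]
  rw [countFun_eq ⟨Real.arccos_nonneg t, hpi⟩, indicator_eq_sub hab, indicator_eq_sub hab]
  ring

theorem moments_SOeigCount {e : ℕ} (he : e ≤ 1) (N : ℕ) [MeasurableSpace (SOGroup (2 * N + e))]
    [BorelSpace (SOGroup (2 * N + e))] (μ : Measure (SOGroup (2 * N + e))) [μ.IsHaarMeasure]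
    [IsProbabilityMeasure μ] {a b : ℝ} (hab : a ≤ b) :
    ∫ g, (SOeigCount (2 * N + e) g a b : ℝ) ∂μ
        = e * (if a ≤ eigenangle 1 ∧ eigenangle 1 < b then 1 else 0)
          + ∫ θ, ∑ j, countFun a b (θ j) ∂(weylMeasure N e)
    ∧ ProbabilityTheory.variance (fun g => (SOeigCount (2 * N + e) g a b : ℝ)) μ
        = ∫ θ, (∑ j, countFun a b (θ j)) ^ 2 ∂(weylMeasure N e)
          - (∫ θ, ∑ j, countFun a b (θ j) ∂(weylMeasure N e)) ^ 2 := by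
  choose ϑ hϑ hroots using exists_angles_SOMat he N
  have hpow : ∀ g, torusPower e (ϑ g) = tracePower (SOMat g) := fun g =>
    funext fun k => (tracePower_eq_torusPower (hroots g) k).symm
  have hIntg : ∀ s, Integrable (fun g => powerMon (torusPower e (ϑ g)) s) μ := by
    intro s
    simp only [hpow]
    exact integrable_comp_SOMat μ (continuous_powerMon_comp continuous_tracePower s)
  have hxy : ∀ s, ∫ g, powerMon (torusPower e (ϑ g)) s ∂μ
      = ∫ θ, powerMon (torusPower e θ) s ∂(weylMeasure N e) := by
    intro s
    rw [integral_weylMeasure]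
    refine integral_powerMon_eq (by interval_cases e <;> norm_num) μ ϑ hϑ hIntg (fun s => ?_) s
    simp only [hpow]
    exact integral_lapMon_eq_zero μ s
  have hA : LinStatAgree μ (weylMeasure N e) ϑ (fun θ => θ) fun x => countFun a b (Real.arccos x) :=
    LinStatAgree.of_isBddBaire (fun p => linStatAgree_polynomial hIntg
      (fun s => integrable_weylMeasure e (contDiff_powerMon e s).continuous) hxy p)
      (isBddBaire_countFun hab)
  have hc : ∀ θ ∈ torusBox N, ∑ j, countFun a b (Real.arccos (Real.cos (θ j)))
      = ∑ j, countFun a b (θ j) := fun θ hθ => Finset.sum_congr rfl fun j _ => by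
    rw [Real.arccos_cos (hθ.1 j) (hθ.2 j)]
  obtain ⟨h1, -, h3, h4⟩ := hA
  simp only [fun g => hc (ϑ g) (hϑ g)] at h1 h3 h4
  have h3' : ∫ g, ∑ j, countFun a b (ϑ g j) ∂μ
      = ∫ θ, ∑ j, countFun a b (θ j) ∂(weylMeasure N e) := by
    rw [h3]
    exact integral_congr_ae ((ae_mem_torusBox e).mono fun θ hθ => hc θ hθ)
  have h4' : ∫ g, (∑ j, countFun a b (ϑ g j)) ^ 2 ∂μ
      = ∫ θ, (∑ j, countFun a b (θ j)) ^ 2 ∂(weylMeasure N e) := by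
    rw [h4]
    exact integral_congr_ae ((ae_mem_torusBox e).mono fun θ hθ => by
      beta_reduce; rw [hc θ hθ])
  have hcount : ∀ g, (SOeigCount (2 * N + e) g a b : ℝ)
      = e * (if a ≤ eigenangle 1 ∧ eigenangle 1 < b then 1 else 0)
        + ∑ j, countFun a b (ϑ g j) := fun g => SOeigCount_eq (hroots g) a b
  have hb : ∀ g, ‖∑ j, countFun a b (ϑ g j)‖ ≤ N * 2 := by
    intro g
    refine (norm_sum_le _ _).trans ((Finset.sum_le_sum (g := fun _ => 2) fun j _ => ?_).trans_eq
      (by simp))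
    rw [Real.norm_eq_abs, countFun]
    split_ifs <;> norm_num
  simp only [hcount]
  refine ⟨?_, ?_⟩
  · rw [integral_add (integrable_const _) (Integrable.of_bound h1 _ (.of_forall hb)), h3']
    simp
  · rw [ProbabilityTheory.variance_const_add h1, ProbabilityTheory.variance_eq_sub
      (MemLp.of_bound h1 _ (.of_forall hb)), h3']
    congr 1

end counting

/-! ### Determinantal structure -/

section determinantal

variable {N : ℕ}

theorem integral_prod_mul_det_sq (m : Measure ℝ) [SigmaFinite m] (φ : Fin N → ℝ → ℝ) (u : ℝ → ℝ)
    (hIntg : ∀ i k, Integrable (fun t => u t * (φ i t * φ k t)) m) :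
    ∫ θ, (∏ j, u (θ j)) * (Matrix.of fun i j => φ i (θ j)).det ^ 2 ∂(Measure.pi fun _ : Fin N => m)
      = N.factorial * (Matrix.of fun i k => ∫ t, u t * (φ i t * φ k t) ∂m).det := by
  have e1 : ∀ θ : Fin N → ℝ, (∏ j, u (θ j)) * (Matrix.of fun i j => φ i (θ j)).det ^ 2
      = ∑ σ : Equiv.Perm (Fin N), ∑ τ : Equiv.Perm (Fin N),
        ((Equiv.Perm.sign σ : ℤ) : ℝ) * ((Equiv.Perm.sign τ : ℤ) : ℝ)
          * ∏ j, u (θ j) * (φ (σ j) (θ j) * φ (τ j) (θ j)) := by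
    intro θ
    rw [sq, Matrix.det_apply', Finset.sum_mul_sum, Finset.mul_sum]
    refine Finset.sum_congr rfl fun σ _ => ?_
    rw [Finset.mul_sum]
    refine Finset.sum_congr rfl fun τ _ => ?_
    simp only [Matrix.of_apply, Finset.prod_mul_distrib]
    ring
  have e2 : ∀ σ τ : Equiv.Perm (Fin N), Integrable (fun θ : Fin N → ℝ =>
      ((Equiv.Perm.sign σ : ℤ) : ℝ) * ((Equiv.Perm.sign τ : ℤ) : ℝ)
          * ∏ j, u (θ j) * (φ (σ j) (θ j) * φ (τ j) (θ j))) (Measure.pi fun _ : Fin N => m) :=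
    fun σ τ => (Integrable.fintype_prod (f := fun j t => u t * (φ (σ j) t * φ (τ j) t))
      fun j => hIntg (σ j) (τ j)).const_mul _
  simp only [e1]
  rw [integral_finsetSum _ fun σ _ => integrable_finsetSum _ fun τ _ => e2 σ τ]
  set G : Matrix (Fin N) (Fin N) ℝ := Matrix.of fun i k => ∫ t, u t * (φ i t * φ k t) ∂m with hG
  have e3 : ∀ σ : Equiv.Perm (Fin N), ∫ θ, ∑ τ : Equiv.Perm (Fin N),
      ((Equiv.Perm.sign σ : ℤ) : ℝ) * ((Equiv.Perm.sign τ : ℤ) : ℝ)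
          * ∏ j, u (θ j) * (φ (σ j) (θ j) * φ (τ j) (θ j)) ∂(Measure.pi fun _ : Fin N => m)
      = G.det := by
    intro σ
    rw [integral_finsetSum _ fun τ _ => e2 σ τ]
    have : ∀ τ : Equiv.Perm (Fin N), ∫ θ, ((Equiv.Perm.sign σ : ℤ) : ℝ)
        * ((Equiv.Perm.sign τ : ℤ) : ℝ) * ∏ j, u (θ j) * (φ (σ j) (θ j) * φ (τ j) (θ j))
          ∂(Measure.pi fun _ : Fin N => m)
        = ((Equiv.Perm.sign σ : ℤ) : ℝ) * (((Equiv.Perm.sign τ : ℤ) : ℝ)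
          * ∏ j, (G.submatrix σ id).transpose (τ j) j) := by
      intro τ
      rw [integral_const_mul,
        integral_fintype_prod_eq_prod (f := fun j t => u t * (φ (σ j) t * φ (τ j) t))]
      simp [hG, mul_assoc]
    simp only [this]
    rw [← Finset.mul_sum, ← Matrix.det_apply', Matrix.det_transpose, Matrix.det_permute,
      ← mul_assoc]
    have hs : ((Equiv.Perm.sign σ : ℤ) : ℝ) * ((Equiv.Perm.sign σ : ℤ) : ℝ) = 1 := by
      rcases Int.units_eq_one_or (Equiv.Perm.sign σ) with h | h <;> simp [h]
    rw [hs, one_mul]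
  simp only [e3]
  simp [Finset.card_univ, Fintype.card_perm]

open Polynomial in
lemma two_mul_coeff_two_det (M : Matrix (Fin N) (Fin N) ℝ) :
    2 * (1 + (X : ℝ[X]) • M.map C).det.coeff 2 = M.trace ^ 2 - (M * M).trace := by
  have h1 : (1 + (X : ℝ[X]) • M.map C).det * (1 + (X : ℝ[X]) • (-M).map C).det
      = expand ℝ 2 (1 + (X : ℝ[X]) • (-(M * M)).map C).det := by
    rw [← Matrix.det_mul, AlgHom.map_det]
    congr 1
    have e1 : (-M).map (C : ℝ →+* ℝ[X]) = -(M.map C) := by ext i j : 2; simp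
    have e2 : (-(M * M)).map (C : ℝ →+* ℝ[X]) = -(M.map C * M.map C) := by
      ext i j : 2; simp only [Matrix.map_apply, Matrix.neg_apply, Matrix.mul_apply, map_neg, map_sum, map_mul]
    have e3 : (expand ℝ 2).mapMatrix (1 + (X : ℝ[X]) • (-(M * M)).map C)
        = 1 + (X ^ 2 : ℝ[X]) • (-(M * M)).map C := by
      rw [map_add, map_one]
      congr 1
      ext i j : 2
      simp only [AlgHom.mapMatrix_apply, Matrix.map_apply, Matrix.smul_apply, smul_eq_mul, map_mul,
        expand_X, expand_C]
    rw [e3, e1, e2]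
    simp only [smul_neg, ← sub_eq_add_neg, add_mul, mul_sub, one_mul, mul_one, Matrix.smul_mul,
      Matrix.mul_smul, smul_smul, sq]
    abel
  have h2 := congrArg (fun p => coeff p 2) h1
  have e0 : ∀ M : Matrix (Fin N) (Fin N) ℝ, (1 + (X : ℝ[X]) • M.map C).det.coeff 0 = 1 := by
    intro M; rw [Matrix.coeff_det_one_add_X_smul_eq_sum_minors]; simp
  have e2 : (1 + (X : ℝ[X]) • (-M).map C).det.coeff 2 = (1 + (X : ℝ[X]) • M.map C).det.coeff 2 := by
    rw [Matrix.coeff_det_one_add_X_smul_eq_sum_minors,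
      Matrix.coeff_det_one_add_X_smul_eq_sum_minors]
    refine Finset.sum_congr rfl fun s hs => ?_
    rw [show (-M).submatrix Subtype.val Subtype.val
      = -(M.submatrix (Subtype.val : s → Fin N) Subtype.val) from rfl, Matrix.det_neg,
      Fintype.card_coe, (Finset.mem_powersetCard.1 hs).2]
    simp
  have e4 : (expand ℝ 2 (1 + (X : ℝ[X]) • (-(M * M)).map C).det).coeff 2 = -(M * M).trace := by
    rw [coeff_expand (by norm_num)]
    simp only [dvd_refl, if_true, Nat.div_self (by norm_num : 0 < 2)]
    rw [Matrix.coeff_det_one_add_X_smul_one, Matrix.trace_neg]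
  simp only [e4] at h2
  rw [coeff_mul, Finset.Nat.sum_antidiagonal_eq_sum_range_succ_mk] at h2
  simp only [Finset.sum_range_succ, Finset.sum_range_zero, e0, e2, Nat.sub_zero, Nat.sub_self,
    Matrix.coeff_det_one_add_X_smul_one, Matrix.trace_neg, Nat.add_one_sub_one, zero_add] at h2
  linarith

open Polynomial in
lemma coeff_det_diagonal (v : Fin N → ℝ) (k : ℕ) :
    (1 + (X : ℝ[X]) • (Matrix.diagonal v).map C).det.coeff k
      = ∑ t ∈ Finset.powersetCard k Finset.univ, ∏ j ∈ t, v j := by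
  rw [Matrix.coeff_det_one_add_X_smul_eq_sum_minors]
  refine Finset.sum_congr rfl fun t _ => ?_
  rw [Matrix.submatrix_diagonal _ _ Subtype.val_injective, Matrix.det_diagonal]
  exact Finset.prod_coe_sort t v

open Polynomial in
/-- Moments of linear statistics of a determinantal configuration. -/
lemma moments_of_generating {P : Measure (Fin N → ℝ)} [IsProbabilityMeasure P] {f : ℝ → ℝ}
    (hf : Measurable f) {B : ℝ} (hB : ∀ t, |f t| ≤ B) {F : Matrix (Fin N) (Fin N) ℝ}
    (hgen : ∀ s : ℝ, ∫ θ, ∏ j, (1 + s * f (θ j)) ∂P = (1 + s • F).det) :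
    ∫ θ, ∑ j, f (θ j) ∂P = F.trace ∧
    ∫ θ, (∑ j, f (θ j)) ^ 2 ∂P - ∫ θ, ∑ j, f (θ j) ^ 2 ∂P = F.trace ^ 2 - (F * F).trace := by
  have hfj : ∀ j, Measurable fun θ : Fin N → ℝ => f (θ j) := fun j => hf.comp (measurable_pi_apply j)
  have hIntg : ∀ t : Finset (Fin N), Integrable (fun θ : Fin N → ℝ => ∏ j ∈ t, f (θ j)) P := by
    intro t
    refine Integrable.of_bound (Finset.measurable_fun_prod t fun j _ => hfj j).aestronglyMeasurable (∏ _j ∈ t, B) (.of_forall fun θ => ?_)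
    rw [Real.norm_eq_abs, Finset.abs_prod]
    exact Finset.prod_le_prod (fun _ _ => abs_nonneg _) fun _ _ => hB _
  have hpoly : ∑ t : Finset (Fin N), C (∫ θ, ∏ j ∈ t, f (θ j) ∂P) * X ^ t.card
      = (1 + (X : ℝ[X]) • F.map C).det := by
    refine Polynomial.funext fun s => ?_
    have hs : (eval s (1 + (X : ℝ[X]) • F.map C).det) = (1 + s • F).det := by
      rw [← coe_evalRingHom, RingHom.map_det]
      congr 1
      rw [map_add, map_one]
      congr 1
      ext i j
      simp
      exact mul_comm _ _
    rw [hs, ← hgen, eval_finsetSum]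
    simp only [Finset.prod_one_add, Finset.powerset_univ, Finset.prod_mul_distrib,
      Finset.prod_const]
    rw [integral_finsetSum _ fun t _ => (hIntg t).const_mul _]
    refine Finset.sum_congr rfl fun t _ => ?_
    rw [integral_const_mul]
    simp only [eval_mul, eval_C, eval_pow, eval_X]
    ring
  have hcoeff : ∀ k, ∫ θ, (1 + (X : ℝ[X]) • (Matrix.diagonal fun j => f (θ j)).map C).det.coeff k ∂P
      = (1 + (X : ℝ[X]) • F.map C).det.coeff k := by
    intro k
    simp only [coeff_det_diagonal]
    rw [integral_finsetSum _ fun t _ => hIntg t, ← hpoly, finsetSum_coeff]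
    simp only [coeff_C_mul, coeff_X_pow, mul_ite, mul_one, mul_zero]
    rw [← Finset.sum_filter]
    refine Finset.sum_congr ?_ fun _ _ => rfl
    ext t
    simp [Finset.mem_powersetCard, eq_comm]
  have h1 := hcoeff 1
  have h2 := congrArg (2 * ·) (hcoeff 2)
  simp only [← integral_const_mul, two_mul_coeff_two_det] at h2
  simp only [Matrix.coeff_det_one_add_X_smul_one] at h1
  simp only [Matrix.trace_diagonal, Matrix.diagonal_mul_diagonal] at h1 h2
  refine ⟨h1, ?_⟩
  rw [← h2, ← integral_sub]
  · simp only [sq]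
  · refine Integrable.of_bound ((Finset.measurable_fun_sum _ fun j _ => hfj j).pow_const 2).aestronglyMeasurable
      ((N * B) ^ 2) (.of_forall fun θ => ?_)
    rw [Real.norm_eq_abs, abs_pow]
    refine pow_le_pow_left₀ (abs_nonneg _) ((Finset.abs_sum_le_sum_abs _ _).trans
      ((Finset.sum_le_sum fun j _ => hB (θ j)).trans_eq (by simp))) 2
  · refine Integrable.of_bound (Finset.measurable_fun_sum _ fun j _ => (hfj j).pow_const 2).aestronglyMeasurable
      (N * B ^ 2) (.of_forall fun θ => ?_)
    refine (norm_sum_le _ _).trans ((Finset.sum_le_sum (g := fun _ => B ^ 2) fun j _ => ?_).trans_eq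
      (by simp))
    rw [Real.norm_eq_abs, abs_pow]
    exact pow_le_pow_left₀ (abs_nonneg _) (hB _) 2

end determinantal

/-! ### The orthonormal systems attached to the Weyl densities -/

section orthonormal

variable {N : ℕ}

/-- The unnormalised trigonometric system: `cos (i t)` for `e = 0` and `sin ((i + 1/2) t)`
otherwise. -/
noncomputable def trigFun (e i : ℕ) (t : ℝ) : ℝ :=
  if e = 0 then Real.cos (i * t) else Real.sin ((i + 1 / 2) * t)

/-- The normalising constants of `trigFun`. -/
noncomputable def trigWeight (e i : ℕ) : ℝ := if e = 0 ∧ i = 0 then 1 else √2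

/-- The orthonormal trigonometric system. -/
noncomputable def trigSys (e i : ℕ) (t : ℝ) : ℝ := trigWeight e i * trigFun e i t

lemma continuous_trigSys (e i : ℕ) : Continuous (trigSys e i) := by
  unfold trigSys trigFun
  split_ifs <;> fun_prop

open Polynomial in
lemma exists_polynomial_trigSys {e : ℕ} (he : e ≤ 1) (i : ℕ) :
    ∃ p : ℝ[X], p.natDegree ≤ i ∧
      ∀ t, trigSys e i t = p.eval (Real.cos t) * Real.sin (t / 2) ^ e := by
  have key : ∀ i : ℕ, (∃ p : ℝ[X], p.natDegree ≤ i ∧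
      ∀ t, trigFun e i t = p.eval (Real.cos t) * Real.sin (t / 2) ^ e) ∧
      ∃ p : ℝ[X], p.natDegree ≤ i + 1 ∧
      ∀ t, trigFun e (i + 1) t = p.eval (Real.cos t) * Real.sin (t / 2) ^ e := by
    intro i
    induction i with
    | zero =>
      refine ⟨⟨1, by simp, fun t => ?_⟩, ?_⟩
      · interval_cases e
        · simp [trigFun]
        · simp [trigFun]
          congr 1; ring
      · interval_cases e
        · exact ⟨X, by simp, fun t => by simp [trigFun]⟩
        · refine ⟨C 2 * X + C 1, natDegree_linear_le, fun t => ?_⟩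
          simp only [trigFun, one_ne_zero, if_false, eval_add, eval_mul, eval_C, eval_X, pow_one]
          have h := Real.sin_add t (t / 2)
          have h2 : Real.cos t = 2 * Real.cos (t / 2) ^ 2 - 1 := by
            rw [← Real.cos_two_mul]; congr 1; ring
          have h3 : Real.sin t = 2 * Real.sin (t / 2) * Real.cos (t / 2) := by
            rw [← Real.sin_two_mul]; congr 1; ring
          have h4 : Real.sin ((((0 + 1 : ℕ) : ℝ) + 1 / 2) * t) = Real.sin (t + t / 2) := by
            congr 1; push_cast; ring
          rw [h4, h, h3, h2]
          ring
    | succ i ih =>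
      obtain ⟨⟨p, hp, hp'⟩, q, hq, hq'⟩ := ih
      refine ⟨⟨q, hq, hq'⟩, C 2 * X * q - p, ?_, fun t => ?_⟩
      · refine (natDegree_sub_le _ _).trans (max_le (natDegree_mul_le.trans ?_) (by omega))
        have := natDegree_linear_le (a := (2 : ℝ)) (b := 0)
        simp only [map_zero, add_zero] at this
        omega
      · have hrec : trigFun e (i + 1 + 1) t
            = 2 * Real.cos t * trigFun e (i + 1) t - trigFun e i t := by
          unfold trigFun
          split_ifs
          · have h1 := Real.cos_add ((i + 1 : ℕ) * t) t
            have h2 := Real.cos_sub ((i + 1 : ℕ) * t) t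
            have e1 : ((i + 1 : ℕ) * t + t) = (i + 1 + 1 : ℕ) * t := by push_cast; ring
            have e2 : ((i + 1 : ℕ) * t - t) = i * t := by push_cast; ring
            rw [e1] at h1; rw [e2] at h2
            rw [h1, h2]; ring
          · have h1 := Real.sin_add (((i + 1 : ℕ) + 1 / 2) * t) t
            have h2 := Real.sin_sub (((i + 1 : ℕ) + 1 / 2) * t) t
            have e1 : (((i + 1 : ℕ) + 1 / 2) * t + t) = ((i + 1 + 1 : ℕ) + 1 / 2) * t := by
              push_cast; ring
            have e2 : (((i + 1 : ℕ) + 1 / 2) * t - t) = (i + 1 / 2) * t := by push_cast; ring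
            rw [e1] at h1; rw [e2] at h2
            rw [h1, h2]; ring
        rw [hrec, hp', hq']
        simp only [eval_sub, eval_mul, eval_C, eval_X]
        ring
  obtain ⟨p, hp, hp'⟩ := (key i).1
  refine ⟨C (trigWeight e i) * p, (natDegree_C_mul_le _ _).trans hp, fun t => ?_⟩
  rw [trigSys, hp', eval_mul, eval_C, mul_assoc]

lemma prod_ordPairs (g : Fin N → Fin N → ℝ) :
    ∏ p ∈ ordPairs N, g p.1 p.2 = ∏ i, ∏ j ∈ Finset.Ioi i, g i j := by
  rw [ordPairs, Finset.prod_filter, Fintype.prod_prod_type]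
  refine Finset.prod_congr rfl fun i _ => ?_
  rw [← Finset.prod_filter]
  refine Finset.prod_congr ?_ fun _ _ => rfl
  ext j; simp

lemma exists_det_trigSys {e : ℕ} (he : e ≤ 1) (N : ℕ) :
    ∃ c : ℝ, ∀ θ : Fin N → ℝ,
      (Matrix.of fun i j : Fin N => trigSys e i (θ j)).det = c * weylDen e θ := by
  choose p hp hp' using fun i : Fin N => exists_polynomial_trigSys he (i : ℕ)
  refine ⟨(Matrix.of fun i j : Fin N => (p j).coeff i).det, fun θ => ?_⟩
  have h1 : (Matrix.of fun i j : Fin N => trigSys e i (θ j)).transpose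
      = Matrix.of fun i j => Real.sin (θ i / 2) ^ e
        * (Matrix.of fun i j : Fin N => (p j).eval (Real.cos (θ i))) i j := by
    ext i j
    simp [hp', mul_comm]
  rw [← Matrix.det_transpose, h1, Matrix.det_mul_column,
    Matrix.eval_matrixOfPolynomials_eq_vandermonde_mul_matrixOfPolynomials _ p hp,
    Matrix.det_mul, Matrix.det_vandermonde, weylDen,
    prod_ordPairs fun i j => Real.cos (θ j) - Real.cos (θ i)]
  ring

/-- The cosine coefficients of a function on `[0, π]`. -/
noncomputable def cosCoeff (u : ℝ → ℝ) (m : ℕ) : ℝ :=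
  Real.pi⁻¹ * ∫ t in Set.Icc 0 Real.pi, u t * Real.cos (m * t)

/-- The Gram matrix entries of the multiplication operator by `u` in the system `trigSys`. -/
noncomputable def trigGram (e : ℕ) (u : ℝ → ℝ) (i k : ℕ) : ℝ :=
  Real.pi⁻¹ * ∫ t in Set.Icc 0 Real.pi, u t * (trigSys e i t * trigSys e k t)

lemma integrableOn_mul_of_bounded {u : ℝ → ℝ} (hu : Measurable u) {B : ℝ} (hB : ∀ t, |u t| ≤ B)
    {g : ℝ → ℝ} (hg : Continuous g) : IntegrableOn (fun t => u t * g t) (Set.Icc 0 Real.pi) :=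
  (hg.continuousOn.integrableOn_compact isCompact_Icc).bdd_mul hu.aestronglyMeasurable
    (.of_forall hB)

lemma trigGram_one {u : ℝ → ℝ} (hu : Measurable u) {B : ℝ} (hB : ∀ t, |u t| ≤ B) (i k : ℕ) :
    trigGram 1 u i k = cosCoeff u (Nat.dist i k) - cosCoeff u (i + k + 1) := by
  rw [trigGram, cosCoeff, cosCoeff, ← mul_sub, ← integral_sub
    (integrableOn_mul_of_bounded hu hB (by fun_prop))
    (integrableOn_mul_of_bounded hu hB (by fun_prop))]
  congr 1
  refine integral_congr_ae (.of_forall fun t => ?_)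
  have hd : Real.cos ((Nat.dist i k : ℕ) * t) = Real.cos ((i + 1 / 2) * t - (k + 1 / 2) * t) := by
    rcases le_total i k with h | h
    · rw [Nat.dist_eq_sub_of_le h, Nat.cast_sub h, ← Real.cos_neg]
      congr 1; ring
    · rw [Nat.dist_eq_sub_of_le_right h, Nat.cast_sub h]
      congr 1; ring
  have hs : Real.cos ((i + k + 1 : ℕ) * t) = Real.cos ((i + 1 / 2) * t + (k + 1 / 2) * t) := by
    congr 1; push_cast; ring
  simp only [trigSys, trigFun, trigWeight, one_ne_zero, if_false, false_and, hd, hs, Real.cos_sub,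
    Real.cos_add]
  have := Real.mul_self_sqrt (show (0 : ℝ) ≤ 2 by norm_num)
  linear_combination (u t * Real.sin ((i + 1 / 2) * t) * Real.sin ((k + 1 / 2) * t)) * this

lemma trigGram_zero {u : ℝ → ℝ} (hu : Measurable u) {B : ℝ} (hB : ∀ t, |u t| ≤ B) (i k : ℕ) :
    trigGram 0 u i k = trigWeight 0 i * trigWeight 0 k / 2
      * (cosCoeff u (Nat.dist i k) + cosCoeff u (i + k)) := by
  rw [trigGram, cosCoeff, cosCoeff, ← mul_add, ← integral_add
    (integrableOn_mul_of_bounded hu hB (by fun_prop))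
    (integrableOn_mul_of_bounded hu hB (by fun_prop)), mul_left_comm]
  congr 1
  rw [← integral_const_mul]
  refine integral_congr_ae (.of_forall fun t => ?_)
  have hd : Real.cos ((Nat.dist i k : ℕ) * t) = Real.cos (i * t - k * t) := by
    rcases le_total i k with h | h
    · rw [Nat.dist_eq_sub_of_le h, Nat.cast_sub h, ← Real.cos_neg]
      congr 1; ring
    · rw [Nat.dist_eq_sub_of_le_right h, Nat.cast_sub h]
      congr 1; ring
  have hs : Real.cos ((i + k : ℕ) * t) = Real.cos (i * t + k * t) := by
    congr 1; push_cast; ring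
  simp only [trigSys, trigFun, if_true, hd, hs, Real.cos_sub, Real.cos_add]
  ring

lemma cosCoeff_const_one (m : ℕ) : cosCoeff (fun _ => 1) m = if m = 0 then 1 else 0 := by
  rw [cosCoeff, integral_Icc_eq_integral_Ioc, ← intervalIntegral.integral_of_le Real.pi_pos.le]
  split_ifs with h
  · simp [h, Real.pi_ne_zero]
  · have h' : (m : ℝ) ≠ 0 := by exact_mod_cast h
    simp only [one_mul]
    rw [intervalIntegral.integral_comp_mul_left (fun x => Real.cos x) h', integral_cos]
    simp

lemma trigGram_const_one {e : ℕ} (he : e ≤ 1) (i k : ℕ) :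
    trigGram e (fun _ => 1) i k = if i = k then 1 else 0 := by
  have h1 : ∀ t : ℝ, |(fun _ => (1 : ℝ)) t| ≤ 1 := by simp
  interval_cases e
  · rw [trigGram_zero measurable_const h1, cosCoeff_const_one, cosCoeff_const_one]
    by_cases h : i = k
    · subst h
      rcases Nat.eq_zero_or_pos i with h0 | h0
      · simp [h0, trigWeight]; norm_num
      · simp [h0.ne', trigWeight]
    · have : Nat.dist i k ≠ 0 := fun h' => h (Nat.eq_of_dist_eq_zero h')
      rw [if_neg this, if_neg (by omega), if_neg h]
      simp
  · rw [trigGram_one measurable_const h1, cosCoeff_const_one, cosCoeff_const_one]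
    by_cases h : i = k
    · simp [h]
    · have : Nat.dist i k ≠ 0 := fun h' => h (Nat.eq_of_dist_eq_zero h')
      simp [*]

lemma volume_restrict_torusBox (N : ℕ) : (volume : Measure (Fin N → ℝ)).restrict (torusBox N)
    = Measure.pi fun _ => (volume : Measure ℝ).restrict (Set.Icc 0 Real.pi) := by
  rw [torusBox, ← Set.pi_univ_Icc, volume_pi, Measure.restrict_pi_pi]
  rfl

theorem integral_weylMeasure_prod {e : ℕ} (he : e ≤ 1) (N : ℕ) {u : ℝ → ℝ} (hu : Measurable u)
    {B : ℝ} (hB : ∀ t, |u t| ≤ B) :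
    ∫ θ, ∏ j, u (θ j) ∂(weylMeasure N e)
      = (Matrix.of fun i k : Fin N => trigGram e u i k).det := by
  obtain ⟨c, hc⟩ := exists_det_trigSys he N
  have key : ∀ {v : ℝ → ℝ} {B : ℝ}, Measurable v → (∀ t, |v t| ≤ B) →
      c ^ 2 * ∫ θ in torusBox N, weylDen e θ ^ 2 * ∏ j, v (θ j)
        = N.factorial * (Real.pi ^ N * (Matrix.of fun i k : Fin N => trigGram e v i k).det) := by
    intro v B hv hB
    have h := integral_prod_mul_det_sq (N := N) (volume.restrict (Set.Icc 0 Real.pi))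
      (fun i => trigSys e i) v fun i k => integrableOn_mul_of_bounded hv hB
        ((continuous_trigSys e i).mul (continuous_trigSys e k))
    have h2 : (Matrix.of fun i k : Fin N => ∫ t in Set.Icc 0 Real.pi,
        v t * (trigSys e i t * trigSys e k t))
        = Real.pi • Matrix.of fun i k : Fin N => trigGram e v i k := by
      ext i k
      simp only [Matrix.of_apply, Matrix.smul_apply, smul_eq_mul, trigGram]
      rw [mul_inv_cancel_left₀ Real.pi_ne_zero]
    rw [h2, Matrix.det_smul, Fintype.card_fin] at h
    rw [← h, volume_restrict_torusBox, ← integral_const_mul]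
    refine integral_congr_ae (.of_forall fun θ => ?_)
    simp only [hc]
    ring
  have hK : (N.factorial : ℝ) * Real.pi ^ N ≠ 0 := by positivity
  have h1 := key (v := fun _ => 1) (B := 1) measurable_const (by simp)
  have hone : (Matrix.of fun i k : Fin N => trigGram e (fun _ => 1) i k) = 1 := by
    ext i k
    simp [trigGram_const_one he, Matrix.one_apply, Fin.ext_iff]
  rw [hone, Matrix.det_one] at h1
  simp only [Finset.prod_const_one, mul_one] at h1
  change c ^ 2 * weylNorm N e = _ at h1
  have h2 := key hu hB
  rw [integral_weylMeasure]
  have hW := (weylNorm_pos N e).ne'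
  rw [inv_mul_eq_iff_eq_mul₀ hW]
  have hc0 : c ^ 2 ≠ 0 := by
    intro h0; rw [h0, zero_mul] at h1; exact hK h1.symm
  refine mul_left_cancel₀ hc0 ?_
  rw [h2, ← mul_assoc, ← mul_assoc, h1]

end orthonormal

/-! ### Bounds for the mean and variance of linear statistics -/

section linStat

lemma trigGram_one_add_mul {e : ℕ} (he : e ≤ 1) {f : ℝ → ℝ} (hf : Measurable f) {B : ℝ}
    (hB : ∀ t, |f t| ≤ B) (s : ℝ) (i k : ℕ) :
    trigGram e (fun t => 1 + s * f t) i k = (if i = k then 1 else 0) + s * trigGram e f i k := by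
  have hc : Continuous fun t => trigSys e i t * trigSys e k t :=
    (continuous_trigSys e i).mul (continuous_trigSys e k)
  have h1 : IntegrableOn (fun t => 1 * (trigSys e i t * trigSys e k t)) (Set.Icc 0 Real.pi) :=
    integrableOn_mul_of_bounded (u := fun _ => 1) measurable_const (B := 1) (by simp) hc
  have h2 := integrableOn_mul_of_bounded hf hB hc
  rw [← trigGram_const_one he i k, trigGram, trigGram, trigGram, mul_left_comm, ← mul_add]
  congr 1
  rw [← integral_const_mul, ← integral_add h1 (h2.const_mul s)]
  refine integral_congr_ae (.of_forall fun t => ?_)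
  ring

lemma moments_weylMeasure {e : ℕ} (he : e ≤ 1) (N : ℕ) {f : ℝ → ℝ} (hf : Measurable f) {B : ℝ}
    (hB : ∀ t, |f t| ≤ B) :
    ∫ θ, ∑ j, f (θ j) ∂(weylMeasure N e) = ∑ i : Fin N, trigGram e f i i ∧
    ∫ θ, (∑ j, f (θ j)) ^ 2 ∂(weylMeasure N e) - ∫ θ, ∑ j, f (θ j) ^ 2 ∂(weylMeasure N e)
      = (∑ i : Fin N, trigGram e f i i) ^ 2 - ∑ i : Fin N, ∑ k : Fin N, trigGram e f i k ^ 2 := by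
  have h := moments_of_generating (P := weylMeasure N e) hf hB
    (F := Matrix.of fun i k : Fin N => trigGram e f i k) fun s => by
      rw [integral_weylMeasure_prod he N (u := fun t => 1 + s * f t) (B := 1 + |s| * B)
        (by fun_prop) fun t => ?_]
      · congr 1
        ext i k
        simp [trigGram_one_add_mul he hf hB, Matrix.one_apply, Fin.ext_iff]
      · refine (abs_add_le _ _).trans ?_
        rw [abs_one, abs_mul]
        gcongr
        exact hB t
  refine ⟨by simpa [Matrix.trace] using h.1, h.2.trans ?_⟩
  have hsymm : ∀ i k, trigGram e f i k = trigGram e f k i := fun i k => by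
    simp only [trigGram, mul_comm (trigSys e i _)]
  simp only [Matrix.trace, Matrix.diag_apply, Matrix.of_apply, Matrix.mul_apply, sq]
  congr 1
  exact Finset.sum_congr rfl fun i _ => Finset.sum_congr rfl fun k _ => by
    rw [hsymm k i]

/-- The variance of a linear statistic as a sum over rows of the Gram matrix. -/
lemma variance_weylMeasure {e : ℕ} (he : e ≤ 1) (N : ℕ) {f : ℝ → ℝ} (hf : Measurable f) {B : ℝ}
    (hB : ∀ t, |f t| ≤ B) :
    ∫ θ, (∑ j, f (θ j)) ^ 2 ∂(weylMeasure N e) - (∫ θ, ∑ j, f (θ j) ∂(weylMeasure N e)) ^ 2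
      = ∑ i ∈ Finset.range N, (trigGram e (fun t => f t ^ 2) i i
        - ∑ k ∈ Finset.range N, trigGram e f i k ^ 2) := by
  have h1 := moments_weylMeasure he N hf hB
  have h2 := (moments_weylMeasure he N (f := fun t => f t ^ 2) (hf.pow_const 2) (B := B ^ 2)
    fun t => by rw [abs_pow]; exact pow_le_pow_left₀ (abs_nonneg _) (hB t) 2).1
  rw [Finset.sum_range]
  simp only [Finset.sum_range, Finset.sum_sub_distrib]
  beta_reduce at h2
  rw [← h2, h1.1]
  linarith [h1.2]

/-- Bessel's inequality on `[0, π]`. -/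
lemma bessel_Icc {h : ℝ → ℝ} (hh : Measurable h) {B : ℝ} (hB : ∀ t, |h t| ≤ B) (s : Finset ℕ)
    {φ : ℕ → ℝ → ℝ} (hφ : ∀ k, Continuous (φ k))
    (ho : ∀ k ∈ s, ∀ l ∈ s, Real.pi⁻¹ * ∫ t in Set.Icc 0 Real.pi, φ k t * φ l t
      = if k = l then 1 else 0) :
    ∑ k ∈ s, (Real.pi⁻¹ * ∫ t in Set.Icc 0 Real.pi, h t * φ k t) ^ 2
      ≤ Real.pi⁻¹ * ∫ t in Set.Icc 0 Real.pi, h t ^ 2 := by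
  set a : ℕ → ℝ := fun k => Real.pi⁻¹ * ∫ t in Set.Icc 0 Real.pi, h t * φ k t with ha
  have hi1 : ∀ k, IntegrableOn (fun t => h t * φ k t) (Set.Icc 0 Real.pi) :=
    fun k => integrableOn_mul_of_bounded hh hB (hφ k)
  have hi2 : IntegrableOn (fun t => h t ^ 2) (Set.Icc 0 Real.pi) := by
    have := integrableOn_mul_of_bounded (hh.pow_const 2) (B := B ^ 2) (g := fun _ => 1)
      (fun t => by rw [abs_pow]; exact pow_le_pow_left₀ (abs_nonneg _) (hB t) 2) continuous_const
    simpa using this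
  have hi3 : ∀ k l, IntegrableOn (fun t => φ k t * φ l t) (Set.Icc 0 Real.pi) := fun k l =>
    ((hφ k).mul (hφ l)).continuousOn.integrableOn_compact isCompact_Icc
  have h0 : 0 ≤ Real.pi⁻¹ * ∫ t in Set.Icc 0 Real.pi, (h t - ∑ k ∈ s, a k * φ k t) ^ 2 :=
    mul_nonneg (inv_nonneg.2 Real.pi_pos.le) (integral_nonneg fun t => sq_nonneg _)
  have hexp : ∀ t, (h t - ∑ k ∈ s, a k * φ k t) ^ 2 = (h t ^ 2 - ∑ k ∈ s, 2 * a k * (h t * φ k t))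
      + ∑ k ∈ s, ∑ l ∈ s, a k * a l * (φ k t * φ l t) := by
    intro t
    rw [sub_sq, sq (∑ k ∈ s, a k * φ k t), Finset.sum_mul_sum, Finset.mul_sum]
    congr 1
    · congr 1
      exact Finset.sum_congr rfl fun k _ => by ring
    · exact Finset.sum_congr rfl fun k _ => Finset.sum_congr rfl fun l _ => by ring
  have hs1 : IntegrableOn (fun t => ∑ k ∈ s, 2 * a k * (h t * φ k t)) (Set.Icc 0 Real.pi) :=
    integrable_finsetSum _ fun k _ => (hi1 k).const_mul _
  have hs2 : IntegrableOn (fun t => ∑ k ∈ s, ∑ l ∈ s, a k * a l * (φ k t * φ l t))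
      (Set.Icc 0 Real.pi) :=
    integrable_finsetSum _ fun k _ => integrable_finsetSum _ fun l _ => (hi3 k l).const_mul _
  have e1 : Real.pi⁻¹ * ∫ t in Set.Icc 0 Real.pi, ∑ k ∈ s, 2 * a k * (h t * φ k t)
      = 2 * ∑ k ∈ s, a k ^ 2 := by
    rw [integral_finsetSum _ fun k _ => (hi1 k).const_mul _, Finset.mul_sum, Finset.mul_sum]
    refine Finset.sum_congr rfl fun k _ => ?_
    rw [integral_const_mul]
    simp only [ha]
    ring
  have e2 : Real.pi⁻¹ * ∫ t in Set.Icc 0 Real.pi, ∑ k ∈ s, ∑ l ∈ s, a k * a l * (φ k t * φ l t)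
      = ∑ k ∈ s, a k ^ 2 := by
    rw [integral_finsetSum _ fun k _ => integrable_finsetSum _ fun l _ => (hi3 k l).const_mul _,
      Finset.mul_sum]
    refine Finset.sum_congr rfl fun k hk => ?_
    rw [integral_finsetSum _ fun l _ => (hi3 k l).const_mul _, Finset.mul_sum]
    simp only [integral_const_mul, mul_left_comm Real.pi⁻¹]
    rw [Finset.sum_congr rfl fun l hl => by rw [ho k hk l hl]]
    simp [hk, sq]
  simp only [hexp] at h0
  have hs3 : IntegrableOn (fun t => h t ^ 2 - ∑ k ∈ s, 2 * a k * (h t * φ k t))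
      (Set.Icc 0 Real.pi) := hi2.sub hs1
  rw [integral_add hs3 hs2, integral_sub hi2 hs1, mul_add, mul_sub, e1, e2] at h0
  linarith

lemma integral_mul_cos_mul_cos {u : ℝ → ℝ} (hu : Measurable u) {B : ℝ} (hB : ∀ t, |u t| ≤ B)
    (i k : ℕ) : Real.pi⁻¹ * ∫ t in Set.Icc 0 Real.pi, u t *
      ((√2 * Real.cos ((i + 1 / 2) * t)) * (√2 * Real.cos ((k + 1 / 2) * t)))
      = cosCoeff u (Nat.dist i k) + cosCoeff u (i + k + 1) := by
  rw [cosCoeff, cosCoeff, ← mul_add, ← integral_add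
    (integrableOn_mul_of_bounded hu hB (by fun_prop))
    (integrableOn_mul_of_bounded hu hB (by fun_prop))]
  congr 1
  refine integral_congr_ae (.of_forall fun t => ?_)
  have hd : Real.cos ((Nat.dist i k : ℕ) * t) = Real.cos ((i + 1 / 2) * t - (k + 1 / 2) * t) := by
    rcases le_total i k with h | h
    · rw [Nat.dist_eq_sub_of_le h, Nat.cast_sub h, ← Real.cos_neg]
      congr 1; ring
    · rw [Nat.dist_eq_sub_of_le_right h, Nat.cast_sub h]
      congr 1; ring
  have hs : Real.cos ((i + k + 1 : ℕ) * t) = Real.cos ((i + 1 / 2) * t + (k + 1 / 2) * t) := by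
    congr 1; push_cast; ring
  simp only [hd, hs, Real.cos_sub, Real.cos_add]
  have := Real.mul_self_sqrt (show (0 : ℝ) ≤ 2 by norm_num)
  linear_combination (u t * Real.cos ((i + 1 / 2) * t) * Real.cos ((k + 1 / 2) * t)) * this

lemma integral_mul_sin_mul_sin {u : ℝ → ℝ} (hu : Measurable u) {B : ℝ} (hB : ∀ t, |u t| ≤ B)
    (i k : ℕ) : Real.pi⁻¹ * ∫ t in Set.Icc 0 Real.pi, u t *
      ((√2 * Real.sin (i * t)) * (√2 * Real.sin (k * t)))
      = cosCoeff u (Nat.dist i k) - cosCoeff u (i + k) := by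
  rw [cosCoeff, cosCoeff, ← mul_sub, ← integral_sub
    (integrableOn_mul_of_bounded hu hB (by fun_prop))
    (integrableOn_mul_of_bounded hu hB (by fun_prop))]
  congr 1
  refine integral_congr_ae (.of_forall fun t => ?_)
  have hd : Real.cos ((Nat.dist i k : ℕ) * t) = Real.cos (i * t - k * t) := by
    rcases le_total i k with h | h
    · rw [Nat.dist_eq_sub_of_le h, Nat.cast_sub h, ← Real.cos_neg]
      congr 1; ring
    · rw [Nat.dist_eq_sub_of_le_right h, Nat.cast_sub h]
      congr 1; ring
  have hs : Real.cos ((i + k : ℕ) * t) = Real.cos (i * t + k * t) := by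
    congr 1; push_cast; ring
  simp only [hd, hs, Real.cos_sub, Real.cos_add]
  have := Real.mul_self_sqrt (show (0 : ℝ) ≤ 2 by norm_num)
  linear_combination (u t * Real.sin (i * t) * Real.sin (k * t)) * this

lemma sum_dist_sq (g : ℕ → ℝ) {N i : ℕ} (hi : i < N) :
    ∑ k ∈ Finset.range N, g (Nat.dist i k)
      = g 0 + ∑ m ∈ Finset.range i, g (m + 1) + ∑ m ∈ Finset.range (N - 1 - i), g (m + 1) := by
  obtain ⟨r, rfl⟩ : ∃ r, N = (i + 1) + r := ⟨N - (i + 1), by omega⟩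
  rw [Finset.sum_range_add, ← Finset.sum_range_reflect, show i + 1 + r - 1 - i = r by omega]
  congr 1
  · rw [add_comm (g 0), ← Finset.sum_range_succ']
    refine Finset.sum_congr rfl fun k hk => ?_
    rw [Finset.mem_range] at hk
    rw [Nat.dist_eq_sub_of_le_right (by omega)]
    congr 1; omega
  · refine Finset.sum_congr rfl fun k _ => ?_
    rw [Nat.dist_eq_sub_of_le (by omega)]
    congr 1; omega

end linStat

/-! ### Parseval's identity for even functions -/

section parseval

variable {f : ℝ → ℝ} {B : ℝ}

lemma integral_even {E : Type*} [NormedAddCommGroup E] [NormedSpace ℝ E] {g : ℝ → E}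
    (hg : IntegrableOn g (Set.Icc (-Real.pi) Real.pi)) :
    ∫ t in (-Real.pi)..Real.pi, g t = ∫ t in Set.Icc 0 Real.pi, (g t + g (-t)) := by
  have hpi := Real.pi_pos
  have hi : IntervalIntegrable g volume (-Real.pi) Real.pi :=
    (intervalIntegrable_iff_integrableOn_Icc_of_le (by linarith)).2 hg
  have h1 : IntervalIntegrable g volume (-Real.pi) 0 :=
    hi.mono_set (by rw [Set.uIcc_of_le (by linarith), Set.uIcc_of_le (by linarith)]
                    exact Set.Icc_subset_Icc le_rfl hpi.le)
  have h2 : IntervalIntegrable g volume 0 Real.pi :=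
    hi.mono_set (by rw [Set.uIcc_of_le (by linarith), Set.uIcc_of_le (by linarith)]
                    exact Set.Icc_subset_Icc (by linarith) le_rfl)
  have h3 : IntervalIntegrable (fun t => g (-t)) volume 0 Real.pi := by
    have := (IntervalIntegrable.iff_comp_neg (by simp)).1 h1
    rw [neg_zero, neg_neg] at this
    exact this.symm
  rw [integral_Icc_eq_integral_Ioc, ← intervalIntegral.integral_of_le hpi.le,
    intervalIntegral.integral_add h2 h3, intervalIntegral.integral_comp_neg, neg_zero,
    ← intervalIntegral.integral_add_adjacent_intervals h1 h2, add_comm]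

lemma fourierCoeffOn_even (hf : Measurable f) (hB : ∀ t, |f t| ≤ B) (heven : ∀ t, f (-t) = f t)
    (h : -Real.pi < Real.pi) (n : ℤ) :
    fourierCoeffOn h (fun t => (f t : ℂ)) n = (cosCoeff f n.natAbs : ℂ) := by
  have hi : IntegrableOn (fun t : ℝ => Complex.exp (-(n * t) * Complex.I) * (f t : ℂ))
      (Set.Icc (-Real.pi) Real.pi) := by
    have h1 : Continuous fun t : ℝ => Complex.exp (-(n * t) * Complex.I) := by fun_prop
    refine (h1.continuousOn.integrableOn_compact isCompact_Icc).mul_bdd (c := B)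
      (Complex.measurable_ofReal.comp hf).aestronglyMeasurable (.of_forall fun t => ?_)
    simpa using hB t
  have h1 : ∀ t : ℝ, (fourier (-n) (t : AddCircle (Real.pi - -Real.pi))) • ((f t : ℝ) : ℂ)
      = Complex.exp (-(n * t) * Complex.I) * (f t : ℂ) := by
    intro t
    rw [fourier_coe_apply, smul_eq_mul]
    congr 2
    have : (Real.pi : ℂ) ≠ 0 := by exact_mod_cast Real.pi_ne_zero
    push_cast
    field_simp
    ring
  rw [fourierCoeffOn_eq_integral]
  simp only [h1]
  rw [integral_even hi, cosCoeff]
  have h2 : ∀ t : ℝ, Complex.exp (-(n * t) * Complex.I) * (f t : ℂ)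
      + Complex.exp (-(n * (-t : ℝ)) * Complex.I) * (f (-t) : ℂ)
      = ((2 * (f t * Real.cos ((n.natAbs : ℕ) * t)) : ℝ) : ℂ) := by
    intro t
    have hc : Real.cos ((n.natAbs : ℕ) * t) = Real.cos (n * t) := by
      rcases Int.natAbs_eq n with h | h
      · conv_rhs => rw [h]
        simp
      · conv_rhs => rw [h]
        simp
    rw [heven, hc]
    push_cast
    rw [Complex.cos]
    have e1 : -((n : ℂ) * -(t : ℂ)) * Complex.I = n * t * Complex.I := by ring
    rw [e1]
    have e2 : -((n : ℂ) * (t : ℂ)) * Complex.I = -(n * t) * Complex.I := by ring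
    rw [e2]
    ring
  simp only [h2]
  rw [integral_complex_ofReal, integral_const_mul, Complex.real_smul, ← Complex.ofReal_mul]
  congr 1
  field_simp
  ring

/-- A quantitative form of Parseval's identity for even functions. -/
lemma cosCoeff_sq_le (hf : Measurable f) (hB : ∀ t, |f t| ≤ B) (heven : ∀ t, f (-t) = f t)
    (hc : ∀ m : ℕ, m * |cosCoeff f m| ≤ 1) {K : ℕ} (hK : 1 ≤ K) :
    cosCoeff (fun t => f t ^ 2) 0
      ≤ cosCoeff f 0 ^ 2 + 2 * ∑ m ∈ Finset.range K, cosCoeff f (m + 1) ^ 2 + 2 / K := by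
  have hpi : -Real.pi < Real.pi := by linarith [Real.pi_pos]
  have hL : MemLp (fun t => (f t : ℂ)) 2 (volume.restrict (Set.Ioc (-Real.pi) Real.pi)) :=
    MemLp.of_bound (Complex.measurable_ofReal.comp hf).aestronglyMeasurable B
      (.of_forall fun t => by simpa using hB t)
  have hs := hasSum_sq_fourierCoeffOn hpi hL
  simp only [fourierCoeffOn_even hf hB heven, Complex.norm_real, Real.norm_eq_abs, sq_abs] at hs
  have hi : IntegrableOn (fun t => f t ^ 2) (Set.Icc (-Real.pi) Real.pi) :=
    Measure.integrableOn_of_bounded (M := B ^ 2) (by simp) (hf.pow_const 2).aestronglyMeasurable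
      (.of_forall fun t => by
        rw [Real.norm_eq_abs, abs_pow]; exact pow_le_pow_left₀ (abs_nonneg _) (hB t) 2)
  have hT : (Real.pi - -Real.pi)⁻¹ • ∫ t in (-Real.pi)..Real.pi, f t ^ 2
      = cosCoeff (fun t => f t ^ 2) 0 := by
    rw [integral_even hi, cosCoeff]
    simp only [heven, ← two_mul, Nat.cast_zero, zero_mul, Real.cos_zero, mul_one]
    rw [integral_const_mul, smul_eq_mul]
    field_simp
    ring
  rw [hT] at hs
  have h2 := hs.nat_add_neg.tendsto_sum_nat
  simp only [Int.natAbs_neg, Int.natAbs_natCast, Int.natAbs_zero] at h2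
  have htail : ∀ M, ∑ m ∈ Finset.range M, cosCoeff f (K + m + 1) ^ 2 ≤ 1 / K - 1 / (K + M : ℕ) := by
    intro M
    induction M with
    | zero => simp
    | succ M ih =>
      rw [Finset.sum_range_succ]
      have hKM : (0 : ℝ) < (K + M : ℕ) := by exact_mod_cast (by omega)
      have h3 : cosCoeff f (K + M + 1) ^ 2 ≤ 1 / (K + M : ℕ) - 1 / ((K + M : ℕ) + 1) := by
        have h4 := hc (K + M + 1)
        have h5 : (((K + M : ℕ) + 1) * |cosCoeff f (K + M + 1)|) ^ 2 ≤ 1 :=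
          pow_le_one₀ (by positivity) (by exact_mod_cast h4)
        rw [mul_pow, sq_abs] at h5
        rw [div_sub_div _ _ (by positivity) (by positivity), le_div_iff₀ (by positivity)]
        nlinarith [sq_nonneg (cosCoeff f (K + M + 1))]
      have h6 : ((K + (M + 1) : ℕ) : ℝ) = (K + M : ℕ) + 1 := by push_cast; ring
      rw [h6]
      linarith
  refine le_of_sub_nonneg ?_
  have hlim := le_of_tendsto' ((Filter.tendsto_add_atTop_iff_nat (K + 1)).2 h2)
    (b := 2 * cosCoeff f 0 ^ 2 + 2 * ∑ m ∈ Finset.range K, cosCoeff f (m + 1) ^ 2 + 2 / K)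
    fun M => by
      rw [show M + (K + 1) = (K + M) + 1 by ring, Finset.sum_range_succ', Finset.sum_range_add]
      simp only [← two_mul, ← Finset.mul_sum]
      have h7 := htail M
      have h8 : (0 : ℝ) ≤ 1 / (K + M : ℕ) := by positivity
      have h9 : (2 : ℝ) / K = 2 * (1 / K) := by ring
      rw [h9]
      linarith
  linarith

end parseval

/-! ### The variance bound -/

section variance

variable {f : ℝ → ℝ} {B : ℝ}

lemma two_half_row_bound {T x c₀ S P Q R : ℝ} {K : ℕ} {u v : ℕ → ℝ} {s : Finset ℕ}
    (hbessel : ∑ k ∈ s, (u k + v k) ^ 2 ≤ T + x) (hsum : ∑ k ∈ s, (u k ^ 2 + v k ^ 2) + R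
      = c₀ + P + Q) (hT : T ≤ c₀ + 2 * S + 2 / K) (hQ : S ≤ Q) :
    T - x - (∑ k ∈ s, (u k - v k) ^ 2 + 2 * R) ≤ 2 * (S - P) + 4 / K := by
  have h1 : ∑ k ∈ s, (u k + v k) ^ 2 + ∑ k ∈ s, (u k - v k) ^ 2
      = 2 * ∑ k ∈ s, (u k ^ 2 + v k ^ 2) := by
    rw [← Finset.sum_add_distrib, Finset.mul_sum]
    exact Finset.sum_congr rfl fun k _ => by ring
  have h2 : (4 : ℝ) / K = 2 * (2 / K) := by ring
  linarith

lemma bessel_coeff (hf : Measurable f) (hB : ∀ t, |f t| ≤ B) (s : Finset ℕ)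
    {φ : ℕ → ℝ → ℝ} (hφ : ∀ k, Continuous (φ k)) {i : ℕ} (hφi : ∀ t, |φ i t| ≤ √2)
    (ho : ∀ k ∈ s, ∀ l ∈ s, Real.pi⁻¹ * ∫ t in Set.Icc 0 Real.pi, 1 * (φ k t * φ l t)
      = if k = l then 1 else 0) :
    ∑ k ∈ s, (Real.pi⁻¹ * ∫ t in Set.Icc 0 Real.pi, f t * (φ i t * φ k t)) ^ 2
      ≤ Real.pi⁻¹ * ∫ t in Set.Icc 0 Real.pi, f t ^ 2 * (φ i t * φ i t) := by
  have hb : ∀ t, |f t * φ i t| ≤ B * √2 := fun t => by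
    rw [abs_mul]
    exact mul_le_mul (hB t) (hφi t) (abs_nonneg _) ((abs_nonneg _).trans (hB t))
  have h := bessel_Icc (hf.mul (hφ i).measurable) hb s hφ (by simpa using ho)
  simpa only [Pi.mul_apply, mul_assoc, mul_pow, ← sq] using h

lemma abs_sqrt_two_mul_le {x : ℝ} (hx : |x| ≤ 1) : |√2 * x| ≤ √2 := by
  rw [abs_mul, abs_of_nonneg (Real.sqrt_nonneg 2)]
  exact mul_le_of_le_one_right (Real.sqrt_nonneg 2) hx

lemma row_variance_le {e : ℕ} (he : e ≤ 1) (hf : Measurable f) (hB : ∀ t, |f t| ≤ B)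
    (heven : ∀ t, f (-t) = f t) (hc : ∀ m : ℕ, m * |cosCoeff f m| ≤ 1) {N i : ℕ} (hi : i < N) :
    trigGram e (fun t => f t ^ 2) i i - ∑ k ∈ Finset.range N, trigGram e f i k ^ 2
      ≤ 2 * (∑ m ∈ Finset.range N, cosCoeff f (m + 1) ^ 2
        - ∑ m ∈ Finset.range (N - 1 - i), cosCoeff f (m + 1) ^ 2) + 4 / N := by
  have hT := cosCoeff_sq_le hf hB heven hc (K := N) (by omega)
  have hf2 : Measurable fun t => f t ^ 2 := hf.pow_const 2
  have hB2 : ∀ t, |f t ^ 2| ≤ B ^ 2 := fun t => by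
    rw [abs_pow]; exact pow_le_pow_left₀ (abs_nonneg _) (hB t) 2
  have hmono : ∀ {a b : ℕ}, a ≤ b → ∑ m ∈ Finset.range a, cosCoeff f (m + 1) ^ 2
      ≤ ∑ m ∈ Finset.range b, cosCoeff f (m + 1) ^ 2 := fun h =>
    Finset.sum_le_sum_of_subset_of_nonneg (Finset.range_mono h) fun _ _ _ => sq_nonneg _
  have hone : ∀ t : ℝ, |(fun _ => (1 : ℝ)) t| ≤ 1 := by simp
  have hdist := sum_dist_sq (fun m => cosCoeff f m ^ 2) hi
  have hcat : ∀ r, ∑ m ∈ Finset.range i, cosCoeff f (m + 1) ^ 2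
      + ∑ k ∈ Finset.range r, cosCoeff f (i + k + 1) ^ 2
      = ∑ m ∈ Finset.range (i + r), cosCoeff f (m + 1) ^ 2 := fun r => by
    rw [Finset.sum_range_add]
  interval_cases e
  · rcases Nat.eq_zero_or_pos i with h0 | h0
    · subst h0
      obtain ⟨M, rfl⟩ : ∃ M, N = M + 1 := ⟨N - 1, by omega⟩
      have h1 : trigGram 0 (fun t => f t ^ 2) 0 0 = cosCoeff (fun t => f t ^ 2) 0 := by
        rw [trigGram_zero hf2 hB2]; simp [trigWeight]; ring
      have h2 : ∑ k ∈ Finset.range (M + 1), trigGram 0 f 0 k ^ 2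
          = cosCoeff f 0 ^ 2 + 2 * ∑ m ∈ Finset.range M, cosCoeff f (m + 1) ^ 2 := by
        rw [Finset.sum_range_succ', add_comm, Finset.mul_sum]
        simp only [trigGram_zero hf hB]
        congr 1
        · simp [trigWeight]; ring
        · refine Finset.sum_congr rfl fun k _ => ?_
          have hd : Nat.dist 0 (k + 1) = k + 1 := by simp [Nat.dist]
          have hs : √2 ^ 2 = (2 : ℝ) := Real.sq_sqrt (by norm_num)
          simp only [hd, zero_add, trigWeight, true_and, if_true, Nat.add_eq_zero_iff, one_ne_zero,
            and_false, if_false]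
          linear_combination cosCoeff f (k + 1) ^ 2 * hs
      rw [h1, h2, Nat.add_sub_cancel, Nat.sub_zero]
      have h3 : (4 : ℝ) / (M + 1 : ℕ) = 2 / (M + 1 : ℕ) + 2 / (M + 1 : ℕ) := by ring
      have h4 : (0 : ℝ) ≤ 2 / (M + 1 : ℕ) := by positivity
      linarith
    · obtain ⟨M, rfl⟩ : ∃ M, N = M + 1 := ⟨N - 1, by omega⟩
      have hφ : ∀ k : ℕ, Continuous fun t : ℝ => √2 * Real.sin (k * t) := fun k => by fun_prop
      have hb := bessel_coeff hf hB (Finset.image Nat.succ (Finset.range M)) hφ (i := i)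
        (fun t => abs_sqrt_two_mul_le (Real.abs_sin_le_one _)) (fun k hk l hl => by
          rw [integral_mul_sin_mul_sin (u := fun _ => 1) measurable_const hone,
            cosCoeff_const_one, cosCoeff_const_one]
          have : k + l ≠ 0 := by
            obtain ⟨k', -, rfl⟩ := Finset.mem_image.1 hk
            omega
          by_cases h : k = l
          · simp [h, show l ≠ 0 by omega]
          · have h' : Nat.dist k l ≠ 0 := fun h' => h (Nat.eq_of_dist_eq_zero h')
            rw [if_neg h', if_neg this, if_neg h, sub_zero])
      rw [Finset.sum_image fun _ _ _ _ h => Nat.succ_injective h] at hb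
      simp only [integral_mul_sin_mul_sin hf hB, integral_mul_sin_mul_sin hf2 hB2, Nat.dist_self]
        at hb
      have hw : trigWeight 0 i = √2 := by simp [trigWeight, h0.ne']
      have hs : √2 * √2 = (2 : ℝ) := Real.mul_self_sqrt (by norm_num)
      have h1 : trigGram 0 (fun t => f t ^ 2) i i
          = cosCoeff (fun t => f t ^ 2) 0 - -cosCoeff (fun t => f t ^ 2) (i + i) := by
        rw [trigGram_zero hf2 hB2, hw, Nat.dist_self, hs]; ring
      have h2 : ∑ k ∈ Finset.range (M + 1), trigGram 0 f i k ^ 2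
          = ∑ k ∈ Finset.range M, (cosCoeff f (Nat.dist i k.succ) - -cosCoeff f (i + k.succ)) ^ 2
            + 2 * cosCoeff f i ^ 2 := by
        rw [Finset.sum_range_succ']
        simp only [trigGram_zero hf hB, hw]
        congr 1
        · refine Finset.sum_congr rfl fun k _ => ?_
          simp only [trigWeight, Nat.add_eq_zero_iff, one_ne_zero, and_false, if_false, hs]
          ring
        · have hd : Nat.dist i 0 = i := by simp [Nat.dist]
          simp only [hd, add_zero, trigWeight, and_self, if_true]
          linear_combination cosCoeff f i ^ 2 * hs
      rw [h1, h2]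
      refine two_half_row_bound (by simpa only [← sub_eq_add_neg] using hb) ?_ hT
        (hmono (b := i + M) (by omega)) (R := cosCoeff f i ^ 2)
      rw [← hcat, Finset.sum_add_distrib]
      rw [Finset.sum_range_succ'] at hdist
      have hd : Nat.dist i 0 = i := by simp [Nat.dist]
      rw [hd] at hdist
      simp only [neg_sq, Nat.succ_eq_add_one, ← add_assoc]
      linarith
  · have hφ : ∀ k : ℕ, Continuous fun t : ℝ => √2 * Real.cos ((k + 1 / 2) * t) := fun k => by
      fun_prop
    have hb := bessel_coeff hf hB (Finset.range N) hφ (i := i)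
      (fun t => abs_sqrt_two_mul_le (Real.abs_cos_le_one _)) (fun k hk l hl => by
        rw [integral_mul_cos_mul_cos (u := fun _ => 1) measurable_const hone,
          cosCoeff_const_one, cosCoeff_const_one]
        by_cases h : k = l
        · simp [h]
        · have h' : Nat.dist k l ≠ 0 := fun h' => h (Nat.eq_of_dist_eq_zero h')
          rw [if_neg h', if_neg (by omega), if_neg h, add_zero])
    simp only [integral_mul_cos_mul_cos hf hB, integral_mul_cos_mul_cos hf2 hB2, Nat.dist_self]
      at hb
    simp only [trigGram_one hf hB, trigGram_one hf2 hB2, Nat.dist_self]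
    have := two_half_row_bound hb (R := 0) (P := ∑ m ∈ Finset.range (N - 1 - i),
      cosCoeff f (m + 1) ^ 2) (Q := ∑ m ∈ Finset.range (i + N), cosCoeff f (m + 1) ^ 2) ?_ hT
        (hmono (by omega))
    · simpa using this
    · rw [← hcat, Finset.sum_add_distrib]
      linarith

lemma sum_range_tails (g : ℕ → ℝ) (N : ℕ) :
    ∑ i ∈ Finset.range N, (∑ m ∈ Finset.range N, g (m + 1) - ∑ m ∈ Finset.range (N - 1 - i), g (m + 1))
      = ∑ m ∈ Finset.range N, ((m + 1 : ℕ) : ℝ) * g (m + 1) := by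
  rw [Finset.sum_range_reflect
    (fun i => ∑ m ∈ Finset.range N, g (m + 1) - ∑ m ∈ Finset.range i, g (m + 1))]
  induction N with
  | zero => simp
  | succ N ih =>
    rw [Finset.sum_range_succ _ N, Finset.sum_range_succ (fun m => ((m + 1 : ℕ) : ℝ) * g (m + 1)) N,
      ← ih]
    simp only [Finset.sum_range_succ _ N, add_sub_right_comm]
    rw [Finset.sum_add_distrib]
    simp
    ring

/-- Variance of a linear statistic in terms of cosine coefficients. -/
lemma variance_weylMeasure_le {e : ℕ} (he : e ≤ 1) (hf : Measurable f) (hB : ∀ t, |f t| ≤ B)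
    (heven : ∀ t, f (-t) = f t) (hc : ∀ m : ℕ, m * |cosCoeff f m| ≤ 1) (N : ℕ) :
    ∫ θ, (∑ j, f (θ j)) ^ 2 ∂(weylMeasure N e) - (∫ θ, ∑ j, f (θ j) ∂(weylMeasure N e)) ^ 2
      ≤ 2 * ∑ m ∈ Finset.range N, ((m + 1 : ℕ) : ℝ) * cosCoeff f (m + 1) ^ 2 + 4 := by
  rw [variance_weylMeasure he N hf hB]
  refine (Finset.sum_le_sum fun i hi => row_variance_le he hf hB heven hc
    (Finset.mem_range.1 hi)).trans ?_
  rw [Finset.sum_add_distrib, ← Finset.mul_sum, sum_range_tails (fun m => cosCoeff f m ^ 2)]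
  gcongr
  rw [Finset.sum_const, Finset.card_range, nsmul_eq_mul]
  rcases Nat.eq_zero_or_pos N with h | h
  · simp [h]
  · have : (N : ℝ) ≠ 0 := by positivity
    rw [mul_div_cancel₀ _ this]

end variance

/-! ### Cosine coefficients of the counting function -/

section counting

variable {a b : ℝ}

lemma measurable_eigenangle : Measurable eigenangle := by
  unfold eigenangle
  exact Measurable.ite (Complex.measurable_arg (measurableSet_singleton _)) measurable_const
    (Complex.measurable_arg.div_const _)

lemma measurable_countFun (a b : ℝ) : Measurable (countFun a b) := by
  have h : Measurable fun t : ℝ => eigenangle (circlePoint t) := by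
    refine measurable_eigenangle.comp (Continuous.measurable ?_)
    unfold circlePoint
    fun_prop
  have h' : Measurable fun t : ℝ => eigenangle (circlePoint (-t)) := h.comp measurable_neg
  unfold countFun
  refine Measurable.add ?_ ?_
  · exact Measurable.ite ((measurableSet_le measurable_const h).inter
      (measurableSet_lt h measurable_const)) measurable_const measurable_const
  · exact Measurable.ite ((measurableSet_le measurable_const h').inter
      (measurableSet_lt h' measurable_const)) measurable_const measurable_const

lemma abs_countFun_le (a b t : ℝ) : |countFun a b t| ≤ 2 := by
  unfold countFun
  split_ifs <;> norm_num

lemma countFun_neg (a b t : ℝ) : countFun a b (-t) = countFun a b t := by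
  unfold countFun
  rw [neg_neg, add_comm]

lemma cosCoeff_countFun (ha : -(1 / 2) ≤ a) (hab : a ≤ b) (hb : b ≤ 1 / 2) (m : ℕ) :
    cosCoeff (countFun a b) m
      = Real.pi⁻¹ * ∫ t in (2 * Real.pi * a)..(2 * Real.pi * b), Real.cos (m * t) := by
  have hpi := Real.pi_pos
  set S : Set ℝ := Set.Ico (2 * Real.pi * a) (2 * Real.pi * b) with hS
  have hi : IntegrableOn (S.indicator fun t => Real.cos (m * t)) (Set.Icc (-Real.pi) Real.pi) :=
    IntegrableOn.indicator (Continuous.integrableOn_Icc (by fun_prop)) measurableSet_Ico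
  have h := integral_even hi
  have hSm : ∀ t, t ∈ S ↔ a ≤ t / (2 * Real.pi) ∧ t / (2 * Real.pi) < b := fun t => by
    rw [hS, Set.mem_Ico, le_div_iff₀ (by positivity), div_lt_iff₀ (by positivity),
      mul_comm a, mul_comm b]
  have h1 : ∫ t in Set.Icc 0 Real.pi, countFun a b t * Real.cos (m * t)
      = ∫ t in Set.Icc 0 Real.pi, (S.indicator (fun t => Real.cos (m * t)) t
        + S.indicator (fun t => Real.cos (m * t)) (-t)) := by
    rw [integral_Icc_eq_integral_Ico, integral_Icc_eq_integral_Ico]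
    refine setIntegral_congr_fun measurableSet_Ico fun t ht => ?_
    simp only [countFun_eq ht, Set.indicator_apply, hSm, mul_neg, Real.cos_neg]
    split_ifs <;> ring
  rw [cosCoeff, h1, ← h, intervalIntegral.integral_of_le (by linarith),
    intervalIntegral.integral_of_le (by nlinarith), ← integral_Icc_eq_integral_Ioc,
    integral_Icc_eq_integral_Ico, setIntegral_indicator measurableSet_Ico,
    ← integral_Ico_eq_integral_Ioc]
  congr 2
  congr 1
  refine Set.inter_eq_right.2 (Set.Ico_subset_Ico ?_ ?_) <;> nlinarith

lemma cosCoeff_countFun_zero (ha : -(1 / 2) ≤ a) (hab : a ≤ b) (hb : b ≤ 1 / 2) :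
    cosCoeff (countFun a b) 0 = 2 * (b - a) := by
  have := Real.pi_ne_zero
  rw [cosCoeff_countFun ha hab hb]
  simp
  field_simp

lemma cosCoeff_countFun_of_pos (ha : -(1 / 2) ≤ a) (hab : a ≤ b) (hb : b ≤ 1 / 2) {m : ℕ}
    (hm : m ≠ 0) : cosCoeff (countFun a b) m
      = Real.pi⁻¹ * (Real.sin (m * (2 * Real.pi * b)) / m - Real.sin (m * (2 * Real.pi * a)) / m) := by
  have hm' : (m : ℝ) ≠ 0 := by exact_mod_cast hm
  rw [cosCoeff_countFun ha hab hb,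
    intervalIntegral.integral_comp_mul_left (fun x => Real.cos x) hm', integral_cos, smul_eq_mul]
  ring

lemma mul_abs_cosCoeff_countFun_le (ha : -(1 / 2) ≤ a) (hab : a ≤ b) (hb : b ≤ 1 / 2) (m : ℕ) :
    m * |cosCoeff (countFun a b) m| ≤ 1 := by
  rcases Nat.eq_zero_or_pos m with h | h
  · simp [h]
  have hm : (0 : ℝ) < m := by exact_mod_cast h
  rw [cosCoeff_countFun_of_pos ha hab hb h.ne', ← sub_div, abs_mul, abs_div, abs_of_pos hm,
    abs_of_pos (inv_pos.2 Real.pi_pos)]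
  have h1 := abs_sub (Real.sin (m * (2 * Real.pi * b))) (Real.sin (m * (2 * Real.pi * a)))
  have h2 := Real.abs_sin_le_one (m * (2 * Real.pi * b))
  have h3 := Real.abs_sin_le_one (m * (2 * Real.pi * a))
  have h4 := Real.two_le_pi
  rw [mul_left_comm, mul_div_cancel₀ _ hm.ne', inv_mul_le_iff₀ Real.pi_pos]
  linarith

lemma abs_cosCoeff_countFun_le (ha : -(1 / 2) ≤ a) (hab : a ≤ b) (hb : b ≤ 1 / 2) (m : ℕ) :
    |cosCoeff (countFun a b) m| ≤ 2 * (b - a) := by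
  have hpi := Real.pi_pos
  rw [cosCoeff_countFun ha hab hb, abs_mul, abs_of_pos (inv_pos.2 hpi), inv_mul_le_iff₀ hpi]
  have h := intervalIntegral.norm_integral_le_of_norm_le_const (a := 2 * Real.pi * a)
    (b := 2 * Real.pi * b) (f := fun t => Real.cos (m * t)) (C := 1)
    fun t _ => Real.abs_cos_le_one _
  rw [Real.norm_eq_abs, ← mul_sub, abs_of_nonneg (a := 2 * Real.pi * (b - a))
    (mul_nonneg (by positivity) (sub_nonneg.2 hab))] at h
  linarith

/-- Telescoping comparison of `∑ m c_m ^ 2` with a logarithm. -/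
lemma sum_mul_sq_le_log {c : ℕ → ℝ} {L : ℝ} (hL : 0 ≤ L) (h1 : ∀ m : ℕ, m * |c m| ≤ 1)
    (h2 : ∀ m, |c m| ≤ 2 * L) (N : ℕ) :
    ∑ m ∈ Finset.range N, ((m + 1 : ℕ) : ℝ) * c (m + 1) ^ 2 ≤ 8 * Real.log (1 + N * L) := by
  induction N with
  | zero => simp
  | succ N ih =>
    rw [Finset.sum_range_succ]
    set M : ℝ := ((N + 1 : ℕ) : ℝ) with hM
    have hN : (0 : ℝ) ≤ N := Nat.cast_nonneg _
    have hMN : M = N + 1 := by rw [hM]; push_cast; ring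
    have hM0 : 0 < M := by linarith
    have hp : 0 < 1 + N * L := by positivity
    have hq : 0 < 1 + M * L := by positivity
    have hlog : L / (1 + M * L) ≤ Real.log (1 + M * L) - Real.log (1 + N * L) := by
      rw [← Real.log_div hq.ne' hp.ne']
      have := Real.one_sub_inv_le_log_of_pos (div_pos hq hp)
      refine le_trans (le_of_eq ?_) this
      rw [inv_div, hMN]
      rw [hMN] at hq
      field_simp
      ring
    have hterm : M * c (N + 1) ^ 2 ≤ 8 * (L / (1 + M * L)) := by
      have a1 := h1 (N + 1)
      have a2 := h2 (N + 1)
      rw [← hM] at a1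
      set y := |c (N + 1)| with hy
      have hy0 : 0 ≤ y := abs_nonneg _
      rw [← sq_abs, ← hy, ← mul_div_assoc, le_div_iff₀ hq]
      have b1 : M * y ^ 2 ≤ 2 * L := by nlinarith
      have b2 : M * y ^ 2 * (M * L) ≤ L := by
        have : (M * y) ^ 2 ≤ 1 := pow_le_one₀ (by positivity) a1
        calc M * y ^ 2 * (M * L) = (M * y) ^ 2 * L := by ring
          _ ≤ 1 * L := by gcongr
          _ = L := one_mul L
      linarith
    linarith

/-! ### Bounded partial sums of the sawtooth series -/

lemma abs_sum_sin_div_le (x : ℝ) (N : ℕ) :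
    |∑ k ∈ Finset.range N, Real.sin (k * x) / k| ≤ 7 := by
  rcases Nat.eq_zero_or_pos N with h | hN
  · simp [h]
  have hN' : (0 : ℝ) < N := by exact_mod_cast hN
  have hN1 : (1 : ℝ) ≤ N := by exact_mod_cast hN
  set r : ℝ := 1 - 1 / (N + 1) with hr
  have hr0 : 0 ≤ r := by
    rw [hr, sub_nonneg, div_le_one (by positivity)]; linarith
  have hr1 : r < 1 := by rw [hr]; linarith [show (0 : ℝ) < 1 / (N + 1) by positivity]
  set z : ℂ := r * Complex.exp (x * Complex.I) with hz
  have hzn : ‖z‖ < 1 := by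
    rw [hz, norm_mul, Complex.norm_exp_ofReal_mul_I, mul_one, Complex.norm_real,
      Real.norm_eq_abs, abs_of_nonneg hr0]
    exact hr1
  have hs := Complex.hasSum_im (Complex.hasSum_taylorSeries_neg_log hzn)
  have hterm : ∀ k : ℕ, (z ^ k / k).im = r ^ k * Real.sin (k * x) / k := by
    intro k
    have e1 : z ^ k = ((r ^ k : ℝ) : ℂ) * Complex.exp ((k * x : ℝ) * Complex.I) := by
      rw [hz, mul_pow, ← Complex.exp_nat_mul]
      push_cast
      congr 2; ring
    rw [e1, ← Complex.ofReal_natCast, Complex.div_ofReal_im, Complex.im_ofReal_mul,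
      Complex.exp_ofReal_mul_I_im]
  simp only [hterm] at hs
  have hlim : |(-Complex.log (1 - z)).im| ≤ 4 := by
    rw [Complex.neg_im, abs_neg, Complex.log_im]
    exact (Complex.abs_arg_le_pi _).trans Real.pi_le_four
  have hsum := hs.summable
  have hsplit := hsum.sum_add_tsum_nat_add N
  rw [hs.tsum_eq] at hsplit
  have hr_inv : 1 - r = 1 / (N + 1) := by rw [hr]; ring
  have hgeo := (hasSum_geometric_of_lt_one hr0 hr1)
  have htail : |∑' k : ℕ, r ^ (k + N) * Real.sin ((k + N : ℕ) * x) / (k + N : ℕ)| ≤ 2 := by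
    have h := tsum_of_norm_bounded (hgeo.mul_left (1 / (N : ℝ)))
      (f := fun k : ℕ => r ^ (k + N) * Real.sin ((k + N : ℕ) * x) / (k + N : ℕ)) fun k => by
        have hkN : (N : ℝ) ≤ (k + N : ℕ) := by exact_mod_cast Nat.le_add_left N k
        rw [Real.norm_eq_abs, abs_div, abs_mul, abs_of_nonneg (pow_nonneg hr0 _),
          abs_of_pos (hN'.trans_le hkN), one_div_mul_eq_div]
        gcongr
        calc r ^ (k + N) * |Real.sin ((k + N : ℕ) * x)| ≤ r ^ k * 1 := by
              refine mul_le_mul (pow_le_pow_of_le_one hr0 hr1.le (Nat.le_add_right k N))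
                (Real.abs_sin_le_one _) (abs_nonneg _) (pow_nonneg hr0 _)
          _ = r ^ k := mul_one _
    refine h.trans ?_
    rw [hr_inv, one_div, one_div, inv_inv, inv_mul_le_iff₀ hN']
    linarith
  have hhead : |∑ k ∈ Finset.range N, (Real.sin (k * x) / k - r ^ k * Real.sin (k * x) / k)|
      ≤ 1 := by
    refine (Finset.abs_sum_le_sum_abs _ _).trans ?_
    have : ∀ k ∈ Finset.range N, |Real.sin (k * x) / k - r ^ k * Real.sin (k * x) / k|
        ≤ 1 / (N + 1) := by
      intro k _
      rcases Nat.eq_zero_or_pos k with h | hk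
      · simp [h]; positivity
      have hk' : (0 : ℝ) < k := by exact_mod_cast hk
      have hb : 1 - k * (1 / ((N : ℝ) + 1)) ≤ r ^ k := by
        have := one_add_mul_le_pow (a := -(1 / ((N : ℝ) + 1))) (by
          have : 1 / ((N : ℝ) + 1) ≤ 1 := by rw [div_le_one (by positivity)]; linarith
          linarith) k
        rw [hr, sub_eq_add_neg 1 (1 / ((N : ℝ) + 1))]
        linarith
      have hle : r ^ k ≤ 1 := pow_le_one₀ hr0 hr1.le
      rw [show Real.sin (k * x) / k - r ^ k * Real.sin (k * x) / k
        = (1 - r ^ k) * Real.sin (k * x) / k by ring, abs_div, abs_mul, abs_of_pos hk',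
        abs_of_nonneg (by linarith), div_le_iff₀ hk']
      have := Real.abs_sin_le_one (k * x)
      nlinarith [abs_nonneg (Real.sin (k * x))]
    refine (Finset.sum_le_sum this).trans ?_
    rw [Finset.sum_const, Finset.card_range, nsmul_eq_mul, mul_one_div, div_le_one (by positivity)]
    linarith
  rw [Finset.sum_sub_distrib] at hhead
  rw [abs_le] at hhead htail hlim ⊢
  constructor <;> linarith [hhead.1, hhead.2, htail.1, htail.2, hlim.1, hlim.2]

end counting

/-! ### The mean and the final estimates -/

lemma abs_sum_sin_even_div_le (x : ℝ) (N : ℕ) :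
    |∑ k ∈ Finset.range N, Real.sin ((2 * k : ℕ) * x) / (2 * k : ℕ)| ≤ 7 / 2 := by
  have h : ∑ k ∈ Finset.range N, Real.sin ((2 * k : ℕ) * x) / (2 * k : ℕ)
      = 1 / 2 * ∑ k ∈ Finset.range N, Real.sin (k * (2 * x)) / k := by
    rw [Finset.mul_sum]
    refine Finset.sum_congr rfl fun k _ => ?_
    push_cast
    rw [show (2 : ℝ) * k * x = k * (2 * x) by ring, div_mul_div_comm, one_mul]
  rw [h, abs_mul, abs_of_pos (by norm_num : (0 : ℝ) < 1 / 2)]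
  linarith [abs_sum_sin_div_le (2 * x) N]

lemma abs_sum_sin_odd_div_le (x : ℝ) (N : ℕ) :
    |∑ k ∈ Finset.range N, Real.sin ((2 * k + 1 : ℕ) * x) / (2 * k + 1 : ℕ)| ≤ 21 / 2 := by
  have h : ∀ M : ℕ, ∑ k ∈ Finset.range M, Real.sin ((2 * k + 1 : ℕ) * x) / (2 * k + 1 : ℕ)
      = ∑ k ∈ Finset.range (2 * M), Real.sin (k * x) / k
        - ∑ k ∈ Finset.range M, Real.sin ((2 * k : ℕ) * x) / (2 * k : ℕ) := by
    intro M
    induction M with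
    | zero => simp
    | succ M ih =>
      rw [Finset.sum_range_succ, ih, Finset.sum_range_succ _ M, show 2 * (M + 1) = 2 * M + 1 + 1 by
        ring, Finset.sum_range_succ, Finset.sum_range_succ]
      ring
  rw [h]
  have h1 := abs_le.1 (abs_sum_sin_div_le x (2 * N))
  have h2 := abs_le.1 (abs_sum_sin_even_div_le x N)
  exact abs_le.2 ⟨by linarith, by linarith⟩

section final

variable {a b : ℝ}

lemma trigGram_zero_countFun (ha : -(1 / 2) ≤ a) (hab : a ≤ b) (hb : b ≤ 1 / 2) (i : ℕ) :
    trigGram 0 (countFun a b) i i = 2 * (b - a) + Real.pi⁻¹ *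
      (Real.sin ((2 * i : ℕ) * (2 * Real.pi * b)) / (2 * i : ℕ)
        - Real.sin ((2 * i : ℕ) * (2 * Real.pi * a)) / (2 * i : ℕ)) := by
  rw [trigGram_zero (measurable_countFun a b) (abs_countFun_le a b), Nat.dist_self, ← two_mul,
    cosCoeff_countFun_zero ha hab hb]
  rcases eq_or_ne i 0 with rfl | hi
  · simp [trigWeight, cosCoeff_countFun_zero ha hab hb]
    ring
  · rw [cosCoeff_countFun_of_pos ha hab hb (by omega)]
    simp [trigWeight, hi]

lemma trigGram_one_countFun (ha : -(1 / 2) ≤ a) (hab : a ≤ b) (hb : b ≤ 1 / 2) (i : ℕ) :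
    trigGram 1 (countFun a b) i i = 2 * (b - a) - Real.pi⁻¹ *
      (Real.sin ((2 * i + 1 : ℕ) * (2 * Real.pi * b)) / (2 * i + 1 : ℕ)
        - Real.sin ((2 * i + 1 : ℕ) * (2 * Real.pi * a)) / (2 * i + 1 : ℕ)) := by
  rw [trigGram_one (measurable_countFun a b) (abs_countFun_le a b), Nat.dist_self, ← two_mul,
    cosCoeff_countFun_zero ha hab hb, cosCoeff_countFun_of_pos ha hab hb (by omega)]

lemma abs_pi_inv_mul_sub_le {x y M : ℝ} (hx : |x| ≤ M) (hy : |y| ≤ M) :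
    |Real.pi⁻¹ * (x - y)| ≤ 2 * M := by
  have h1 : |x - y| ≤ 2 * M := (abs_sub x y).trans (by linarith)
  have h2 : Real.pi⁻¹ ≤ 1 := inv_le_one_of_one_le₀ (by linarith [Real.pi_gt_three])
  have h3 : 0 < Real.pi⁻¹ := inv_pos.2 Real.pi_pos
  rw [abs_mul, abs_of_pos h3]
  nlinarith [abs_nonneg (x - y)]

lemma abs_sum_trigGram_countFun_sub_le {e : ℕ} (he : e ≤ 1) (ha : -(1 / 2) ≤ a) (hab : a ≤ b)
    (hb : b ≤ 1 / 2) (N : ℕ) :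
    |∑ i : Fin N, trigGram e (countFun a b) i i - 2 * N * (b - a)| ≤ 21 := by
  rw [Fin.sum_univ_eq_sum_range fun i => trigGram e (countFun a b) i i]
  obtain rfl | rfl : e = 0 ∨ e = 1 := by omega
  · simp only [trigGram_zero_countFun ha hab hb, Finset.sum_add_distrib, ← Finset.mul_sum,
      Finset.sum_sub_distrib, Finset.sum_const, Finset.card_range, nsmul_eq_mul]
    rw [show ∀ y : ℝ, 2 * (N * b - N * a) + y - 2 * N * (b - a) = y by intro y; ring]
    exact (abs_pi_inv_mul_sub_le (abs_sum_sin_even_div_le _ _)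
      (abs_sum_sin_even_div_le _ _)).trans (by norm_num)
  · simp only [trigGram_one_countFun ha hab hb, Finset.sum_sub_distrib, ← Finset.mul_sum,
      Finset.sum_const, Finset.card_range, nsmul_eq_mul]
    rw [show ∀ y : ℝ, 2 * (N * b - N * a) - y - 2 * N * (b - a) = -y by intro y; ring, abs_neg]
    exact (abs_pi_inv_mul_sub_le (abs_sum_sin_odd_div_le _ _)
      (abs_sum_sin_odd_div_le _ _)).trans (by norm_num)

lemma SOeigCount_estimates_of_parity {e : ℕ} (he : e ≤ 1) (N : ℕ)
    [MeasurableSpace (SOGroup (2 * N + e))] [BorelSpace (SOGroup (2 * N + e))]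
    (μ : Measure (SOGroup (2 * N + e))) [μ.IsHaarMeasure] [IsProbabilityMeasure μ]
    (ha : -(1 / 2) ≤ a) (hab : a ≤ b) (hb : b ≤ 1 / 2) :
    |(∫ g, (SOeigCount (2 * N + e) g a b : ℝ) ∂μ) - ((2 * N + e : ℕ) : ℝ) * (b - a)| ≤ 23 ∧
      ProbabilityTheory.variance (fun g => (SOeigCount (2 * N + e) g a b : ℝ)) μ ≤
        23 * Real.log (2 + ((2 * N + e : ℕ) : ℝ) * (b - a)) := by
  obtain ⟨h1, h2⟩ := moments_SOeigCount he N μ hab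
  have hL : 0 ≤ b - a := by linarith
  have hN : (0 : ℝ) ≤ N := N.cast_nonneg
  have he0 : (0 : ℝ) ≤ e := e.cast_nonneg
  have he1 : (e : ℝ) ≤ 1 := by exact_mod_cast he
  constructor
  · rw [h1, (moments_weylMeasure he N (measurable_countFun a b) (abs_countFun_le a b)).1]
    have h3 := abs_le.1 (abs_sum_trigGram_countFun_sub_le he ha hab hb N)
    set s : ℝ := if a ≤ eigenangle 1 ∧ eigenangle 1 < b then 1 else 0 with hs
    have hs0 : 0 ≤ s := by rw [hs]; split_ifs <;> norm_num
    have hs1 : s ≤ 1 := by rw [hs]; split_ifs <;> norm_num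
    have h4 : (e : ℝ) * s ≤ 1 := mul_le_one₀ he1 hs0 hs1
    have h5 : (e : ℝ) * (b - a) ≤ 1 := mul_le_one₀ he1 hL (by linarith)
    have h6 : 0 ≤ (e : ℝ) * s := by positivity
    have h7 : 0 ≤ (e : ℝ) * (b - a) := by positivity
    push_cast
    rw [add_mul]
    exact abs_le.2 ⟨by linarith, by linarith⟩
  · rw [h2]
    refine (variance_weylMeasure_le he (measurable_countFun a b) (abs_countFun_le a b)
      (countFun_neg a b) (mul_abs_cosCoeff_countFun_le ha hab hb) N).trans ?_
    have h3 := sum_mul_sq_le_log hL (mul_abs_cosCoeff_countFun_le ha hab hb)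
      (abs_cosCoeff_countFun_le ha hab hb) N
    have h4 : Real.log (1 + N * (b - a)) ≤ Real.log (2 + ((2 * N + e : ℕ) : ℝ) * (b - a)) := by
      refine Real.log_le_log (by positivity) ?_
      push_cast
      nlinarith [mul_nonneg hN hL, mul_nonneg he0 hL]
    have h5 : Real.log 2 ≤ Real.log (2 + ((2 * N + e : ℕ) : ℝ) * (b - a)) :=
      Real.log_le_log (by norm_num) (le_add_of_nonneg_right (by positivity))
    linarith [Real.log_two_gt_d9]

end final

/-- **Uniform eigenvalue count estimates for Haar-random `SO(n)`.** There is an absolute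
constant `C > 0` such that for every `n ≥ 1`, with `g` Haar-distributed on `SO(n)` and
`U_I^{(n)}` the number of eigenangles of `g` in an interval `I = [a,b) ⊆ [−1/2, 1/2)`:
`|E[U_I^{(n)}] − n·|I|| ≤ C` and `Var(U_I^{(n)}) ≤ C·log(2 + n·|I|)`. -/
theorem SO_eigenvalue_count_estimates :
    ∃ C : ℝ, 0 < C ∧ ∀ (n : ℕ), 1 ≤ n →
      ∀ [MeasurableSpace ↥(SOGroup n)] [BorelSpace ↥(SOGroup n)],
      ∀ μ : Measure ↥(SOGroup n), μ.IsHaarMeasure → IsProbabilityMeasure μ →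
      ∀ a b : ℝ, -(1 / 2) ≤ a → a ≤ b → b ≤ 1 / 2 →
        |(∫ g, (SOeigCount n g a b : ℝ) ∂μ) - (n : ℝ) * (b - a)| ≤ C ∧
        ProbabilityTheory.variance (fun g => (SOeigCount n g a b : ℝ)) μ ≤
          C * Real.log (2 + (n : ℝ) * (b - a)) := by
  refine ⟨23, by norm_num, fun n _ => ?_⟩
  obtain ⟨N, e, he, rfl⟩ : ∃ N e : ℕ, e ≤ 1 ∧ n = 2 * N + e := ⟨n / 2, n % 2, by omega, by omega⟩
  intro _ _ μ _ _ a b ha hab hb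
  exact SOeigCount_estimates_of_parity he N μ ha hab hb
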